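/- In the non-degenerate case ρσ > 0: the system (2.12)–(2.13), with diffusion matrix Σ_W(x₁,x₂) having rows (ρ·1{x₁>x₂}, σ·1{x₁≤x₂}) and (−ρ·1{x₁≤x₂}, −σ·1{x₁>x₂}), admits a strong solution and is therefore pathwise unique; whereas the system (2.14)–(2.15), with diffusion matrix Σ_V(x₁,x₂) having rows (ρ·1{x₁>x₂}, σ·1{x₁≤x₂}) and (ρ·1{x₁≤x₂}, σ·1{x₁>x₂}), admits no strong solution. -/

import Mathlib

open MeasureTheory ProbabilityTheory Filter Set

noncomputable section

namespace SDEPaper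

/-- The signum convention of the paper: `psgn y = 1` for `y > 0`, `= -1` for `y ≤ 0`. -/
def psgn (y : ℝ) : ℝ := if 0 < y then 1 else -1

variable {Ω : Type*} [m : MeasurableSpace Ω]

/-- The σ-algebra generated by the process `Ξ` on the time interval `[0, t]`. -/
def natSA {E : Type*} [MeasurableSpace E] (Ξ : ℝ → Ω → E) (t : ℝ) : MeasurableSpace Ω :=
  ⨆ s ∈ Icc (0 : ℝ) t, MeasurableSpace.comap (Ξ s) inferInstance

/-- The `μ`-augmentation of a σ-algebra. -/
def augSA (μ : Measure Ω) (m' : MeasurableSpace Ω) : MeasurableSpace Ω :=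
  m' ⊔ MeasurableSpace.generateFrom {A : Set Ω | μ A = 0}

/-- `𝔉^Ξ(t)`: the `μ`-augmented σ-algebra generated by the process `Ξ` up to time `t`. -/
def natFilt {E : Type*} [MeasurableSpace E] (μ : Measure Ω) (Ξ : ℝ → Ω → E) (t : ℝ) :
    MeasurableSpace Ω := augSA μ (natSA Ξ t)

/-- Dyadic left-point Riemann sum of `H` against `X` on `[0,t]`. -/
def rsum (H X : ℝ → Ω → ℝ) (t : ℝ) (n : ℕ) (ω : Ω) : ℝ :=
  ∑ i ∈ Finset.range (2 ^ n),
    H (t * i / 2 ^ n) ω * (X (t * (i + 1) / 2 ^ n) ω - X (t * i / 2 ^ n) ω)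

/-- `I = ∫₀^· H dX`: dyadic Riemann sums converge in probability, and `I 0 = 0` a.s. -/
def IsSI (μ : Measure Ω) (H X I : ℝ → Ω → ℝ) : Prop :=
  (∀ᵐ ω ∂μ, I 0 ω = 0) ∧
  ∀ t : ℝ, 0 ≤ t → TendstoInMeasure μ (fun n => rsum H X t n) atTop (I t)

/-- `I = ∫₀^· H₁ dX₁ + ∫₀^· H₂ dX₂` in the sense of convergence in probability
of dyadic Riemann sums. -/
def IsSI2 (μ : Measure Ω) (H₁ X₁ H₂ X₂ I : ℝ → Ω → ℝ) : Prop :=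
  (∀ᵐ ω ∂μ, I 0 ω = 0) ∧
  ∀ t : ℝ, 0 ≤ t →
    TendstoInMeasure μ (fun n ω => rsum H₁ X₁ t n ω + rsum H₂ X₂ t n ω) atTop (I t)

/-- Dyadic sums of products of increments. -/
def qsum (X Y : ℝ → Ω → ℝ) (t : ℝ) (n : ℕ) (ω : Ω) : ℝ :=
  ∑ i ∈ Finset.range (2 ^ n),
    (X (t * (i + 1) / 2 ^ n) ω - X (t * i / 2 ^ n) ω) *
      (Y (t * (i + 1) / 2 ^ n) ω - Y (t * i / 2 ^ n) ω)

/-- `C = ⟨X,Y⟩`: the quadratic covariation, as a limit in probability of dyadic sums. -/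
def IsQV (μ : Measure Ω) (X Y C : ℝ → Ω → ℝ) : Prop :=
  ∀ t : ℝ, 0 ≤ t → TendstoInMeasure μ (fun n => qsum X Y t n) atTop (C t)

/-- `W` is a standard one-dimensional Brownian motion with respect to the family of
σ-algebras `F` (a filtration contained in the ambient σ-algebra). -/
structure IsBM (μ : Measure Ω) (F : ℝ → MeasurableSpace Ω) (W : ℝ → Ω → ℝ) : Prop where
  le : ∀ t : ℝ, F t ≤ m
  mono : Monotone F
  adapted : ∀ t : ℝ, 0 ≤ t → MeasurableSpace.comap (W t) inferInstance ≤ F t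
  init : ∀ᵐ ω ∂μ, W 0 ω = 0
  cont : ∀ᵐ ω ∂μ, Continuous fun t => W t ω
  law : ∀ s t : ℝ, 0 ≤ s → s ≤ t →
    μ.map (fun ω => W t ω - W s ω) = gaussianReal 0 ((t - s).toNNReal)
  indep : ∀ s t : ℝ, 0 ≤ s → s ≤ t →
    Indep (MeasurableSpace.comap (fun ω => W t ω - W s ω) inferInstance) (F s) μ

/-- `(B₁, B₂)` is a planar Brownian motion: two independent standard Brownian motions
with respect to the common filtration `F`. -/
def IsPlanarBM (μ : Measure Ω) (F : ℝ → MeasurableSpace Ω) (B₁ B₂ : ℝ → Ω → ℝ) : Prop :=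
  IsBM μ F B₁ ∧ IsBM μ F B₂ ∧
    IndepFun (fun ω => (fun t => B₁ t ω)) (fun ω => (fun t => B₂ t ω)) μ

/-- `L` is the (right) local time at the origin of the process `Y`:
`L t = lim_{ε ↓ 0} (4ε)⁻¹ ∫₀ᵗ 1{|Y(s)| < ε} ds`. -/
def IsLocalTime (μ : Measure Ω) (Y L : ℝ → Ω → ℝ) : Prop :=
  ∀ᵐ ω ∂μ, ∀ t : ℝ, 0 ≤ t →
    Tendsto (fun ε : ℝ =>
        (4 * ε)⁻¹ * ∫ s in (0:ℝ)..t, (if |Y s ω| < ε then (1:ℝ) else 0))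
      (nhdsWithin 0 (Ioi 0)) (nhds (L t ω))

/-- A continuous local martingale with respect to the filtration `F`. -/
def IsContLocMart (μ : Measure Ω) (F : Filtration ℝ m) (M : ℝ → Ω → ℝ) : Prop :=
  (∀ᵐ ω ∂μ, Continuous fun t => M t ω) ∧ StronglyAdapted F M ∧
    ∃ τ : ℕ → Ω → ℝ, (∀ n, IsStoppingTime F (fun ω => (τ n ω : WithTop ℝ))) ∧
      (∀ᵐ ω ∂μ, Tendsto (fun n => τ n ω) atTop atTop) ∧
      ∀ n, Martingale (fun t ω => M (min t (τ n ω)) ω) F μ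

/-- Orthogonality: the cross-variation `⟨M,N⟩` vanishes identically. -/
def Orthogonal (μ : Measure Ω) (M N : ℝ → Ω → ℝ) : Prop :=
  IsQV μ M N fun _ _ => 0

/-- Domination: `⟨M⟩(t) = ∫₀ᵗ q(s) d⟨N⟩(s)` for a progressively measurable
process `q` with values in `[0,c]`. -/
def Dominated (μ : Measure Ω) (F : Filtration ℝ m) (M N : ℝ → Ω → ℝ) (c : ℝ) : Prop :=
  ∃ QM QN q : ℝ → Ω → ℝ, IsQV μ M M QM ∧ IsQV μ N N QN ∧
    ProgMeasurable F q ∧ (∀ t ω, q t ω ∈ Icc (0:ℝ) c) ∧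
    ∀ᵐ ω ∂μ, ∃ ν : Measure ℝ,
      (∀ a b : ℝ, 0 ≤ a → a ≤ b → ν (Ioc a b) = ENNReal.ofReal (QN b ω - QN a ω)) ∧
      ∀ t : ℝ, 0 ≤ t → QM t ω = ∫ s in Ioc (0:ℝ) t, q s ω ∂ν

/-- The law of the two-dimensional process `(X₁, X₂)` on path space. -/
def pathLaw (μ : Measure Ω) (X₁ X₂ : ℝ → Ω → ℝ) : Measure (ℝ → ℝ × ℝ) :=
  μ.map fun ω => (fun t => (X₁ t ω, X₂ t ω))
/-- `(X₁, X₂)` solves the system (1.1)-(1.2) driven by `(B₁, B₂)`. -/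
def Solves11 (μ : Measure Ω) (F : ℝ → MeasurableSpace Ω) (g h ρ σ x₁ x₂ : ℝ)
    (B₁ B₂ X₁ X₂ : ℝ → Ω → ℝ) : Prop :=
  (∀ t : ℝ, 0 ≤ t →
    MeasurableSpace.comap (fun ω => (X₁ t ω, X₂ t ω)) inferInstance ≤ F t) ∧
  (∀ᵐ ω ∂μ, Continuous (fun t => X₁ t ω) ∧ Continuous (fun t => X₂ t ω)) ∧
  ∃ I₁ I₂ : ℝ → Ω → ℝ,
    IsSI μ (fun s ω => if X₁ s ω ≤ X₂ s ω then σ else ρ) B₁ I₁ ∧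
    IsSI μ (fun s ω => if X₁ s ω ≤ X₂ s ω then ρ else σ) B₂ I₂ ∧
    ∀ᵐ ω ∂μ, ∀ t : ℝ, 0 ≤ t →
      X₁ t ω = x₁ + (∫ s in (0:ℝ)..t, (if X₁ s ω ≤ X₂ s ω then g else -h)) + I₁ t ω ∧
      X₂ t ω = x₂ + (∫ s in (0:ℝ)..t, (if X₁ s ω ≤ X₂ s ω then -h else g)) + I₂ t ω

/-- `(X₁, X₂)` solves the system (4.7)-(4.8), driven by the single Brownian motion `W`. -/
def Solves47 (μ : Measure Ω) (F : ℝ → MeasurableSpace Ω) (g h x₁ x₂ : ℝ)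
    (W X₁ X₂ : ℝ → Ω → ℝ) : Prop :=
  (∀ t : ℝ, 0 ≤ t →
    MeasurableSpace.comap (fun ω => (X₁ t ω, X₂ t ω)) inferInstance ≤ F t) ∧
  (∀ᵐ ω ∂μ, Continuous (fun t => X₁ t ω) ∧ Continuous (fun t => X₂ t ω)) ∧
  ∃ I₁ I₂ : ℝ → Ω → ℝ,
    IsSI μ (fun s ω => if X₁ s ω ≤ X₂ s ω then (0:ℝ) else 1) W I₁ ∧
    IsSI μ (fun s ω => if X₁ s ω ≤ X₂ s ω then (-1:ℝ) else 0) W I₂ ∧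
    ∀ᵐ ω ∂μ, ∀ t : ℝ, 0 ≤ t →
      X₁ t ω = x₁ + (∫ s in (0:ℝ)..t, (if X₁ s ω ≤ X₂ s ω then g else -h)) + I₁ t ω ∧
      X₂ t ω = x₂ + (∫ s in (0:ℝ)..t, (if X₁ s ω ≤ X₂ s ω then -h else g)) + I₂ t ω

/-- `(X₁, X₂)` solves the system (4.9)-(4.10), driven by the single Brownian motion `V`. -/
def Solves49 (μ : Measure Ω) (F : ℝ → MeasurableSpace Ω) (g h x₁ x₂ : ℝ)
    (V X₁ X₂ : ℝ → Ω → ℝ) : Prop :=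
  (∀ t : ℝ, 0 ≤ t →
    MeasurableSpace.comap (fun ω => (X₁ t ω, X₂ t ω)) inferInstance ≤ F t) ∧
  (∀ᵐ ω ∂μ, Continuous (fun t => X₁ t ω) ∧ Continuous (fun t => X₂ t ω)) ∧
  ∃ I₁ I₂ : ℝ → Ω → ℝ,
    IsSI μ (fun s ω => if X₁ s ω ≤ X₂ s ω then (0:ℝ) else 1) V I₁ ∧
    IsSI μ (fun s ω => if X₁ s ω ≤ X₂ s ω then (1:ℝ) else 0) V I₂ ∧
    ∀ᵐ ω ∂μ, ∀ t : ℝ, 0 ≤ t →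
      X₁ t ω = x₁ + (∫ s in (0:ℝ)..t, (if X₁ s ω ≤ X₂ s ω then g else -h)) + I₁ t ω ∧
      X₂ t ω = x₂ + (∫ s in (0:ℝ)..t, (if X₁ s ω ≤ X₂ s ω then -h else g)) + I₂ t ω

/-- `(X₁, X₂)` solves the system (2.12)-(2.13), driven by the planar BM `(W₁, W₂)`. -/
def Solves212 (μ : Measure Ω) (F : ℝ → MeasurableSpace Ω) (g h ρ σ x₁ x₂ : ℝ)
    (W₁ W₂ X₁ X₂ : ℝ → Ω → ℝ) : Prop :=
  (∀ t : ℝ, 0 ≤ t →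
    MeasurableSpace.comap (fun ω => (X₁ t ω, X₂ t ω)) inferInstance ≤ F t) ∧
  (∀ᵐ ω ∂μ, Continuous (fun t => X₁ t ω) ∧ Continuous (fun t => X₂ t ω)) ∧
  ∃ I₁ I₂ : ℝ → Ω → ℝ,
    IsSI2 μ (fun s ω => if X₁ s ω ≤ X₂ s ω then 0 else ρ) W₁
            (fun s ω => if X₁ s ω ≤ X₂ s ω then σ else 0) W₂ I₁ ∧
    IsSI2 μ (fun s ω => if X₁ s ω ≤ X₂ s ω then -ρ else 0) W₁
            (fun s ω => if X₁ s ω ≤ X₂ s ω then 0 else -σ) W₂ I₂ ∧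
    ∀ᵐ ω ∂μ, ∀ t : ℝ, 0 ≤ t →
      X₁ t ω = x₁ + (∫ s in (0:ℝ)..t, (if X₁ s ω ≤ X₂ s ω then g else -h)) + I₁ t ω ∧
      X₂ t ω = x₂ + (∫ s in (0:ℝ)..t, (if X₁ s ω ≤ X₂ s ω then -h else g)) + I₂ t ω

/-- `(X₁, X₂)` solves the system (2.14)-(2.15), driven by the planar BM `(V₁, V₂)`. -/
def Solves214 (μ : Measure Ω) (F : ℝ → MeasurableSpace Ω) (g h ρ σ x₁ x₂ : ℝ)
    (V₁ V₂ X₁ X₂ : ℝ → Ω → ℝ) : Prop :=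
  (∀ t : ℝ, 0 ≤ t →
    MeasurableSpace.comap (fun ω => (X₁ t ω, X₂ t ω)) inferInstance ≤ F t) ∧
  (∀ᵐ ω ∂μ, Continuous (fun t => X₁ t ω) ∧ Continuous (fun t => X₂ t ω)) ∧
  ∃ I₁ I₂ : ℝ → Ω → ℝ,
    IsSI2 μ (fun s ω => if X₁ s ω ≤ X₂ s ω then 0 else ρ) V₁
            (fun s ω => if X₁ s ω ≤ X₂ s ω then σ else 0) V₂ I₁ ∧
    IsSI2 μ (fun s ω => if X₁ s ω ≤ X₂ s ω then ρ else 0) V₁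
            (fun s ω => if X₁ s ω ≤ X₂ s ω then 0 else σ) V₂ I₂ ∧
    ∀ᵐ ω ∂μ, ∀ t : ℝ, 0 ≤ t →
      X₁ t ω = x₁ + (∫ s in (0:ℝ)..t, (if X₁ s ω ≤ X₂ s ω then g else -h)) + I₁ t ω ∧
      X₂ t ω = x₂ + (∫ s in (0:ℝ)..t, (if X₁ s ω ≤ X₂ s ω then -h else g)) + I₂ t ω

/-- `(X₁, X₂)` solves the system `dX = Σ(X) dU + G(X) dt` of (eq:xSigma), where
`Σ(x) = Σ₊ 1{x₁ > x₂} + Σ₋ 1{x₁ ≤ x₂}`. -/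
def SolvesGen (μ : Measure Ω) (F : ℝ → MeasurableSpace Ω) (g h : ℝ)
    (Sp Sm : Matrix (Fin 2) (Fin 2) ℝ) (x₁ x₂ : ℝ)
    (U₁ U₂ X₁ X₂ : ℝ → Ω → ℝ) : Prop :=
  (∀ t : ℝ, 0 ≤ t →
    MeasurableSpace.comap (fun ω => (X₁ t ω, X₂ t ω)) inferInstance ≤ F t) ∧
  (∀ᵐ ω ∂μ, Continuous (fun t => X₁ t ω) ∧ Continuous (fun t => X₂ t ω)) ∧
  ∃ I₁ I₂ : ℝ → Ω → ℝ,
    IsSI2 μ (fun s ω => if X₁ s ω ≤ X₂ s ω then Sm 0 0 else Sp 0 0) U₁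
            (fun s ω => if X₁ s ω ≤ X₂ s ω then Sm 0 1 else Sp 0 1) U₂ I₁ ∧
    IsSI2 μ (fun s ω => if X₁ s ω ≤ X₂ s ω then Sm 1 0 else Sp 1 0) U₁
            (fun s ω => if X₁ s ω ≤ X₂ s ω then Sm 1 1 else Sp 1 1) U₂ I₂ ∧
    ∀ᵐ ω ∂μ, ∀ t : ℝ, 0 ≤ t →
      X₁ t ω = x₁ + (∫ s in (0:ℝ)..t, (if X₁ s ω ≤ X₂ s ω then g else -h)) + I₁ t ω ∧
      X₂ t ω = x₂ + (∫ s in (0:ℝ)..t, (if X₁ s ω ≤ X₂ s ω then -h else g)) + I₂ t ω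

section MeasureLemmas
variable {Ω : Type*} [m : MeasurableSpace Ω] {μ : Measure Ω}

/-- a family of errors vanishing in measure -/
def Van {ι : Type*} (μ : Measure Ω) (l : Filter ι) (e : ι → Ω → ℝ) : Prop :=
  ∀ ε : ℝ, 0 < ε → Tendsto (fun n => μ {ω | ε ≤ e n ω}) l (nhds 0)

lemma tim_iff_van {ι E : Type*} [PseudoMetricSpace E] {l : Filter ι} {f : ι → Ω → E} {g : Ω → E} :
    TendstoInMeasure μ f l g ↔ Van μ l (fun n ω => dist (f n ω) (g ω)) :=
  tendstoInMeasure_iff_dist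

lemma Van.mono {ι : Type*} {l : Filter ι} {e e' : ι → Ω → ℝ} (h : Van μ l e)
    (h' : ∀ n, ∀ᵐ ω ∂μ, e' n ω ≤ e n ω) : Van μ l e' := by
  intro ε hε
  refine tendsto_of_tendsto_of_tendsto_of_le_of_le tendsto_const_nhds (h ε hε)
    (fun _ => zero_le) (fun n => ?_)
  apply measure_mono_ae
  filter_upwards [h' n] with ω hω
  intro h1
  exact le_trans h1 hω

lemma Van.mono' {ι : Type*} {l : Filter ι} {e e' : ι → Ω → ℝ} (h : Van μ l e)
    (h' : ∀ᶠ n in l, ∀ᵐ ω ∂μ, e' n ω ≤ e n ω) : Van μ l e' := by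
  intro ε hε
  refine tendsto_of_tendsto_of_tendsto_of_le_of_le' tendsto_const_nhds (h ε hε)
    (Eventually.of_forall fun _ => zero_le) ?_
  filter_upwards [h'] with n hn
  apply measure_mono_ae
  filter_upwards [hn] with ω hω
  intro h1
  exact le_trans h1 hω

lemma Van.add {ι : Type*} {l : Filter ι} {e e' : ι → Ω → ℝ} (h : Van μ l e) (h' : Van μ l e') :
    Van μ l (fun n ω => e n ω + e' n ω) := by
  intro ε hε
  have h2 := (h (ε/2) (by positivity)).add (h' (ε/2) (by positivity))
  simp only [add_zero] at h2
  refine tendsto_of_tendsto_of_tendsto_of_le_of_le tendsto_const_nhds h2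
    (fun _ => zero_le) (fun n => ?_)
  refine le_trans (measure_mono ?_) (measure_union_le _ _)
  intro ω hω
  simp only [mem_ofPred_eq, mem_union] at *
  by_contra! hc
  linarith [hc.1, hc.2]

lemma Van.const_mul {ι : Type*} {l : Filter ι} {e : ι → Ω → ℝ} (h : Van μ l e) {C : ℝ}
    (hC : 0 ≤ C) : Van μ l (fun n ω => C * e n ω) := by
  intro ε hε
  rcases hC.eq_or_lt with rfl | hC
  · have : ∀ n, {ω | ε ≤ 0 * e n ω} = ∅ := by
      intro n; ext ω; simp [hε]
    simp only [this, measure_empty]; exact tendsto_const_nhds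
  · refine (h (ε/C) (by positivity)).congr (fun n => ?_)
    congr 1; ext ω
    simp only [mem_ofPred_eq]
    rw [div_le_iff₀ hC, mul_comm]

lemma van_zero {ι : Type*} {l : Filter ι} : Van μ l (fun (_:ι) (_:Ω) => (0:ℝ)) := by
  intro ε hε
  have : {ω : Ω | ε ≤ 0} = ∅ := by ext; simp [hε]
  simp only [this, measure_empty]; exact tendsto_const_nhds

lemma van_sum {ι κ : Type*} {l : Filter ι} (s : Finset κ) {e : κ → ι → Ω → ℝ}
    (h : ∀ k ∈ s, Van μ l (e k)) : Van μ l (fun n ω => ∑ k ∈ s, e k n ω) := by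
  classical
  induction s using Finset.induction_on with
  | empty => simpa using van_zero
  | insert a s ha ih =>
    simp only [Finset.sum_insert ha]
    exact (h a (by simp)).add (ih fun k hk => h k (by simp [hk]))

/-- iterated limits -/
lemma van_of_approx {ι : Type*} {l : Filter ι} {e : ι → Ω → ℝ}
    (h : ∀ ε : ℝ, 0 < ε → ∀ δ : ENNReal, 0 < δ → ∀ᶠ n in l, μ {ω | ε ≤ e n ω} ≤ δ) :
    Van μ l e := by
  intro ε hε
  rw [ENNReal.tendsto_nhds_zero]
  exact fun δ hδ => h ε hε δ hδ

lemma tim_pi {ι κ : Type*} [Fintype κ] {E : Type*} [PseudoMetricSpace E] {l : Filter ι}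
    {f : ι → Ω → κ → E} {g : Ω → κ → E}
    (h : ∀ k, TendstoInMeasure μ (fun n ω => f n ω k) l (fun ω => g ω k)) :
    TendstoInMeasure μ f l g := by
  rw [tim_iff_van]
  refine (van_sum Finset.univ (fun k _ => tim_iff_van.1 (h k))).mono (fun n => ae_of_all _ fun ω => ?_)
  rw [dist_pi_le_iff (Finset.sum_nonneg fun _ _ => dist_nonneg)]
  intro k
  exact Finset.single_le_sum (f := fun k => dist (f n ω k) (g ω k))
    (fun _ _ => dist_nonneg) (Finset.mem_univ k)

lemma tim_prod {ι : Type*} {E E' : Type*} [PseudoMetricSpace E] [PseudoMetricSpace E'] {l : Filter ι}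
    {f : ι → Ω → E} {g : Ω → E} {f' : ι → Ω → E'} {g' : Ω → E'}
    (h : TendstoInMeasure μ f l g) (h' : TendstoInMeasure μ f' l g') :
    TendstoInMeasure μ (fun n ω => (f n ω, f' n ω)) l (fun ω => (g ω, g' ω)) := by
  rw [tim_iff_van] at *
  refine (h.add h').mono (fun n => ae_of_all _ fun ω => ?_)
  rw [Prod.dist_eq]
  exact max_le (by linarith [dist_nonneg (x := f' n ω) (y := g' ω)])
    (by linarith [dist_nonneg (x := f n ω) (y := g ω)])

lemma tim_add {ι : Type*} {l : Filter ι} {f f' : ι → Ω → ℝ} {g g' : Ω → ℝ}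
    (h : TendstoInMeasure μ f l g) (h' : TendstoInMeasure μ f' l g') :
    TendstoInMeasure μ (fun n ω => f n ω + f' n ω) l (fun ω => g ω + g' ω) := by
  rw [tim_iff_van] at *
  exact (h.add h').mono (fun n => ae_of_all _ fun ω => dist_add_add_le _ _ _ _)

lemma tim_const_mul {ι : Type*} {l : Filter ι} {f : ι → Ω → ℝ} {g : Ω → ℝ} (c : ℝ)
    (h : TendstoInMeasure μ f l g) :
    TendstoInMeasure μ (fun n ω => c * f n ω) l (fun ω => c * g ω) := by
  rw [tim_iff_van] at *
  refine (h.const_mul (abs_nonneg c)).mono (fun n => ae_of_all _ fun ω => ?_)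
  simp only [Real.dist_eq]
  rw [← mul_sub, abs_mul]

lemma tim_sub {ι : Type*} {l : Filter ι} {f f' : ι → Ω → ℝ} {g g' : Ω → ℝ}
    (h : TendstoInMeasure μ f l g) (h' : TendstoInMeasure μ f' l g') :
    TendstoInMeasure μ (fun n ω => f n ω - f' n ω) l (fun ω => g ω - g' ω) := by
  have := tim_add h (tim_const_mul (-1) h')
  refine this.congr (fun i => ae_of_all _ fun ω => by ring_nf) (ae_of_all _ fun ω => by ring_nf)

lemma tim_const {ι : Type*} {l : Filter ι} {E : Type*} [PseudoMetricSpace E] (g : Ω → E) :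
    TendstoInMeasure μ (fun (_ : ι) => g) l g := by
  rw [tim_iff_van]; simpa using van_zero

lemma tim_sum {ι κ : Type*} {l : Filter ι} (s : Finset κ) {f : κ → ι → Ω → ℝ} {g : κ → Ω → ℝ}
    (h : ∀ k ∈ s, TendstoInMeasure μ (f k) l (g k)) :
    TendstoInMeasure μ (fun n ω => ∑ k ∈ s, f k n ω) l (fun ω => ∑ k ∈ s, g k ω) := by
  classical
  induction s using Finset.induction_on with
  | empty => simpa using tim_const _
  | insert a s ha ih =>
    simp only [Finset.sum_insert ha]
    exact tim_add (h a (by simp)) (ih fun k hk => h k (by simp [hk]))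

/-- If `f` and `f'` differ by an error vanishing in measure they have the same limit. -/
lemma tim_of_van {ι : Type*} {l : Filter ι} {E : Type*} [PseudoMetricSpace E]
    {f f' : ι → Ω → E} {g : Ω → E}
    (h : TendstoInMeasure μ f l g) (h' : Van μ l (fun n ω => dist (f' n ω) (f n ω))) :
    TendstoInMeasure μ f' l g := by
  rw [tim_iff_van] at *
  exact (h'.add h).mono (fun n => ae_of_all _ fun ω => dist_triangle _ _ _)

/-- Multiplication by a bounded random variable preserves vanishing. -/
lemma tim_mul_bdd {ι : Type*} {l : Filter ι} {f : ι → Ω → ℝ} {g : Ω → ℝ} {c : Ω → ℝ} {C : ℝ}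
    (hc : ∀ ω, |c ω| ≤ C) (h : TendstoInMeasure μ f l g) :
    TendstoInMeasure μ (fun n ω => c ω * f n ω) l (fun ω => c ω * g ω) := by
  rw [tim_iff_van] at *
  refine (h.const_mul (C := max C 0) (le_max_right _ _)).mono (fun n => ae_of_all _ fun ω => ?_)
  simp only [Real.dist_eq]
  rw [← mul_sub, abs_mul]
  exact mul_le_mul_of_nonneg_right ((hc ω).trans (le_max_left _ _)) (abs_nonneg _)

/-- Chebyshev: `L²` convergence of real errors. -/
lemma van_of_sq {ι : Type*} {l : Filter ι} {e : ι → Ω → ℝ} (hi : ∀ n, Integrable (fun ω => e n ω ^ 2) μ)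
    [IsFiniteMeasure μ]
    (h : Tendsto (fun n => ∫ ω, e n ω ^ 2 ∂μ) l (nhds 0)) : Van μ l (fun n ω => |e n ω|) := by
  intro ε hε
  have h1 : ∀ n, μ {ω | ε ≤ |e n ω|} ≤ ENNReal.ofReal ((∫ ω, e n ω ^ 2 ∂μ) / ε ^ 2) := by
    intro n
    have h2 := mul_meas_ge_le_integral_of_nonneg (μ := μ) (f := fun ω => e n ω ^ 2)
      (ae_of_all _ fun ω => sq_nonneg _) (hi n) (ε ^ 2)
    have h3 : {ω | ε ≤ |e n ω|} = {ω | ε ^ 2 ≤ e n ω ^ 2} := by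
      ext ω; simp only [mem_ofPred_eq]
      rw [← sq_abs (e n ω)]
      exact (pow_le_pow_iff_left₀ hε.le (abs_nonneg _) (by norm_num)).symm
    rw [h3, ← ENNReal.ofReal_toReal (measure_ne_top μ _)]
    apply ENNReal.ofReal_le_ofReal
    rw [le_div_iff₀ (by positivity), mul_comm]
    exact h2
  refine tendsto_of_tendsto_of_tendsto_of_le_of_le tendsto_const_nhds ?_
    (fun _ => zero_le) h1
  have := (ENNReal.tendsto_ofReal (h.div_const (ε ^ 2)))
  simpa using this

/-- Equality in law passes to limits in measure. -/
lemma identDistrib_of_tim {E : Type*} [PseudoMetricSpace E] [MeasurableSpace E]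
    [BorelSpace E] [IsProbabilityMeasure μ] {f f' : ℕ → Ω → E} {g g' : Ω → E}
    (hf : TendstoInMeasure μ f atTop g) (hf' : TendstoInMeasure μ f' atTop g')
    (hid : ∀ᶠ n in atTop, IdentDistrib (f n) (f' n) μ μ) : IdentDistrib g g' μ μ := by
  obtain ⟨N, hN⟩ := eventually_atTop.1 hid
  have hN' : ∀ n, IdentDistrib (f (n + N)) (f' (n + N)) μ μ := fun n => hN _ (by omega)
  have hs : Tendsto (fun n : ℕ => n + N) atTop atTop := tendsto_add_atTop_nat N
  have h1 := (hf.comp hs).tendstoInDistribution (fun n => (hN' n).aemeasurable_fst)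
  have h2 := (hf'.comp hs).tendstoInDistribution (fun n => (hN' n).aemeasurable_snd)
  refine ⟨h1.aemeasurable_limit, h2.aemeasurable_limit, ?_⟩
  have h3 : TendstoInDistribution (f ∘ fun n => n + N) atTop g' (fun _ => μ) μ := by
    refine ⟨fun n => (hN' n).aemeasurable_fst, h2.aemeasurable_limit, ?_⟩
    have h4 := h2.tendsto
    refine h4.congr (fun n => ?_)
    exact Subtype.ext ((hN' n).map_eq).symm
  exact tendstoInDistribution_unique _ h1 h3

end MeasureLemmas

lemma sm_limUnder {α : Type*} {mα : MeasurableSpace α} {g : ℕ → α → ℝ}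
    (hg : ∀ n, StronglyMeasurable (g n)) :
    StronglyMeasurable (fun x => limUnder atTop (fun n => g n x)) :=
  StronglyMeasurable.limUnder hg

section Filt
set_option linter.unusedSectionVars false
variable {Ω : Type*} [m : MeasurableSpace Ω] {μ : Measure Ω}

lemma sup_eq_generateFrom (m1 m2 : MeasurableSpace Ω) :
    m1 ⊔ m2 = MeasurableSpace.generateFrom
      {s | ∃ a b, MeasurableSet[m1] a ∧ MeasurableSet[m2] b ∧ s = a ∩ b} := by
  apply le_antisymm
  · apply sup_le
    · intro a ha
      exact MeasurableSpace.measurableSet_generateFrom ⟨a, univ, ha, MeasurableSet.univ, by simp⟩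
    · intro a ha
      exact MeasurableSpace.measurableSet_generateFrom ⟨univ, a, MeasurableSet.univ, ha, by simp⟩
  · apply MeasurableSpace.generateFrom_le
    rintro _ ⟨a, b, ha, hb, rfl⟩
    have h1 : m1 ≤ m1 ⊔ m2 := le_sup_left
    have h2 : m2 ≤ m1 ⊔ m2 := le_sup_right
    exact @MeasurableSet.inter _ (m1 ⊔ m2) _ _ (h1 _ ha) (h2 _ hb)

lemma isPiSystem_inter2 (m1 m2 : MeasurableSpace Ω) :
    IsPiSystem {s : Set Ω | ∃ a b, MeasurableSet[m1] a ∧ MeasurableSet[m2] b ∧ s = a ∩ b} := by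
  rintro _ ⟨a, b, ha, hb, rfl⟩ _ ⟨a', b', ha', hb', rfl⟩ _
  exact ⟨a ∩ a', b ∩ b', ha.inter ha', hb.inter hb', by
    ext x; simp only [mem_inter_iff]; tauto⟩

lemma indep_four [IsProbabilityMeasure μ] {m1 n1 m2 n2 : MeasurableSpace Ω}
    (hm1 : m1 ≤ m) (hn1 : n1 ≤ m) (hm2 : m2 ≤ m) (hn2 : n2 ≤ m)
    (h1 : Indep m1 n1 μ) (h2 : Indep m2 n2 μ) (h : Indep (m1 ⊔ n1) (m2 ⊔ n2) μ) :
    Indep (m1 ⊔ m2) (n1 ⊔ n2) μ := by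
  refine IndepSets.indep (sup_le hm1 hm2) (sup_le hn1 hn2) (isPiSystem_inter2 m1 m2)
    (isPiSystem_inter2 n1 n2) (sup_eq_generateFrom _ _) (sup_eq_generateFrom _ _) ?_
  rw [IndepSets_iff]
  rintro _ _ ⟨a, b, ha, hb, rfl⟩ ⟨c, d, hc, hd, rfl⟩
  rw [Indep_iff] at h h1 h2
  have l1 : m1 ≤ m1 ⊔ n1 := le_sup_left
  have l2 : n1 ≤ m1 ⊔ n1 := le_sup_right
  have l3 : m2 ≤ m2 ⊔ n2 := le_sup_left
  have l4 : n2 ≤ m2 ⊔ n2 := le_sup_right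
  have e : (a ∩ b) ∩ (c ∩ d) = (a ∩ c) ∩ (b ∩ d) := by
    ext x; simp only [mem_inter_iff]; tauto
  rw [e, h (a ∩ c) (b ∩ d) (@MeasurableSet.inter _ (m1 ⊔ n1) _ _ (l1 _ ha) (l2 _ hc))
    (@MeasurableSet.inter _ (m2 ⊔ n2) _ _ (l3 _ hb) (l4 _ hd)),
    h a b (l1 _ ha) (l3 _ hb), h1 a c ha hc, h2 b d hb hd,
    h c d (l2 _ hc) (l4 _ hd)]
  ring

/-- complete version of the filtration generated by a planar process. -/
def Gf (μ : Measure Ω) (V₁ V₂ : ℝ → Ω → ℝ) (s : ℝ) : MeasurableSpace Ω :=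
  @eventuallyMeasurableSpace Ω (natSA (fun s ω => (V₁ s ω, V₂ s ω)) s) (ae μ) _ ⊓ m

lemma measurableSet_Gf {V₁ V₂ : ℝ → Ω → ℝ} {s : ℝ} {A : Set Ω} :
    MeasurableSet[Gf μ V₁ V₂ s] A ↔ MeasurableSet A ∧
      ∃ B, MeasurableSet[natSA (fun s ω => (V₁ s ω, V₂ s ω)) s] B ∧ A =ᵐ[μ] B := by
  exact and_comm

lemma natSA_mono {E : Type*} [MeasurableSpace E] (Ξ : ℝ → Ω → E) : Monotone (natSA Ξ) := by
  intro s t hst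
  unfold natSA
  refine iSup₂_le fun r hr => ?_
  exact le_iSup₂_of_le r ⟨hr.1, hr.2.trans hst⟩ le_rfl

lemma Gf_le (V₁ V₂ : ℝ → Ω → ℝ) (s : ℝ) : Gf μ V₁ V₂ s ≤ m := inf_le_right

lemma Gf_mono (V₁ V₂ : ℝ → Ω → ℝ) : Monotone (Gf μ V₁ V₂) := by
  intro s t hst A hA
  rw [measurableSet_Gf] at *
  obtain ⟨h, B, hB, h'⟩ := hA
  exact ⟨h, B, natSA_mono _ hst _ hB, h'⟩

lemma Gf_null (V₁ V₂ : ℝ → Ω → ℝ) (s : ℝ) {A : Set Ω} (hA : MeasurableSet A) (h0 : μ A = 0) :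
    MeasurableSet[Gf μ V₁ V₂ s] A := by
  rw [measurableSet_Gf]
  exact ⟨hA, ∅, @MeasurableSet.empty _ (_), by rwa [ae_eq_empty]⟩

lemma natSA_le_Gf {V₁ V₂ : ℝ → Ω → ℝ} {s : ℝ}
    (h : natSA (fun s ω => (V₁ s ω, V₂ s ω)) s ≤ m) :
    natSA (fun s ω => (V₁ s ω, V₂ s ω)) s ≤ Gf μ V₁ V₂ s := by
  intro A hA
  rw [measurableSet_Gf]
  exact ⟨h _ hA, A, hA, EventuallyEq.rfl⟩

lemma natFilt_inf_le_Gf (V₁ V₂ : ℝ → Ω → ℝ) (s : ℝ) :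
    natFilt μ (fun s ω => (V₁ s ω, V₂ s ω)) s ⊓ m ≤ Gf μ V₁ V₂ s := by
  apply inf_le_inf_right
  unfold natFilt augSA
  apply sup_le
  · intro A hA
    exact ⟨A, hA, EventuallyEq.rfl⟩
  · apply MeasurableSpace.generateFrom_le
    intro A hA
    exact ⟨∅, @MeasurableSet.empty _ (_), by rwa [ae_eq_empty]⟩

lemma indep_Gf {V₁ V₂ : ℝ → Ω → ℝ} {s : ℝ} {m1 : MeasurableSpace Ω}
    (h : @Indep Ω m1 (natSA (fun s ω => (V₁ s ω, V₂ s ω)) s) m μ) :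
    @Indep Ω m1 (@Gf Ω m μ V₁ V₂ s) m μ := by
  rw [@Indep_iff] at *
  intro A B hA hB
  rw [@measurableSet_Gf Ω m] at hB
  obtain ⟨_, B', hB', hBB⟩ := hB
  rw [measure_congr hBB, ← h A B' hA hB']
  exact measure_congr (EventuallyEq.rfl.inter hBB)

/-- Functions measurable for the completed filtration have a version measurable for the
raw filtration. -/
lemma aesm_of_Gf {V₁ V₂ : ℝ → Ω → ℝ} {s : ℝ} {f : Ω → ℝ}
    (hf : Measurable[Gf μ V₁ V₂ s] f) :
    AEStronglyMeasurable[natSA (fun s ω => (V₁ s ω, V₂ s ω)) s] f μ := by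
  have hs : StronglyMeasurable[Gf μ V₁ V₂ s] f :=
    @Measurable.stronglyMeasurable Ω ℝ f (Gf μ V₁ V₂ s) _ _ _ _ _ hf
  have key : ∀ u : @SimpleFunc Ω (Gf μ V₁ V₂ s) ℝ,
      AEStronglyMeasurable[natSA (fun s ω => (V₁ s ω, V₂ s ω)) s] u μ := by
    intro u
    refine @SimpleFunc.induction Ω ℝ (Gf μ V₁ V₂ s) _ (fun u => @AEStronglyMeasurable Ω ℝ _
      (natSA (fun s ω => (V₁ s ω, V₂ s ω)) s) m u μ) ?_ ?_ u
    · intro c A hA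
      obtain ⟨_, B, hB, hAB⟩ := measurableSet_Gf.1 hA
      refine ⟨B.indicator (fun _ => c), ?_, ?_⟩
      · exact (@stronglyMeasurable_const _ _ (natSA (fun s ω => (V₁ s ω, V₂ s ω)) s) _ _).indicator hB
      · simp only [SimpleFunc.coe_piecewise, SimpleFunc.coe_const, SimpleFunc.const_zero,
          SimpleFunc.coe_zero]
        classical
        have : A.piecewise (Function.const Ω c) 0 = A.indicator (fun _ => c) := by
          ext ω; by_cases h : ω ∈ A <;> simp [h]
        convert (indicator_ae_eq_of_ae_eq_set (f := fun _ => c) hAB) using 1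
    · intro f g _ ih1 ih2
      rw [@SimpleFunc.coe_add Ω ℝ (Gf μ V₁ V₂ s)]
      exact ih1.add ih2
  choose g hg hfg using fun n => key (hs.approx n)
  refine ⟨fun x => limUnder atTop (g · x), @sm_limUnder Ω
    (natSA (fun s ω => (V₁ s ω, V₂ s ω)) s) g hg, ?_⟩
  filter_upwards [ae_all_iff.2 hfg] with ω hω
  have h1 : Tendsto (fun n => g n ω) atTop (nhds (f ω)) :=
    (hs.tendsto_approx ω).congr hω
  exact h1.limUnder_eq.symm

lemma gauss_rot (v : NNReal) (α β : ℝ) (h : α ^ 2 + β ^ 2 = 1) :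
    ((gaussianReal 0 v).prod (gaussianReal 0 v)).map
      (fun p : ℝ × ℝ => (α * p.1 + β * p.2, -β * p.1 + α * p.2)) =
    (gaussianReal 0 v).prod (gaussianReal 0 v) := by
  let T : ℝ × ℝ →L[ℝ] ℝ × ℝ :=
    (α • ContinuousLinearMap.fst ℝ ℝ ℝ + β • ContinuousLinearMap.snd ℝ ℝ ℝ).prod
      ((-β) • ContinuousLinearMap.fst ℝ ℝ ℝ + α • ContinuousLinearMap.snd ℝ ℝ ℝ)
  have hT : (fun p : ℝ × ℝ => (α * p.1 + β * p.2, -β * p.1 + α * p.2)) = T := by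
    ext p <;> simp [T]
  have hg : ∀ L : StrongDual ℝ ℝ, charFunDual (gaussianReal 0 v) L =
      Complex.exp (- (v : ℂ) * (L 1 : ℂ) ^ 2 / 2) := by
    intro L
    have : charFunDual (gaussianReal 0 v) L = charFun (gaussianReal 0 v) (L 1) := by
      rw [charFunDual_apply, charFun_apply_real]
      congr 1
      ext x
      have : L x = L 1 * x := by
        have := L.map_smul x 1
        simp only [smul_eq_mul, mul_one] at this
        rw [this]; ring
      rw [this]; push_cast; ring_nf
    rw [this, charFun_gaussianReal]
    congr 1; simp; ring
  have : IsFiniteMeasure (((gaussianReal 0 v).prod (gaussianReal 0 v)).map T) := inferInstance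
  rw [hT]
  apply Measure.ext_of_charFunDual
  ext L
  rw [charFunDual_map, charFunDual_prod, charFunDual_prod, hg, hg, hg, hg, ← Complex.exp_add,
    ← Complex.exp_add]
  congr 1
  have e1 : ((L.comp T).comp (.inl ℝ ℝ ℝ)) 1 = α * L (1,0) - β * L (0,1) := by
    have : T (1,0) = α • (1,0) - β • (0,1) := by ext <;> simp [T]
    simp only [ContinuousLinearMap.comp_apply, ContinuousLinearMap.inl_apply]
    rw [this, map_sub, map_smul, map_smul]; rfl
  have e2 : ((L.comp T).comp (.inr ℝ ℝ ℝ)) 1 = β * L (1,0) + α * L (0,1) := by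
    have : T (0,1) = β • (1,0) + α • (0,1) := by ext <;> simp [T]
    simp only [ContinuousLinearMap.comp_apply, ContinuousLinearMap.inr_apply]
    rw [this, map_add, map_smul, map_smul]; rfl
  rw [e1, e2]
  simp only [ContinuousLinearMap.comp_apply, ContinuousLinearMap.inr_apply,
    ContinuousLinearMap.inl_apply]
  have h' : (α : ℂ) ^ 2 + (β : ℂ) ^ 2 = 1 := by exact_mod_cast congrArg (fun x : ℝ => (x : ℂ)) h
  push_cast
  linear_combination (-(v:ℂ) / 2 * ((L (1,0) : ℂ) ^ 2 + (L (0,1) : ℂ) ^ 2)) * h'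

end Filt

section PBsec
set_option linter.unusedSectionVars false
variable {Ω : Type*} [m : MeasurableSpace Ω] {μ : Measure Ω}

/-- A (standard, planar) Brownian motion `(V,Q)` with continuous paths, for a complete filtration. -/
structure PB (μ : Measure Ω) (G : ℝ → MeasurableSpace Ω) (V Q : ℝ → Ω → ℝ) : Prop where
  le : ∀ t : ℝ, G t ≤ m
  mono : Monotone G
  null : ∀ t : ℝ, ∀ A, MeasurableSet A → μ A = 0 → MeasurableSet[G t] A
  adV : ∀ t : ℝ, 0 ≤ t → Measurable[G t] (V t)
  adQ : ∀ t : ℝ, 0 ≤ t → Measurable[G t] (Q t)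
  contV : ∀ ω, Continuous fun t => V t ω
  contQ : ∀ ω, Continuous fun t => Q t ω
  V0 : ∀ ω, V 0 ω = 0
  Q0 : ∀ ω, Q 0 ω = 0
  law : ∀ s t : ℝ, 0 ≤ s → s ≤ t → μ.map (fun ω => (V t ω - V s ω, Q t ω - Q s ω)) =
    (gaussianReal 0 ((t - s).toNNReal)).prod (gaussianReal 0 ((t - s).toNNReal))
  indep : ∀ s t : ℝ, 0 ≤ s → s ≤ t →
    Indep (MeasurableSpace.comap (fun ω => (V t ω - V s ω, Q t ω - Q s ω)) inferInstance) (G s) μ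

lemma meas_of_le {m1 m2 : MeasurableSpace Ω} {E : Type*} [MeasurableSpace E] {f : Ω → E}
    (hf : Measurable[m1] f) (h : m1 ≤ m2) : Measurable[m2] f := fun _ hs => h _ (hf hs)

lemma measurable_of_comap_le {m1 : MeasurableSpace Ω} {E : Type*} [mE : MeasurableSpace E] {f : Ω → E}
    (hf : MeasurableSpace.comap f mE ≤ m1) : Measurable[m1] f := by
  rw [measurable_iff_comap_le]; exact hf

lemma natSA_pair_le {W₁ W₂ : ℝ → Ω → ℝ} {M : MeasurableSpace Ω} {s : ℝ}
    (h1 : ∀ r, 0 ≤ r → r ≤ s → Measurable[M] (W₁ r))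
    (h2 : ∀ r, 0 ≤ r → r ≤ s → Measurable[M] (W₂ r)) :
    natSA (fun s ω => (W₁ s ω, W₂ s ω)) s ≤ M := by
  unfold natSA
  refine iSup₂_le fun r hr => ?_
  rw [← measurable_iff_comap_le]
  exact (h1 r hr.1 hr.2).prodMk (h2 r hr.1 hr.2)

lemma meas_natSA {E : Type*} [MeasurableSpace E] (Ξ : ℝ → Ω → E) {s t : ℝ} (h0 : 0 ≤ s)
    (hs : s ≤ t) : Measurable[natSA Ξ t] (Ξ s) := by
  rw [measurable_iff_comap_le]
  exact le_iSup₂_of_le s ⟨h0, hs⟩ le_rfl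

theorem exists_pb [IsProbabilityMeasure μ] {F : ℝ → MeasurableSpace Ω} {W₁ W₂ : ℝ → Ω → ℝ}
    (h : IsPlanarBM μ F W₁ W₂) :
    ∃ U₁ U₂ : ℝ → Ω → ℝ, (∀ᵐ ω ∂μ, ∀ t, U₁ t ω = W₁ t ω ∧ U₂ t ω = W₂ t ω) ∧
      ∀ α β : ℝ, α ^ 2 + β ^ 2 = 1 → PB μ (Gf μ W₁ W₂)
        (fun t ω => α * U₁ t ω + β * U₂ t ω) (fun t ω => -β * U₁ t ω + α * U₂ t ω) := by
  obtain ⟨h1, h2, h12⟩ := h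
  have hae : ∀ᵐ ω ∂μ, (W₁ 0 ω = 0 ∧ W₂ 0 ω = 0) ∧
      (Continuous fun t => W₁ t ω) ∧ Continuous fun t => W₂ t ω := by
    filter_upwards [h1.init, h2.init, h1.cont, h2.cont] with ω a b c d
    exact ⟨⟨a, b⟩, c, d⟩
  obtain ⟨N, hNs, hNm, hN0⟩ := exists_measurable_superset_of_null (ae_iff.1 hae)
  have hN : ∀ ω, ω ∉ N → (W₁ 0 ω = 0 ∧ W₂ 0 ω = 0) ∧
      (Continuous fun t => W₁ t ω) ∧ Continuous fun t => W₂ t ω := by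
    intro ω hω
    by_contra hc
    exact hω (hNs hc)
  classical
  let U₁ : ℝ → Ω → ℝ := fun t ω => if ω ∈ N then 0 else W₁ t ω
  let U₂ : ℝ → Ω → ℝ := fun t ω => if ω ∈ N then 0 else W₂ t ω
  have hUW : ∀ᵐ ω ∂μ, ∀ t, U₁ t ω = W₁ t ω ∧ U₂ t ω = W₂ t ω := by
    have : ∀ᵐ ω ∂μ, ω ∉ N := by rw [ae_iff]; simpa using hN0
    filter_upwards [this] with ω hω t
    simp [U₁, U₂, hω]
  have m1 : ∀ t, 0 ≤ t → Measurable (W₁ t) := fun t ht =>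
    meas_of_le (measurable_of_comap_le (h1.adapted t ht)) (h1.le t)
  have m2 : ∀ t, 0 ≤ t → Measurable (W₂ t) := fun t ht =>
    meas_of_le (measurable_of_comap_le (h2.adapted t ht)) (h2.le t)
  have hnm : ∀ s, natSA (fun s ω => (W₁ s ω, W₂ s ω)) s ≤ m := fun s =>
    natSA_pair_le (fun r hr _ => m1 r hr) (fun r hr _ => m2 r hr)
  have gW : ∀ t, 0 ≤ t → Measurable[Gf μ W₁ W₂ t] (fun ω => (W₁ t ω, W₂ t ω)) := fun t ht =>
    meas_of_le (meas_natSA (fun s ω => (W₁ s ω, W₂ s ω)) ht le_rfl) (natSA_le_Gf (hnm t))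
  have gN : ∀ t, MeasurableSet[Gf μ W₁ W₂ t] N := fun t => Gf_null _ _ _ hNm hN0
  have g1 : ∀ t, 0 ≤ t → Measurable[Gf μ W₁ W₂ t] (U₁ t) := fun t ht =>
    Measurable.ite (p := fun ω => ω ∈ N) (gN t) measurable_const
      (measurable_fst.comp (gW t ht))
  have g2 : ∀ t, 0 ≤ t → Measurable[Gf μ W₁ W₂ t] (U₂ t) := fun t ht =>
    Measurable.ite (p := fun ω => ω ∈ N) (gN t) measurable_const
      (measurable_snd.comp (gW t ht))
  have c1 : ∀ ω, Continuous fun t => U₁ t ω := by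
    intro ω
    by_cases hω : ω ∈ N
    · simp only [U₁, hω, if_true]; exact continuous_const
    · simp only [U₁, hω, if_false]; exact (hN ω hω).2.1
  have c2 : ∀ ω, Continuous fun t => U₂ t ω := by
    intro ω
    by_cases hω : ω ∈ N
    · simp only [U₂, hω, if_true]; exact continuous_const
    · simp only [U₂, hω, if_false]; exact (hN ω hω).2.2
  -- joint independence of the increments from the past
  have hind : ∀ s t : ℝ, 0 ≤ s → s ≤ t →
      Indep (MeasurableSpace.comap (fun ω => (W₁ t ω - W₁ s ω, W₂ t ω - W₂ s ω)) inferInstance)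
        (natSA (fun s ω => (W₁ s ω, W₂ s ω)) s) μ := by
    intro s t hs hst
    have ht := hs.trans hst
    have lA1 : MeasurableSpace.comap (fun ω => W₁ t ω - W₁ s ω) inferInstance ≤ m := ((m1 t ht).sub (m1 s hs)).comap_le
    have lA2 : MeasurableSpace.comap (fun ω => W₂ t ω - W₂ s ω) inferInstance ≤ m := ((m2 t ht).sub (m2 s hs)).comap_le
    have lN1 : natSA W₁ s ≤ m := iSup₂_le fun r hr => (m1 r hr.1).comap_le
    have lN2 : natSA W₂ s ≤ m := iSup₂_le fun r hr => (m2 r hr.1).comap_le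
    have F1 : natSA W₁ s ≤ F s := iSup₂_le fun r hr => (h1.adapted r hr.1).trans (h1.mono hr.2)
    have F2 : natSA W₂ s ≤ F s := iSup₂_le fun r hr => (h2.adapted r hr.1).trans (h2.mono hr.2)
    have i1 : Indep (MeasurableSpace.comap (fun ω => W₁ t ω - W₁ s ω) inferInstance) (natSA W₁ s) μ := indep_of_indep_of_le_right (h1.indep s t hs hst) F1
    have i2 : Indep (MeasurableSpace.comap (fun ω => W₂ t ω - W₂ s ω) inferInstance) (natSA W₂ s) μ := indep_of_indep_of_le_right (h2.indep s t hs hst) F2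
    have pth : ∀ W : ℝ → Ω → ℝ, MeasurableSpace.comap (fun ω => W t ω - W s ω) inferInstance ⊔
        natSA W s ≤ MeasurableSpace.comap (fun ω => (fun t => W t ω)) inferInstance := by
      intro W
      have hr : ∀ r, Measurable[MeasurableSpace.comap (fun ω => (fun t => W t ω)) inferInstance] (W r) :=
        fun r => (measurable_pi_apply r).comp (comap_measurable (fun ω => (fun t => W t ω)))
      refine sup_le ?_ (iSup₂_le fun r _ => ?_)
      · rw [← measurable_iff_comap_le]
        exact (hr t).sub (hr s)
      · rw [← measurable_iff_comap_le]; exact hr r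
    have i3 : Indep (MeasurableSpace.comap (fun ω => W₁ t ω - W₁ s ω) inferInstance ⊔ natSA W₁ s) (MeasurableSpace.comap (fun ω => W₂ t ω - W₂ s ω) inferInstance ⊔ natSA W₂ s) μ :=
      indep_of_indep_of_le_left (indep_of_indep_of_le_right h12 (pth W₂)) (pth W₁)
    have i4 := indep_four lA1 lN1 lA2 lN2 i1 i2 i3
    refine indep_of_indep_of_le_left (indep_of_indep_of_le_right i4 ?_) ?_
    · refine natSA_pair_le (fun r hr hrs => ?_) (fun r hr hrs => ?_)
      · exact meas_of_le (meas_natSA W₁ hr hrs) le_sup_left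
      · exact meas_of_le (meas_natSA W₂ hr hrs) le_sup_right
    · rw [← measurable_iff_comap_le]
      exact Measurable.prodMk (
        meas_of_le (comap_measurable _) (le_sup_left : MeasurableSpace.comap (fun ω => W₁ t ω - W₁ s ω) inferInstance ≤ MeasurableSpace.comap (fun ω => W₁ t ω - W₁ s ω) inferInstance ⊔ MeasurableSpace.comap (fun ω => W₂ t ω - W₂ s ω) inferInstance))
        (meas_of_le (comap_measurable _) (le_sup_right : MeasurableSpace.comap (fun ω => W₂ t ω - W₂ s ω) inferInstance ≤ MeasurableSpace.comap (fun ω => W₁ t ω - W₁ s ω) inferInstance ⊔ MeasurableSpace.comap (fun ω => W₂ t ω - W₂ s ω) inferInstance))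
  have hlaw : ∀ s t : ℝ, 0 ≤ s → s ≤ t →
      μ.map (fun ω => (W₁ t ω - W₁ s ω, W₂ t ω - W₂ s ω)) =
      (gaussianReal 0 ((t - s).toNNReal)).prod (gaussianReal 0 ((t - s).toNNReal)) := by
    intro s t hs hst
    have ht := hs.trans hst
    have hi : IndepFun (fun ω => W₁ t ω - W₁ s ω) (fun ω => W₂ t ω - W₂ s ω) μ := by
      have hφ : Measurable (fun f : ℝ → ℝ => f t - f s) := by fun_prop
      exact h12.comp hφ hφ
    have md1 : Measurable (fun ω => W₁ t ω - W₁ s ω) := (m1 t ht).sub (m1 s hs)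
    have md2 : Measurable (fun ω => W₂ t ω - W₂ s ω) := (m2 t ht).sub (m2 s hs)
    rw [(indepFun_iff_map_prod_eq_prod_map_map md1.aemeasurable md2.aemeasurable).1 hi, h1.law s t hs hst, h2.law s t hs hst]
  refine ⟨U₁, U₂, hUW, fun α β hαβ => ?_⟩
  have hT : Measurable (fun p : ℝ × ℝ => (α * p.1 + β * p.2, -β * p.1 + α * p.2)) := by fun_prop
  have haeq : ∀ s t : ℝ, (fun ω => (α * U₁ t ω + β * U₂ t ω - (α * U₁ s ω + β * U₂ s ω),
      -β * U₁ t ω + α * U₂ t ω - (-β * U₁ s ω + α * U₂ s ω))) =ᵐ[μ]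
      (fun p : ℝ × ℝ => (α * p.1 + β * p.2, -β * p.1 + α * p.2)) ∘
        (fun ω => (W₁ t ω - W₁ s ω, W₂ t ω - W₂ s ω)) := by
    intro s t
    filter_upwards [hUW] with ω hω
    simp only [Function.comp_apply, (hω t).1, (hω t).2, (hω s).1, (hω s).2, Prod.mk.injEq]
    constructor <;> ring
  refine ⟨Gf_le _ _, Gf_mono _ _, fun t A => Gf_null _ _ _, ?_, ?_, ?_, ?_, ?_, ?_, ?_, ?_⟩
  · intro t ht
    exact ((g1 t ht).const_mul _).add ((g2 t ht).const_mul _)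
  · intro t ht
    exact ((g1 t ht).const_mul _).add ((g2 t ht).const_mul _)
  · intro ω; exact ((c1 ω).const_mul α).add ((c2 ω).const_mul β)
  · intro ω; exact ((c1 ω).const_mul (-β)).add ((c2 ω).const_mul α)
  · intro ω
    by_cases hω : ω ∈ N
    · simp [U₁, U₂, hω]
    · simp [U₁, U₂, hω, (hN ω hω).1.1, (hN ω hω).1.2]
  · intro ω
    by_cases hω : ω ∈ N
    · simp [U₁, U₂, hω]
    · simp [U₁, U₂, hω, (hN ω hω).1.1, (hN ω hω).1.2]
  · intro s t hs hst
    have ht := hs.trans hst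
    have md1 : Measurable (fun ω => W₁ t ω - W₁ s ω) := (m1 t ht).sub (m1 s hs)
    have md2 : Measurable (fun ω => W₂ t ω - W₂ s ω) := (m2 t ht).sub (m2 s hs)
    rw [Measure.map_congr (haeq s t), ← Measure.map_map hT (md1.prodMk md2), hlaw s t hs hst,
      gauss_rot _ α β hαβ]
  · intro s t hs hst
    have hi := indep_Gf (hind s t hs hst)
    rw [Indep_iff] at hi ⊢
    rintro _ B ⟨S, hS, rfl⟩ hB
    have e : ((fun ω => (α * U₁ t ω + β * U₂ t ω - (α * U₁ s ω + β * U₂ s ω),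
      -β * U₁ t ω + α * U₂ t ω - (-β * U₁ s ω + α * U₂ s ω))) ⁻¹' S : Set Ω) =ᵐ[μ]
      ((fun ω => (W₁ t ω - W₁ s ω, W₂ t ω - W₂ s ω)) ⁻¹'
        ((fun p : ℝ × ℝ => (α * p.1 + β * p.2, -β * p.1 + α * p.2)) ⁻¹' S) : Set Ω) := by
      rw [← preimage_comp]
      filter_upwards [haeq s t] with ω hω
      apply propext
      exact Iff.of_eq (congrArg (· ∈ S) hω)
    rw [measure_congr e, measure_congr (e.inter (EventuallyEq.rfl (f := B)))]
    exact hi _ B ⟨_, hT hS, rfl⟩ hB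

end PBsec

section Isosec
set_option linter.unusedSectionVars false
variable {Ω : Type*} [m : MeasurableSpace Ω] {μ : Measure Ω} {G : ℝ → MeasurableSpace Ω}
  {V Q : ℝ → Ω → ℝ}

lemma PB.mV (h : PB μ G V Q) {t : ℝ} (ht : 0 ≤ t) : Measurable (V t) :=
  meas_of_le (h.adV t ht) (h.le t)

lemma PB.mQ (h : PB μ G V Q) {t : ℝ} (ht : 0 ≤ t) : Measurable (Q t) :=
  meas_of_le (h.adQ t ht) (h.le t)

lemma PB.mD (h : PB μ G V Q) {a b : ℝ} (ha : 0 ≤ a) (hab : a ≤ b) :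
    Measurable (fun ω => V b ω - V a ω) := (h.mV (ha.trans hab)).sub (h.mV ha)

lemma PB.mDQ (h : PB μ G V Q) {a b : ℝ} (ha : 0 ≤ a) (hab : a ≤ b) :
    Measurable (fun ω => Q b ω - Q a ω) := (h.mQ (ha.trans hab)).sub (h.mQ ha)

lemma PB.indepPair (h : PB μ G V Q) {a b : ℝ} (ha : 0 ≤ a) (hab : a ≤ b)
    {E : Type*} [MeasurableSpace E] {X : Ω → E}
    (hX : Measurable[G a] X) : IndepFun X (fun ω => (V b ω - V a ω, Q b ω - Q a ω)) μ := by
  rw [IndepFun_iff_Indep]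
  exact (indep_of_indep_of_le_right (h.indep a b ha hab) hX.comap_le).symm

lemma PB.indepX (h : PB μ G V Q) {a b : ℝ} (ha : 0 ≤ a) (hab : a ≤ b)
    {E : Type*} [MeasurableSpace E] {X : Ω → E}
    (hX : Measurable[G a] X) : IndepFun X (fun ω => V b ω - V a ω) μ :=
  (h.indepPair ha hab hX).comp measurable_id measurable_fst

lemma PB.lawV (h : PB μ G V Q) {a b : ℝ} (ha : 0 ≤ a) (hab : a ≤ b) :
    μ.map (fun ω => V b ω - V a ω) = gaussianReal 0 ((b - a).toNNReal) := by
  have := congrArg (Measure.map Prod.fst) (h.law a b ha hab)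
  rw [Measure.map_map measurable_fst ((h.mD ha hab).prodMk (h.mDQ ha hab)),
    ← Measure.fst, Measure.fst_prod] at this
  exact this

lemma PB.memLpD (h : PB μ G V Q) {a b : ℝ} (ha : 0 ≤ a) (hab : a ≤ b) :
    MemLp (fun ω => V b ω - V a ω) 2 μ := by
  have h1 := memLp_id_gaussianReal (μ := 0) (v := (b - a).toNNReal) 2
  rw [← h.lawV ha hab] at h1
  exact (memLp_map_measure_iff (by fun_prop) (h.mD ha hab).aemeasurable).1 h1

variable [IsProbabilityMeasure μ]

lemma PB.intD (h : PB μ G V Q) {a b : ℝ} (ha : 0 ≤ a) (hab : a ≤ b) :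
    ∫ ω, (V b ω - V a ω) ∂μ = 0 := by
  have h1 := integral_id_gaussianReal (μ := 0) (v := (b - a).toNNReal)
  rw [← h.lawV ha hab, integral_map (h.mD ha hab).aemeasurable (by fun_prop)] at h1
  exact h1

lemma PB.intD2 (h : PB μ G V Q) {a b : ℝ} (ha : 0 ≤ a) (hab : a ≤ b) :
    ∫ ω, (V b ω - V a ω) ^ 2 ∂μ = b - a := by
  have h1 := variance_id_gaussianReal (μ := 0) (v := (b - a).toNNReal)
  rw [variance_eq_integral (by fun_prop), show ∫ x, id x ∂(gaussianReal 0 (b - a).toNNReal) = 0 from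
      integral_id_gaussianReal,
    ← h.lawV ha hab, integral_map (h.mD ha hab).aemeasurable (by fun_prop)] at h1
  simpa [Real.coe_toNNReal _ (sub_nonneg.2 hab)] using h1

lemma PB.mean0 (h : PB μ G V Q) {a b : ℝ} (ha : 0 ≤ a) (hab : a ≤ b) {X : Ω → ℝ}
    (hX : Measurable[G a] X) (hi : Integrable X μ) :
    Integrable (fun ω => X ω * (V b ω - V a ω)) μ ∧ ∫ ω, X ω * (V b ω - V a ω) ∂μ = 0 := by
  have hind := h.indepX ha hab hX
  have hD := (h.memLpD ha hab).integrable (by norm_num)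
  refine ⟨hind.integrable_mul hi hD, ?_⟩
  rw [hind.integral_fun_mul_eq_mul_integral hi.1 hD.1, h.intD ha hab, mul_zero]

lemma PB.sq (h : PB μ G V Q) {a b : ℝ} (ha : 0 ≤ a) (hab : a ≤ b) {X : Ω → ℝ}
    (hX : Measurable[G a] X) (hi : Integrable X μ) :
    Integrable (fun ω => X ω * (V b ω - V a ω) ^ 2) μ ∧
      ∫ ω, X ω * (V b ω - V a ω) ^ 2 ∂μ = (∫ ω, X ω ∂μ) * (b - a) := by
  have hind := (h.indepX ha hab hX).comp measurable_id
    (measurable_id.pow_const 2 : Measurable fun x : ℝ => x ^ 2)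
  have hD := (h.memLpD ha hab).integrable_sq
  refine ⟨hind.integrable_mul hi hD, ?_⟩
  have := hind.integral_fun_mul_eq_mul_integral hi.1 hD.1
  simp only [Function.comp_apply, id] at this
  rw [this, h.intD2 ha hab]

lemma integrable_of_bdd {X : Ω → ℝ} (hX : Measurable X) {C : ℝ} (hC : ∀ ω, |X ω| ≤ C) :
    Integrable X μ := Integrable.of_bound hX.aestronglyMeasurable C (ae_of_all _ hC)

/-- pairwise isometry, when `a ≤ a'`. -/
lemma PB.pair_aux (h : PB μ G V Q) {a b a' b' : ℝ} (ha : 0 ≤ a) (hab : a ≤ b) (hab' : a' ≤ b')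
    (haa : a ≤ a') {c c' : Ω → ℝ} (hc : Measurable[G a] c) (hc' : Measurable[G a'] c') {C : ℝ}
    (hC : ∀ ω, |c ω| ≤ C) (hC' : ∀ ω, |c' ω| ≤ C) :
    ∫ ω, (c ω * (V b ω - V a ω)) * (c' ω * (V b' ω - V a' ω)) ∂μ =
      (∫ ω, c ω * c' ω ∂μ) * max 0 (min b b' - max a a') := by
  have ha' : 0 ≤ a' := ha.trans haa
  have hb : 0 ≤ b := ha.trans hab
  have hb' : 0 ≤ b' := ha'.trans hab'
  have hCn : 0 ≤ C := by
    obtain ⟨ω⟩ : Nonempty Ω := nonempty_of_isProbabilityMeasure μ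
    exact (abs_nonneg _).trans (hC ω)
  rw [max_eq_right haa]
  have hcc : Measurable[G a'] (fun ω => c ω * c' ω) := (meas_of_le hc (h.mono haa)).mul hc'
  have hccb : ∀ ω, |c ω * c' ω| ≤ C * C := fun ω => by
    rw [abs_mul]; exact mul_le_mul (hC ω) (hC' ω) (abs_nonneg _) hCn
  have hcci : Integrable (fun ω => c ω * c' ω) μ := integrable_of_bdd (meas_of_le hcc (h.le _)) hccb
  -- first piece orthogonal
  have key : ∀ r, a ≤ r → r ≤ a' →
      Integrable (fun ω => (c ω * c' ω) * (V r ω - V a ω) * (V b' ω - V a' ω)) μ ∧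
      ∫ ω, (c ω * c' ω) * (V r ω - V a ω) * (V b' ω - V a' ω) ∂μ = 0 := by
    intro r har hra
    refine h.mean0 ha' hab' (X := fun ω => (c ω * c' ω) * (V r ω - V a ω)) ?_ ?_
    · exact hcc.mul ((meas_of_le (h.adV r (ha.trans har)) (h.mono hra)).sub
        (meas_of_le (h.adV a ha) (h.mono haa)))
    · exact ((h.memLpD ha har).integrable (by norm_num)).bdd_mul
        (meas_of_le hcc (h.le _)).aestronglyMeasurable (ae_of_all _ hccb)
  by_cases hba : b ≤ a'
  · rw [max_eq_left (by have := min_le_left b b'; linarith), mul_zero, ← (key b hab hba).2]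
    congr 1; ext ω; ring
  · push Not at hba
    have k2 : ∀ p q, a' ≤ p → p ≤ q →
      Integrable (fun ω => (c ω * c' ω) * (V p ω - V a' ω) * (V q ω - V a' ω)) μ ∧
      ∫ ω, (c ω * c' ω) * (V p ω - V a' ω) * (V q ω - V a' ω) ∂μ =
        (∫ ω, c ω * c' ω ∂μ) * (p - a') := by
      intro p q hp hpq
      have hp0 := ha'.trans hp
      have e1 := h.sq ha' hp hcc hcci
      have e2 := h.mean0 hp0 hpq (X := fun ω => (c ω * c' ω) * (V p ω - V a' ω))
        ((meas_of_le hcc (h.mono hp)).mul ((h.adV p hp0).sub (meas_of_le (h.adV a' ha') (h.mono hp))))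
        (((h.memLpD ha' hp).integrable (by norm_num)).bdd_mul
        (meas_of_le hcc (h.le _)).aestronglyMeasurable (ae_of_all _ hccb))
      have e : (fun ω => (c ω * c' ω) * (V p ω - V a' ω) * (V q ω - V a' ω)) =
          fun ω => (c ω * c' ω) * (V p ω - V a' ω) ^ 2 +
            (c ω * c' ω) * (V p ω - V a' ω) * (V q ω - V p ω) := by
        ext ω; ring
      rw [e]
      refine ⟨e1.1.add e2.1, ?_⟩
      rw [integral_add e1.1 e2.1, e1.2, e2.2, add_zero]
    have e : (fun ω => (c ω * (V b ω - V a ω)) * (c' ω * (V b' ω - V a' ω))) =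
        fun ω => (c ω * c' ω) * (V a' ω - V a ω) * (V b' ω - V a' ω) +
          (c ω * c' ω) * (V b ω - V a' ω) * (V b' ω - V a' ω) := by
      ext ω; ring
    rw [e]
    have k1 := key a' haa le_rfl
    rcases le_total b b' with hbb | hbb
    · have k := k2 b b' hba.le hbb
      rw [integral_add k1.1 k.1, k1.2, k.2, zero_add, min_eq_left hbb, max_eq_right (by linarith)]
    · have k := k2 b' b hab' hbb
      have e3 : (fun ω => (c ω * c' ω) * (V b ω - V a' ω) * (V b' ω - V a' ω)) =
        (fun ω => (c ω * c' ω) * (V b' ω - V a' ω) * (V b ω - V a' ω)) := by ext ω; ring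
      rw [integral_add k1.1 (by rw [e3]; exact k.1), k1.2, e3, k.2, zero_add, min_eq_right hbb,
        max_eq_right (by linarith)]

lemma PB.pair (h : PB μ G V Q) {a b a' b' : ℝ} (ha : 0 ≤ a) (ha' : 0 ≤ a')
    (hab : a ≤ b) (hab' : a' ≤ b')
    {c c' : Ω → ℝ} (hc : Measurable[G a] c) (hc' : Measurable[G a'] c') {C : ℝ}
    (hC : ∀ ω, |c ω| ≤ C) (hC' : ∀ ω, |c' ω| ≤ C) :
    ∫ ω, (c ω * (V b ω - V a ω)) * (c' ω * (V b' ω - V a' ω)) ∂μ =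
      (∫ ω, c ω * c' ω ∂μ) * max 0 (min b b' - max a a') := by
  rcases le_total a a' with haa | haa
  · exact h.pair_aux ha hab hab' haa hc hc' hC hC'
  · have := h.pair_aux ha' hab' hab haa hc' hc hC' hC
    rw [min_comm, max_comm a]
    simp only [mul_comm (c' _) (c _)] at this
    rw [← this]
    congr 1; ext ω; ring

/-- the step integrand of a finite family. -/
def stepF {ι : Type*} (I : Finset ι) (a b : ι → ℝ) (c : ι → Ω → ℝ) (s : ℝ) (ω : Ω) : ℝ :=
  ∑ i ∈ I, c i ω * (Ioc (a i) (b i)).indicator (fun _ => (1:ℝ)) s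

def stepI {ι : Type*} (V : ℝ → Ω → ℝ) (I : Finset ι) (a b : ι → ℝ) (c : ι → Ω → ℝ) (ω : Ω) : ℝ :=
  ∑ i ∈ I, c i ω * (V (b i) ω - V (a i) ω)

lemma ind_int (a b a' b' : ℝ) :
    Integrable (fun s => (Ioc a b).indicator (fun _ => (1:ℝ)) s * (Ioc a' b').indicator (fun _ => (1:ℝ)) s) ∧
    ∫ s, (Ioc a b).indicator (fun _ => (1:ℝ)) s * (Ioc a' b').indicator (fun _ => (1:ℝ)) s
      = max 0 (min b b' - max a a') := by
  have e : (fun s => (Ioc a b).indicator (fun _ => (1:ℝ)) s * (Ioc a' b').indicator (fun _ => (1:ℝ)) s)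
      = (Ioc (max a a') (min b b')).indicator (fun _ => (1:ℝ)) := by
    ext s
    simp only [indicator_apply, mem_Ioc, max_lt_iff, le_min_iff]
    split_ifs <;> first | simp; done | (exfalso; tauto)
  rw [e]
  refine ⟨(integrableOn_const (by simp)).integrable_indicator measurableSet_Ioc, ?_⟩
  rw [integral_indicator measurableSet_Ioc]
  simp [max_comm]

structure StepFam {ι : Type*} (G : ℝ → MeasurableSpace Ω) (I : Finset ι) (a b : ι → ℝ)
    (c : ι → Ω → ℝ) : Prop where
  nonneg : ∀ i ∈ I, 0 ≤ a i
  le : ∀ i ∈ I, a i ≤ b i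
  meas : ∀ i ∈ I, Measurable[G (a i)] (c i)
  bdd : ∃ C, ∀ i ∈ I, ∀ ω, |c i ω| ≤ C

lemma StepFam.memLp1 {ι : Type*} {I : Finset ι} {a b : ι → ℝ} {c : ι → Ω → ℝ}
    (f : StepFam G I a b c) (h : PB μ G V Q) {i : ι} (hi : i ∈ I) :
    MemLp (fun ω => c i ω * (V (b i) ω - V (a i) ω)) 2 μ := by
  obtain ⟨C, hC⟩ := f.bdd
  exact (h.memLpD (f.nonneg i hi) (f.le i hi)).of_le_mul (c := C)
    ((meas_of_le (f.meas i hi) (h.le _)).aestronglyMeasurable.mul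
      (h.mD (f.nonneg i hi) (f.le i hi)).aestronglyMeasurable)
    (ae_of_all _ fun ω => by
      rw [norm_mul]
      exact mul_le_mul_of_nonneg_right (hC i hi ω) (norm_nonneg _))

lemma StepFam.memLp {ι : Type*} {I : Finset ι} {a b : ι → ℝ} {c : ι → Ω → ℝ}
    (f : StepFam G I a b c) (h : PB μ G V Q) : MemLp (stepI V I a b c) 2 μ :=
  memLp_finsetSum _ (fun _ hi => f.memLp1 h hi)

lemma StepFam.iso {ι : Type*} {I : Finset ι} {a b : ι → ℝ} {c : ι → Ω → ℝ}
    (f : StepFam G I a b c) (h : PB μ G V Q) :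
    ∫ ω, stepI V I a b c ω ^ 2 ∂μ = ∫ s, ∫ ω, stepF I a b c s ω ^ 2 ∂μ := by
  obtain ⟨C, hC⟩ := f.bdd
  have mc : ∀ i ∈ I, Measurable (c i) := fun i hi => meas_of_le (f.meas i hi) (h.le _)
  have ic : ∀ i ∈ I, ∀ j ∈ I, Integrable (fun ω => c i ω * c j ω) μ := fun i hi j hj => by
    refine integrable_of_bdd ((mc i hi).mul (mc j hj)) (C := C * C) fun ω => ?_
    rw [abs_mul]
    exact mul_le_mul (hC i hi ω) (hC j hj ω) (abs_nonneg _) ((abs_nonneg _).trans (hC i hi ω))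
  have e1 : ∀ ω, stepI V I a b c ω ^ 2 = ∑ i ∈ I, ∑ j ∈ I,
      (c i ω * (V (b i) ω - V (a i) ω)) * (c j ω * (V (b j) ω - V (a j) ω)) := fun ω => by
    rw [_root_.sq, stepI, Finset.sum_mul_sum]
  have e2 : ∀ s ω, stepF I a b c s ω ^ 2 = ∑ i ∈ I, ∑ j ∈ I, (c i ω * c j ω) *
      ((Ioc (a i) (b i)).indicator (fun _ => (1:ℝ)) s *
        (Ioc (a j) (b j)).indicator (fun _ => (1:ℝ)) s) := fun s ω => by
    rw [_root_.sq, stepF, Finset.sum_mul_sum]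
    refine Finset.sum_congr rfl fun i _ => Finset.sum_congr rfl fun j _ => by ring
  have ii : ∀ i ∈ I, ∀ j ∈ I, Integrable (fun ω => (c i ω * (V (b i) ω - V (a i) ω)) *
      (c j ω * (V (b j) ω - V (a j) ω))) μ := fun i hi j hj =>
    (f.memLp1 h hi).integrable_mul (f.memLp1 h hj)
  simp only [e1, e2]
  rw [integral_finsetSum _ (fun i hi => integrable_finsetSum _ fun j hj =>
    ii i hi j hj)]
  have e3 : ∀ s, ∫ ω, ∑ i ∈ I, ∑ j ∈ I, (c i ω * c j ω) *
      ((Ioc (a i) (b i)).indicator (fun _ => (1:ℝ)) s *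
        (Ioc (a j) (b j)).indicator (fun _ => (1:ℝ)) s) ∂μ = ∑ i ∈ I, ∑ j ∈ I,
      (∫ ω, c i ω * c j ω ∂μ) * ((Ioc (a i) (b i)).indicator (fun _ => (1:ℝ)) s *
        (Ioc (a j) (b j)).indicator (fun _ => (1:ℝ)) s) := by
    intro s
    rw [integral_finsetSum _ (fun i hi => integrable_finsetSum _ fun j hj =>
      (ic i hi j hj).mul_const _)]
    refine Finset.sum_congr rfl fun i hi => ?_
    rw [integral_finsetSum _ (fun j hj => (ic i hi j hj).mul_const _)]
    refine Finset.sum_congr rfl fun j hj => ?_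
    rw [integral_mul_const]
  simp only [e3]
  rw [integral_finsetSum _ (fun i hi => integrable_finsetSum _ fun j hj =>
      (ind_int _ _ _ _).1.const_mul _)]
  refine Finset.sum_congr rfl fun i hi => ?_
  rw [integral_finsetSum _ (fun j hj => (ind_int _ _ _ _).1.const_mul _),
    integral_finsetSum _ (fun j hj => ii i hi j hj)]
  refine Finset.sum_congr rfl fun j hj => ?_
  rw [integral_const_mul, (ind_int _ _ _ _).2]
  exact h.pair (f.nonneg i hi) (f.nonneg j hj) (f.le i hi) (f.le j hj) (f.meas i hi) (f.meas j hj)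
    (hC i hi) (hC j hj)

lemma step_tendsto {ι κ : Type*} {l : Filter κ} [l.IsCountablyGenerated] {I : κ → Finset ι}
    {a b : κ → ι → ℝ} {c : κ → ι → Ω → ℝ}
    (f : ∀ n, StepFam G (I n) (a n) (b n) (c n)) (h : PB μ G V Q) {C T : ℝ}
    (hC : ∀ᶠ n in l, ∀ s ω, |stepF (I n) (a n) (b n) (c n) s ω| ≤ C)
    (hT : ∀ᶠ n in l, ∀ s ω, s ∉ Ioc 0 T → stepF (I n) (a n) (b n) (c n) s ω = 0)
    (hlim : ∀ᵐ s : ℝ, s ∈ Ioc 0 T →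
      ∀ᵐ ω ∂μ, Tendsto (fun n => stepF (I n) (a n) (b n) (c n) s ω) l (nhds 0)) :
    Tendsto (fun n => ∫ ω, stepI V (I n) (a n) (b n) (c n) ω ^ 2 ∂μ) l (nhds 0) := by
  simp only [fun n => (f n).iso h]
  have mc : ∀ n, ∀ i ∈ I n, Measurable (c n i) := fun n i hi =>
    meas_of_le ((f n).meas i hi) (h.le _)
  have mp : ∀ n, Measurable (fun p : ℝ × Ω => stepF (I n) (a n) (b n) (c n) p.1 p.2) := by
    intro n
    refine Finset.measurable_sum _ fun i hi => ?_
    exact ((mc n i hi).comp measurable_snd).mul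
      ((measurable_const.indicator measurableSet_Ioc).comp measurable_fst)
  have ms : ∀ n s, Measurable (fun ω => stepF (I n) (a n) (b n) (c n) s ω) := fun n s =>
    (mp n).comp (measurable_const.prodMk measurable_id)
  have key := tendsto_integral_filter_of_dominated_convergence (μ := (volume : Measure ℝ)) (l := l)
    (F := fun n s => ∫ ω, stepF (I n) (a n) (b n) (c n) s ω ^ 2 ∂μ) (f := fun _ => (0:ℝ))
    ((Ioc 0 T).indicator (fun _ => C ^ 2)) ?_ ?_ ?_ ?_
  · simpa using key
  · refine Eventually.of_forall fun n => ?_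
    have : StronglyMeasurable (fun p : ℝ × Ω => stepF (I n) (a n) (b n) (c n) p.1 p.2 ^ 2) :=
      ((mp n).pow_const 2).stronglyMeasurable
    exact this.integral_prod_right.aestronglyMeasurable
  · filter_upwards [hC, hT] with n hC hT
    refine ae_of_all _ fun s => ?_
    by_cases hs : s ∈ Ioc 0 T
    · rw [indicator_of_mem hs]
      have := norm_integral_le_of_norm_le_const (μ := μ)
        (f := fun ω => stepF (I n) (a n) (b n) (c n) s ω ^ 2) (C := C ^ 2) (ae_of_all _ fun ω => by
          rw [Real.norm_eq_abs, abs_pow]; exact pow_le_pow_left₀ (abs_nonneg _) (hC s ω) 2)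
      simpa using this
    · rw [indicator_of_notMem hs]
      simp [hT s _ hs]
  · exact (integrableOn_const (by simp)).integrable_indicator measurableSet_Ioc
  · filter_upwards [hlim] with s hs
    by_cases hsT : s ∈ Ioc 0 T
    · have := tendsto_integral_filter_of_dominated_convergence (μ := μ) (l := l)
        (F := fun n ω => stepF (I n) (a n) (b n) (c n) s ω ^ 2) (f := fun _ => (0:ℝ))
        (fun _ => C ^ 2) (Eventually.of_forall fun n => ((ms n s).pow_const 2).aestronglyMeasurable)
        (by
          filter_upwards [hC] with n hC
          refine ae_of_all _ fun ω => ?_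
          rw [Real.norm_eq_abs, abs_pow]; exact pow_le_pow_left₀ (abs_nonneg _) (hC s ω) 2)
        (integrable_const _) (by
          filter_upwards [hs hsT] with ω hω
          simpa using hω.pow 2)
      simpa using this
    · refine tendsto_const_nhds.congr' ?_
      filter_upwards [hT] with n hT
      simp [hT s _ hsT]

end Isosec

section Gridsec
set_option linter.unusedSectionVars false
variable {Ω : Type*} [m : MeasurableSpace Ω] {μ : Measure Ω} {G : ℝ → MeasurableSpace Ω}
  {V Q : ℝ → Ω → ℝ}

/-- left-point sum over the grid of mesh `δ` with `M` intervals. -/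
def gsum (K V : ℝ → Ω → ℝ) (δ : ℝ) (M : ℕ) (ω : Ω) : ℝ :=
  ∑ i ∈ Finset.range M, K (δ * i) ω * (V (δ * (i + 1)) ω - V (δ * i) ω)

lemma rsum_eq_gsum (K V : ℝ → Ω → ℝ) (t : ℝ) (n : ℕ) :
    rsum K V t n = gsum K V (t / 2 ^ n) (2 ^ n) := by
  ext ω
  unfold rsum gsum
  refine Finset.sum_congr rfl fun i _ => ?_
  have e1 : t * (i:ℝ) / 2 ^ n = t / 2 ^ n * i := by ring
  have e2 : t * ((i:ℝ) + 1) / 2 ^ n = t / 2 ^ n * (i + 1) := by ring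
  rw [e1, e2]

lemma stepF_grid {δ : ℝ} (hδ : 0 < δ) (M : ℕ) (c : ℕ → Ω → ℝ) (s : ℝ) (ω : Ω) :
    stepF (Finset.range M) (fun i : ℕ => δ * i) (fun i : ℕ => δ * (i + 1)) c s ω =
      if 0 < s ∧ s ≤ δ * M then c (⌈s / δ⌉₊ - 1) ω else 0 := by
  unfold stepF
  have hiff : ∀ i : ℕ, s ∈ Ioc (δ * (i:ℝ)) (δ * (i + 1)) ↔ 0 < s ∧ i = ⌈s / δ⌉₊ - 1 := by
    intro i
    have h1 : δ * (i:ℝ) < s ↔ (i:ℝ) < s / δ := by rw [lt_div_iff₀ hδ, mul_comm]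
    have h2 : s ≤ δ * ((i:ℝ) + 1) ↔ s / δ ≤ ((i + 1 : ℕ) : ℝ) := by
      rw [div_le_iff₀ hδ, mul_comm]; push_cast; rfl
    rw [mem_Ioc, h1, h2, ← Nat.lt_ceil, ← Nat.ceil_le]
    constructor
    · rintro ⟨h3, h4⟩
      refine ⟨?_, by omega⟩
      have : 0 < ⌈s / δ⌉₊ := by omega
      have := Nat.ceil_pos.1 this
      exact (div_pos_iff_of_pos_right hδ).1 this
    · rintro ⟨h3, h4⟩
      have : 0 < ⌈s / δ⌉₊ := Nat.ceil_pos.2 (div_pos h3 hδ)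
      omega
  split_ifs with hs
  · have hpos : 0 < ⌈s / δ⌉₊ := Nat.ceil_pos.2 (div_pos hs.1 hδ)
    have hM : ⌈s / δ⌉₊ ≤ M := by
      rw [Nat.ceil_le, div_le_iff₀ hδ, mul_comm]; exact hs.2
    rw [Finset.sum_eq_single_of_mem (⌈s / δ⌉₊ - 1) (by simp; omega)]
    · rw [indicator_of_mem ((hiff _).2 ⟨hs.1, rfl⟩), mul_one]
    · intro i _ hi
      rw [indicator_of_notMem (fun h => hi ((hiff i).1 h).2), mul_zero]
  · refine Finset.sum_eq_zero fun i hi => ?_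
    rw [indicator_of_notMem, mul_zero]
    intro h
    have h' := (hiff i).1 h
    refine hs ⟨h'.1, h.2.trans ?_⟩
    have : (i:ℝ) + 1 ≤ M := by exact_mod_cast Finset.mem_range.1 hi
    exact mul_le_mul_of_nonneg_left this hδ.le

lemma grid_left {δ s : ℝ} (hδ : 0 < δ) (hs : 0 < s) :
    δ * ((⌈s / δ⌉₊ - 1 : ℕ) : ℝ) < s ∧ s - δ ≤ δ * ((⌈s / δ⌉₊ - 1 : ℕ) : ℝ) := by
  have hpos : 0 < ⌈s / δ⌉₊ := Nat.ceil_pos.2 (div_pos hs hδ)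
  have h1 : ((⌈s / δ⌉₊ - 1 : ℕ) : ℝ) < s / δ := by rw [← Nat.lt_ceil]; omega
  have h2 : s / δ ≤ (((⌈s / δ⌉₊ - 1 : ℕ) + 1 : ℕ) : ℝ) := by
    rw [← Nat.ceil_le]; omega
  rw [lt_div_iff₀ hδ] at h1
  rw [div_le_iff₀ hδ] at h2
  push_cast at h2
  constructor <;> linarith

lemma grid_left_tendsto {κ : Type*} {l : Filter κ} {δ : κ → ℝ} (hδ : ∀ n, 0 < δ n)
    (h : Tendsto δ l (nhds 0)) {s : ℝ} (hs : 0 < s) :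
    Tendsto (fun n => δ n * ((⌈s / δ n⌉₊ - 1 : ℕ) : ℝ)) l (nhds s) := by
  refine tendsto_of_tendsto_of_tendsto_of_le_of_le (g := fun n => s - δ n) (h := fun _ => s)
    (by simpa using (tendsto_const_nhds (x := s)).sub h) tendsto_const_nhds
    (fun n => (grid_left (hδ n) hs).2) (fun n => (grid_left (hδ n) hs).1.le)

/-- An admissible integrand. -/
structure Adm (μ : Measure Ω) (G : ℝ → MeasurableSpace Ω) (K : ℝ → Ω → ℝ) (C : ℝ) : Prop where
  meas : ∀ s : ℝ, 0 ≤ s → Measurable[G s] (K s)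
  bdd : ∀ s ω, |K s ω| ≤ C
  cont : ∀ s : ℝ, 0 < s → ∀ᵐ ω ∂μ, ContinuousAt (fun r => K r ω) s

lemma stepFam_grid {δ : ℝ} (hδ : 0 < δ) (M : ℕ) {c : ℕ → Ω → ℝ}
    (hc : ∀ i : ℕ, Measurable[G (δ * i)] (c i)) {C : ℝ} (hC : ∀ i ω, |c i ω| ≤ C) :
    StepFam G (Finset.range M) (fun i : ℕ => δ * i) (fun i : ℕ => δ * (i + 1)) c :=
  ⟨fun i _ => by positivity, fun i _ => by nlinarith, fun i _ => hc i, ⟨C, fun i _ => hC i⟩⟩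

lemma Adm.grid {K : ℝ → Ω → ℝ} {C : ℝ} (hK : Adm μ G K C) {δ : ℝ} (hδ : 0 < δ) (M : ℕ) :
    StepFam G (Finset.range M) (fun i : ℕ => δ * i) (fun i : ℕ => δ * (i + 1))
      (fun i : ℕ => K (δ * i)) :=
  stepFam_grid hδ M (fun i => hK.meas _ (by positivity)) (fun i => hK.bdd _)

variable [IsProbabilityMeasure μ]

lemma Adm.memLp {K : ℝ → Ω → ℝ} {C : ℝ} (hK : Adm μ G K C) (h : PB μ G V Q) {δ : ℝ} (hδ : 0 < δ)
    (M : ℕ) : MemLp (gsum K V δ M) 2 μ := (hK.grid hδ M).memLp h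

lemma Adm.diff {K : ℝ → Ω → ℝ} {C : ℝ} (hK : Adm μ G K C) (h : PB μ G V Q)
    {κ : Type*} {l : Filter κ} [l.IsCountablyGenerated] {t : ℝ}
    {δ δ' : κ → ℝ} {M M' : κ → ℕ} (hδ : ∀ n, 0 < δ n) (hδ' : ∀ n, 0 < δ' n)
    (h0 : Tendsto δ l (nhds 0)) (h0' : Tendsto δ' l (nhds 0))
    (hM : ∀ n, δ n * M n ≤ t) (hM' : ∀ n, δ' n * M' n ≤ t)
    (ht : Tendsto (fun n => δ n * M n) l (nhds t)) (ht' : Tendsto (fun n => δ' n * M' n) l (nhds t)) :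
    Tendsto (fun n => ∫ ω, (gsum K V (δ n) (M n) ω - gsum K V (δ' n) (M' n) ω) ^ 2 ∂μ) l (nhds 0) := by
  let I : κ → Finset (ℕ ⊕ ℕ) := fun n => (Finset.range (M n)).disjSum (Finset.range (M' n))
  let a : κ → ℕ ⊕ ℕ → ℝ := fun n => Sum.elim (fun i : ℕ => δ n * i) (fun i : ℕ => δ' n * i)
  let b : κ → ℕ ⊕ ℕ → ℝ := fun n => Sum.elim (fun i : ℕ => δ n * (i + 1)) (fun i : ℕ => δ' n * (i + 1))
  let c : κ → ℕ ⊕ ℕ → Ω → ℝ := fun n => Sum.elim (fun i : ℕ => K (δ n * i))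
    (fun i : ℕ => fun ω => - K (δ' n * i) ω)
  have hI : ∀ n ω, stepI V (I n) (a n) (b n) (c n) ω =
      gsum K V (δ n) (M n) ω - gsum K V (δ' n) (M' n) ω := by
    intro n ω
    simp only [stepI, I, a, b, c, Finset.sum_disjSum, Sum.elim_inl, Sum.elim_inr, gsum, neg_mul,
      Finset.sum_neg_distrib]
    ring
  have hF : ∀ n s ω, stepF (I n) (a n) (b n) (c n) s ω =
      (if 0 < s ∧ s ≤ δ n * M n then K (δ n * ((⌈s / δ n⌉₊ - 1 : ℕ) : ℝ)) ω else 0) -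
      (if 0 < s ∧ s ≤ δ' n * M' n then K (δ' n * ((⌈s / δ' n⌉₊ - 1 : ℕ) : ℝ)) ω else 0) := by
    intro n s ω
    rw [← stepF_grid (hδ n) (M n) (fun i : ℕ => K (δ n * i)),
      ← stepF_grid (hδ' n) (M' n) (fun i : ℕ => K (δ' n * i))]
    simp only [stepF, I, a, b, c, Finset.sum_disjSum, Sum.elim_inl, Sum.elim_inr, neg_mul,
      Finset.sum_neg_distrib]
    ring
  have hC0 : 0 ≤ C := by
    obtain ⟨ω⟩ : Nonempty Ω := nonempty_of_isProbabilityMeasure μ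
    exact (abs_nonneg _).trans (hK.bdd 0 ω)
  have key := step_tendsto (l := l) (I := I) (a := a) (b := b) (c := c) (T := t) (C := C + C) ?_ h ?_ ?_ ?_
  · simpa only [hI] using key
  · intro n
    have f1 := hK.grid (hδ n) (M n)
    have f2 := hK.grid (hδ' n) (M' n)
    refine ⟨?_, ?_, ?_, ⟨C, ?_⟩⟩
    · rintro (i | i) hi
      · exact f1.nonneg i (by simpa [I] using hi)
      · exact f2.nonneg i (by simpa [I] using hi)
    · rintro (i | i) hi
      · exact f1.le i (by simpa [I] using hi)
      · exact f2.le i (by simpa [I] using hi)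
    · rintro (i | i) hi
      · exact f1.meas i (by simpa [I] using hi)
      · exact (f2.meas i (by simpa [I] using hi)).neg
    · rintro (i | i) hi ω
      · exact hK.bdd _ _
      · simp only [c, Sum.elim_inr, abs_neg]; exact hK.bdd _ _
  · refine Eventually.of_forall fun n s ω => ?_
    rw [hF]
    refine (abs_sub _ _).trans (add_le_add ?_ ?_)
    all_goals
      split_ifs
      · exact hK.bdd _ _
      · simpa using hC0
  · refine Eventually.of_forall fun n s ω hs => ?_
    rw [hF, if_neg, if_neg, sub_zero]
    · exact fun hh => hs ⟨hh.1, hh.2.trans (hM' n)⟩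
    · exact fun hh => hs ⟨hh.1, hh.2.trans (hM n)⟩
  · have : ∀ᵐ s : ℝ, s ≠ t := by simp [ae_iff]
    filter_upwards [this] with s hst hs
    have hst' : s < t := lt_of_le_of_ne hs.2 hst
    filter_upwards [hK.cont s hs.1] with ω hω
    have t1 := hω.tendsto.comp (grid_left_tendsto hδ h0 hs.1)
    have t2 := hω.tendsto.comp (grid_left_tendsto hδ' h0' hs.1)
    have t3 := t1.sub t2
    rw [sub_self] at t3
    refine t3.congr' ?_
    filter_upwards [ht.eventually (lt_mem_nhds hst'), ht'.eventually (lt_mem_nhds hst')] with n h1 h2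
    rw [hF, if_pos ⟨hs.1, h1.le⟩, if_pos ⟨hs.1, h2.le⟩]
    rfl

end Gridsec

section Limsec
set_option linter.unusedSectionVars false
variable {Ω : Type*} [m : MeasurableSpace Ω] {μ : Measure Ω} {G : ℝ → MeasurableSpace Ω}
  {V Q : ℝ → Ω → ℝ}

lemma exists_tim_of_cauchy {f : ℕ → Ω → ℝ} (hf : ∀ n, MemLp (f n) 2 μ)
    (h : Tendsto (fun p : ℕ × ℕ => ∫ ω, (f p.1 ω - f p.2 ω) ^ 2 ∂μ) atTop (nhds 0)) :
    ∃ U : Ω → ℝ, TendstoInMeasure μ f atTop U := by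
  have hc : CauchySeq (fun n => (hf n).toLp (f n)) := by
    rw [cauchySeq_iff_tendsto_dist_atTop_0]
    have h2 := h.sqrt
    rw [Real.sqrt_zero] at h2
    refine h2.congr fun p => ?_
    rw [dist_eq_norm, ← MemLp.toLp_sub, Lp.norm_toLp,
      ((hf p.1).sub (hf p.2)).eLpNorm_eq_integral_rpow_norm (by norm_num) (by norm_num),
      ENNReal.toReal_ofReal (by positivity), Real.sqrt_eq_rpow]
    norm_num
  obtain ⟨U, hU⟩ := cauchySeq_tendsto_of_complete hc
  refine ⟨U, (tendstoInMeasure_of_tendsto_Lp hU).congr_left fun n => ?_⟩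
  exact (hf n).coeFn_toLp

/-- in-measure limits of `M`-measurable functions have `M`-measurable versions. -/
lemma exists_meas_version {M : MeasurableSpace Ω} {f : ℕ → Ω → ℝ} {U : Ω → ℝ}
    (hf : ∀ n, Measurable[M] (f n)) (h : TendstoInMeasure μ f atTop U) :
    ∃ U' : Ω → ℝ, Measurable[M] U' ∧ U' =ᵐ[μ] U := by
  obtain ⟨ns, -, hns⟩ := h.exists_seq_tendsto_ae
  refine ⟨fun ω => limUnder atTop (fun n => f (ns n) ω),
    (@sm_limUnder Ω M (fun n => f (ns n)) (fun n => (hf (ns n)).stronglyMeasurable)).measurable, ?_⟩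
  filter_upwards [hns] with ω hω
  exact hω.limUnder_eq

/-- dyadic floor sums. -/
def fsum (K V : ℝ → Ω → ℝ) (t : ℝ) (n : ℕ) : Ω → ℝ := gsum K V (1 / 2 ^ n) ⌊t * 2 ^ n⌋₊

lemma floor_le' {t : ℝ} (ht : 0 ≤ t) (n : ℕ) : 1 / 2 ^ n * (⌊t * 2 ^ n⌋₊ : ℝ) ≤ t := by
  rw [one_div, inv_mul_le_iff₀ (by positivity), mul_comm]
  exact Nat.floor_le (by positivity)

lemma lt_floor' (t : ℝ) (n : ℕ) : t - 1 / 2 ^ n ≤ 1 / 2 ^ n * (⌊t * 2 ^ n⌋₊ : ℝ) := by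
  have := Nat.lt_floor_add_one (t * 2 ^ n)
  rw [one_div, ← sub_nonneg]
  have h2 : (0:ℝ) < 2 ^ n := by positivity
  have : 0 ≤ (2 ^ n)⁻¹ * ((⌊t * 2 ^ n⌋₊ : ℝ) + 1 - t * 2 ^ n) := by
    apply mul_nonneg (by positivity); linarith
  have e : (2 ^ n)⁻¹ * (t * 2 ^ n) = t := by field_simp
  nlinarith

lemma tendsto_dyad : Tendsto (fun n : ℕ => (1:ℝ) / 2 ^ n) atTop (nhds 0) := by
  have := tendsto_pow_atTop_nhds_zero_of_lt_one (r := (1/2:ℝ)) (by norm_num) (by norm_num)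
  simpa [one_div] using this

lemma floor_tendsto {t : ℝ} (ht : 0 ≤ t) :
    Tendsto (fun n : ℕ => 1 / 2 ^ n * (⌊t * 2 ^ n⌋₊ : ℝ)) atTop (nhds t) := by
  refine tendsto_of_tendsto_of_tendsto_of_le_of_le (g := fun n : ℕ => t - 1 / 2 ^ n) (h := fun _ => t)
    (by simpa using (tendsto_const_nhds (x := t)).sub tendsto_dyad) tendsto_const_nhds
    (fun n => lt_floor' t n) (fun n => floor_le' ht n)

variable [IsProbabilityMeasure μ]

lemma Adm.van_diff {K : ℝ → Ω → ℝ} {C : ℝ} (hK : Adm μ G K C) (h : PB μ G V Q) {t : ℝ} (ht : 0 ≤ t) :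
    Van μ atTop (fun n ω => |fsum K V t n ω - rsum K V t n ω|) := by
  rcases ht.eq_or_lt with rfl | htp
  · refine van_zero.mono fun n => ae_of_all _ fun ω => ?_
    simp [fsum, rsum, gsum]
  · simp only [rsum_eq_gsum]
    refine van_of_sq (fun n => ?_) ?_
    · exact ((hK.memLp h (by positivity) _).sub (hK.memLp h (by positivity) _)).integrable_sq
    · refine hK.diff h (t := t) (fun n => by positivity) (fun n => by positivity) tendsto_dyad ?_
        (fun n => floor_le' ht n) (fun n => ?_) (floor_tendsto ht) ?_
      · simpa [div_eq_mul_inv] using tendsto_dyad.const_mul t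
      · apply le_of_eq; push_cast; field_simp
      · refine tendsto_const_nhds.congr fun n => ?_
        push_cast; field_simp

lemma Adm.tim_fsum {K : ℝ → Ω → ℝ} {C : ℝ} (hK : Adm μ G K C) (h : PB μ G V Q) {t : ℝ} (ht : 0 ≤ t)
    {U : Ω → ℝ} (hU : TendstoInMeasure μ (rsum K V t) atTop U) :
    TendstoInMeasure μ (fsum K V t) atTop U :=
  tim_of_van hU ((hK.van_diff h ht).mono fun n => ae_of_all _ fun ω => by rw [Real.dist_eq])

lemma Adm.tim_rsum {K : ℝ → Ω → ℝ} {C : ℝ} (hK : Adm μ G K C) (h : PB μ G V Q) {t : ℝ} (ht : 0 ≤ t)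
    {U : Ω → ℝ} (hU : TendstoInMeasure μ (fsum K V t) atTop U) :
    TendstoInMeasure μ (rsum K V t) atTop U :=
  tim_of_van hU ((hK.van_diff h ht).mono fun n => ae_of_all _ fun ω => by
    rw [Real.dist_eq, abs_sub_comm])

lemma gsum_meas {K : ℝ → Ω → ℝ} (hK : ∀ s : ℝ, 0 ≤ s → Measurable[G s] (K s)) (h : PB μ G V Q) {δ t : ℝ}
    (hδ : 0 ≤ δ) {M : ℕ} (hM : δ * M ≤ t) : Measurable[G t] (gsum K V δ M) := by
  unfold gsum
  refine Finset.measurable_fun_sum _ fun i hi => ?_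
  have h1 : (i:ℝ) + 1 ≤ M := by exact_mod_cast Finset.mem_range.1 hi
  have h2 : δ * (i + 1) ≤ t := (mul_le_mul_of_nonneg_left h1 hδ).trans hM
  have h3 : δ * i ≤ t := le_trans (by nlinarith) h2
  exact (meas_of_le (hK _ (by positivity)) (h.mono h3)).mul
    ((meas_of_le (h.adV _ (by positivity)) (h.mono h2)).sub
      (meas_of_le (h.adV _ (by positivity)) (h.mono h3)))

lemma Adm.exists_lim {K : ℝ → Ω → ℝ} {C : ℝ} (hK : Adm μ G K C) (h : PB μ G V Q) {t : ℝ} (ht : 0 ≤ t) :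
    ∃ U : Ω → ℝ, Measurable[G t] U ∧ TendstoInMeasure μ (fsum K V t) atTop U := by
  have hc : ∃ U : Ω → ℝ, TendstoInMeasure μ (fsum K V t) atTop U := by
    refine exists_tim_of_cauchy (fun n => hK.memLp h (by positivity) _) ?_
    have t1 : Tendsto (fun p : ℕ × ℕ => p.1) atTop atTop := by rw [← prod_atTop_atTop_eq]; exact tendsto_fst
    have t2 : Tendsto (fun p : ℕ × ℕ => p.2) atTop atTop := by rw [← prod_atTop_atTop_eq]; exact tendsto_snd
    exact hK.diff h (t := t) (l := (atTop : Filter (ℕ × ℕ)))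
      (δ := fun p => 1 / 2 ^ p.1) (δ' := fun p => 1 / 2 ^ p.2)
      (M := fun p => ⌊t * 2 ^ p.1⌋₊) (M' := fun p => ⌊t * 2 ^ p.2⌋₊)
      (fun n => by positivity) (fun n => by positivity) (tendsto_dyad.comp t1) (tendsto_dyad.comp t2)
      (fun n => floor_le' ht _) (fun n => floor_le' ht _) ((floor_tendsto ht).comp t1)
      ((floor_tendsto ht).comp t2)
  obtain ⟨U, hU⟩ := hc
  obtain ⟨U', hm, he⟩ := exists_meas_version (M := G t)
    (fun n => gsum_meas hK.meas h (by positivity) (floor_le' ht n)) hU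
  exact ⟨U', hm, hU.congr_right he.symm⟩

/-- iterated sign sums approximate `V` itself. -/
lemma Adm.prod {H : ℝ → Ω → ℝ} (hK : Adm μ G H 1) (h1 : ∀ s ω, H s ω * H s ω = 1) (h : PB μ G V Q)
    {t : ℝ} (ht : 0 ≤ t) :
    Tendsto (fun p : ℕ × ℕ => ∫ ω, (∑ j ∈ Finset.range (⌊t * 2 ^ p.1⌋₊ * 2 ^ p.2),
      (H (1 / 2 ^ p.1 * ((j / 2 ^ p.2 : ℕ) : ℝ)) ω * H (1 / 2 ^ (p.1 + p.2) * j) ω - 1) *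
        (V (1 / 2 ^ (p.1 + p.2) * (j + 1)) ω - V (1 / 2 ^ (p.1 + p.2) * j) ω)) ^ 2 ∂μ) atTop (nhds 0) := by
  have t1 : Tendsto (fun p : ℕ × ℕ => p.1) atTop atTop := by rw [← prod_atTop_atTop_eq]; exact tendsto_fst
  have t2 : Tendsto (fun p : ℕ × ℕ => p.1 + p.2) atTop atTop :=
    tendsto_atTop_mono (fun p => Nat.le_add_right _ _) t1
  have hδ : ∀ p : ℕ × ℕ, (0:ℝ) < 1 / 2 ^ (p.1 + p.2) := fun p => by positivity
  have hle : ∀ (p : ℕ × ℕ) (j : ℕ), (1:ℝ) / 2 ^ p.1 * ((j / 2 ^ p.2 : ℕ) : ℝ) ≤ 1 / 2 ^ (p.1 + p.2) * j := by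
    intro p j
    have := Nat.div_mul_le_self j (2 ^ p.2)
    have h3 : ((j / 2 ^ p.2 : ℕ) : ℝ) * 2 ^ p.2 ≤ j := by exact_mod_cast this
    rw [pow_add]
    have : (1:ℝ) / (2 ^ p.1 * 2 ^ p.2) * j - 1 / 2 ^ p.1 * ((j / 2 ^ p.2 : ℕ) : ℝ) =
      1 / (2 ^ p.1 * 2 ^ p.2) * (j - ((j / 2 ^ p.2 : ℕ) : ℝ) * 2 ^ p.2) := by field_simp
    rw [← sub_nonneg, this]
    exact mul_nonneg (by positivity) (by linarith)
  have hge : ∀ (p : ℕ × ℕ) (j : ℕ), (1:ℝ) / 2 ^ (p.1 + p.2) * j - 1 / 2 ^ p.1 ≤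
      1 / 2 ^ p.1 * ((j / 2 ^ p.2 : ℕ) : ℝ) := by
    intro p j
    have := Nat.lt_div_mul_add (a := j) (b := 2 ^ p.2) (by positivity)
    have h3 : (j:ℝ) ≤ ((j / 2 ^ p.2 : ℕ) : ℝ) * 2 ^ p.2 + 2 ^ p.2 := by exact_mod_cast this.le
    rw [pow_add]
    have : 1 / 2 ^ p.1 * ((j / 2 ^ p.2 : ℕ) : ℝ) - ((1:ℝ) / (2 ^ p.1 * 2 ^ p.2) * j - 1 / 2 ^ p.1) =
      1 / (2 ^ p.1 * 2 ^ p.2) * (((j / 2 ^ p.2 : ℕ) : ℝ) * 2 ^ p.2 + 2 ^ p.2 - j) := by field_simp; ring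
    rw [← sub_nonneg, this]
    exact mul_nonneg (by positivity) (by linarith)
  let c : ℕ × ℕ → ℕ → Ω → ℝ := fun p j ω =>
    H (1 / 2 ^ p.1 * ((j / 2 ^ p.2 : ℕ) : ℝ)) ω * H (1 / 2 ^ (p.1 + p.2) * j) ω - 1
  have hc2 : ∀ p j ω, |c p j ω| ≤ 2 := by
    intro p j ω
    have a1 := hK.bdd (1 / 2 ^ p.1 * ((j / 2 ^ p.2 : ℕ) : ℝ)) ω
    have a2 := hK.bdd (1 / 2 ^ (p.1 + p.2) * j) ω
    refine (abs_sub _ _).trans ?_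
    rw [abs_mul, abs_one]
    nlinarith [mul_le_mul a1 a2 (abs_nonneg _) zero_le_one]
  have key := step_tendsto (l := (atTop : Filter (ℕ × ℕ))) (μ := μ) (G := G) (V := V) (Q := Q)
    (I := fun p => Finset.range (⌊t * 2 ^ p.1⌋₊ * 2 ^ p.2))
    (a := fun p i => 1 / 2 ^ (p.1 + p.2) * (i:ℝ)) (b := fun p i => 1 / 2 ^ (p.1 + p.2) * ((i:ℝ) + 1))
    (c := c) (C := 2) (T := t) ?_ h ?_ ?_ ?_
  · exact key
  · intro p
    refine stepFam_grid (hδ p) _ (fun i => ?_) (hc2 p)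
    exact (((meas_of_le (hK.meas _ (by positivity)) (h.mono (hle p i))).mul
      (hK.meas _ (by positivity))).sub measurable_const)
  · refine Eventually.of_forall fun p s ω => ?_
    rw [stepF_grid (hδ p)]
    split_ifs
    · exact hc2 _ _ _
    · simp
  · refine Eventually.of_forall fun p s ω hs => ?_
    rw [stepF_grid (hδ p), if_neg]
    rintro ⟨h3, h4⟩
    refine hs ⟨h3, h4.trans ?_⟩
    refine le_trans (le_of_eq ?_) (floor_le' ht p.1)
    push_cast; rw [pow_add]; field_simp
  · refine ae_of_all _ fun s hs => ?_
    filter_upwards [hK.cont s hs.1] with ω hω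
    have g1 := grid_left_tendsto hδ (tendsto_dyad.comp t2) hs.1
    have g2 : Tendsto (fun p : ℕ × ℕ => (1:ℝ) / 2 ^ p.1 *
        (((⌈s / (1 / 2 ^ (p.1 + p.2))⌉₊ - 1 : ℕ) / 2 ^ p.2 : ℕ) : ℝ)) atTop (nhds s) := by
      refine tendsto_of_tendsto_of_tendsto_of_le_of_le (g := fun p : ℕ × ℕ => _ - 1 / 2 ^ p.1)
        ?_ g1 (fun p => hge p _) (fun p => hle p _)
      simpa using g1.sub (tendsto_dyad.comp t1)
    have k1 := ((hω.tendsto.comp g2).mul (hω.tendsto.comp g1)).sub_const 1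
    rw [h1, sub_self] at k1
    have k2 := k1.norm
    rw [norm_zero] at k2
    refine squeeze_zero_norm (fun p => ?_) k2
    rw [stepF_grid (hδ p)]
    split_ifs
    · exact le_rfl
    · simp

end Limsec

section Lawsec
set_option linter.unusedSectionVars false
variable {Ω : Type*} [m : MeasurableSpace Ω] {μ : Measure Ω} {G : ℝ → MeasurableSpace Ω}
  {V Q : ℝ → Ω → ℝ} [IsProbabilityMeasure μ]

lemma PB.signed_law (h : PB μ G V Q) {a b : ℝ} (ha : 0 ≤ a) (hab : a ≤ b)
    {E : Type*} [MeasurableSpace E] {X : Ω → E} (hX : Measurable[G a] X) {K : Ω → ℝ}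
    (hK : Measurable[G a] K) (hK1 : ∀ ω, K ω = 1 ∨ K ω = -1) :
    μ.map (fun ω => (X ω, (K ω * (V b ω - V a ω), Q b ω - Q a ω))) =
      (μ.map X).prod ((gaussianReal 0 ((b - a).toNNReal)).prod (gaussianReal 0 ((b - a).toNNReal))) := by
  have hX' : Measurable X := meas_of_le hX (h.le a)
  have hK' : Measurable K := meas_of_le hK (h.le a)
  have hD : Measurable (fun ω => (V b ω - V a ω, Q b ω - Q a ω)) := (h.mD ha hab).prodMk (h.mDQ ha hab)
  have hXK : Measurable (fun ω => (X ω, K ω)) := hX'.prodMk hK'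
  have hi := h.indepPair ha hab (X := fun ω => (X ω, K ω)) (hX.prodMk hK)
  have e1 := (indepFun_iff_map_prod_eq_prod_map_map hXK.aemeasurable hD.aemeasurable).1 hi
  rw [h.law a b ha hab] at e1
  have hf : MeasurePreserving (Prod.fst : E × ℝ → E) (μ.map (fun ω => (X ω, K ω))) (μ.map X) :=
    ⟨measurable_fst, by rw [Measure.map_map measurable_fst hXK]; rfl⟩
  have : IsProbabilityMeasure (μ.map (fun ω => (X ω, K ω))) :=
    Measure.isProbabilityMeasure_map hXK.aemeasurable
  have hsk := hf.skew_product (μc := (gaussianReal 0 ((b - a).toNNReal)).prod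
      (gaussianReal 0 ((b - a).toNNReal))) (μd := (gaussianReal 0 ((b - a).toNNReal)).prod
      (gaussianReal 0 ((b - a).toNNReal)))
      (g := fun (q : E × ℝ) (d : ℝ × ℝ) => (q.2 * d.1, d.2)) (by fun_prop) (by
        have : ∀ᵐ q ∂(μ.map (fun ω => (X ω, K ω))), q.2 = 1 ∨ q.2 = -1 := by
          refine (ae_map_iff hXK.aemeasurable ?_).2 (ae_of_all _ hK1)
          exact ((measurable_snd (measurableSet_singleton 1)).union
            (measurable_snd (measurableSet_singleton (-1))))
        filter_upwards [this] with q hq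
        rcases hq with hq | hq
        · simp only [hq, one_mul]
          exact Measure.map_id
        · have hneg : MeasurePreserving (fun x : ℝ => q.2 * x) (gaussianReal 0 ((b - a).toNNReal))
              (gaussianReal 0 ((b - a).toNNReal)) := by
            refine ⟨by fun_prop, ?_⟩
            rw [gaussianReal_map_const_mul]
            simp [hq]
          exact (hneg.prod (MeasurePreserving.id _)).map_eq)
  rw [← hsk.map_eq, ← e1, Measure.map_map hsk.measurable (hXK.prodMk hD)]
  rfl

variable {E : Type*} [MeasurableSpace E]

/-- signed increments along a grid. -/
def incs (K : ℕ → Ω → ℝ) (V Q : ℝ → Ω → ℝ) (p : ℕ → ℝ) (N : ℕ) (ω : Ω) : ℕ → ℝ × ℝ :=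
  fun j => if j < N then (K j ω * (V (p (j + 1)) ω - V (p j) ω), Q (p (j + 1)) ω - Q (p j) ω) else 0

lemma incs_succ (K : ℕ → Ω → ℝ) (V Q : ℝ → Ω → ℝ) (p : ℕ → ℝ) (N : ℕ) (ω : Ω) :
    incs K V Q p (N + 1) ω = Function.update (incs K V Q p N ω) N
      (K N ω * (V (p (N + 1)) ω - V (p N) ω), Q (p (N + 1)) ω - Q (p N) ω) := by
  ext1 j
  by_cases hj : j = N
  · subst hj; simp [incs]
  · rw [Function.update_of_ne hj]
    unfold incs
    have : j < N + 1 ↔ j < N := by omega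
    simp only [this]

lemma PB.incs_meas (h : PB μ G V Q) {p : ℕ → ℝ} (hp : Monotone p) (hp0 : 0 ≤ p 0) {K : ℕ → Ω → ℝ}
    (hK : ∀ j, Measurable[G (p j)] (K j)) (N : ℕ) :
    Measurable[G (p N)] (incs K V Q p N) := by
  have hp0' : ∀ j, 0 ≤ p j := fun j => hp0.trans (hp (Nat.zero_le _))
  refine (@measurable_pi_iff Ω ℕ (fun _ => ℝ × ℝ) (G (p N)) _ _).2 fun j => ?_
  unfold incs
  by_cases hj : j < N
  · simp only [hj, if_true]
    have l1 : G (p (j + 1)) ≤ G (p N) := h.mono (hp hj)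
    have l2 : G (p j) ≤ G (p N) := h.mono (hp hj.le)
    exact ((meas_of_le (hK j) l2).mul ((meas_of_le (h.adV _ (hp0' _)) l1).sub
      (meas_of_le (h.adV _ (hp0' _)) l2))).prodMk ((meas_of_le (h.adQ _ (hp0' _)) l1).sub
      (meas_of_le (h.adQ _ (hp0' _)) l2))
  · simp only [hj, if_false]; exact measurable_const

lemma PB.incs_law (h : PB μ G V Q) {p : ℕ → ℝ} (hp : Monotone p) (hp0 : 0 ≤ p 0) {K : ℕ → Ω → ℝ}
    (hK : ∀ j, Measurable[G (p j)] (K j)) (hK1 : ∀ j ω, K j ω = 1 ∨ K j ω = -1)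
    {A : Ω → E} (hA : Measurable[G (p 0)] A) (N : ℕ) :
    IdentDistrib (fun ω => (A ω, incs K V Q p N ω)) (fun ω => (A ω, incs (fun _ _ => 1) V Q p N ω)) μ μ := by
  have mK : ∀ N, Measurable[G (p N)] (fun ω => (A ω, incs K V Q p N ω)) := fun N =>
    (meas_of_le hA (h.mono (hp (Nat.zero_le N)))).prodMk (h.incs_meas hp hp0 hK N)
  have m1 : ∀ N, Measurable[G (p N)] (fun ω => (A ω, incs (fun _ _ => 1) V Q p N ω)) := fun N =>
    (meas_of_le hA (h.mono (hp (Nat.zero_le N)))).prodMk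
      (h.incs_meas hp hp0 (fun _ => measurable_const) N)
  have hp0' : ∀ j, 0 ≤ p j := fun j => hp0.trans (hp (Nat.zero_le _))
  induction N with
  | zero =>
    have : (fun ω => (A ω, incs K V Q p 0 ω)) = (fun ω => (A ω, incs (fun _ _ => 1) V Q p 0 ω)) := by
      ext ω <;> simp [incs]
    rw [this]
    exact IdentDistrib.refl (meas_of_le (m1 0) (h.le _)).aemeasurable
  | succ N ih =>
    have hle : p N ≤ p (N + 1) := hp (Nat.le_succ N)
    have e1 := h.signed_law (hp0' N) hle (mK N) (hK N) (hK1 N)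
    have e2 := h.signed_law (hp0' N) hle (m1 N) (K := fun _ => 1) measurable_const (fun _ => Or.inl rfl)
    have hb : IdentDistrib (fun ω => ((A ω, incs K V Q p N ω),
        (K N ω * (V (p (N + 1)) ω - V (p N) ω), Q (p (N + 1)) ω - Q (p N) ω)))
        (fun ω => ((A ω, incs (fun _ _ => 1) V Q p N ω),
        (1 * (V (p (N + 1)) ω - V (p N) ω), Q (p (N + 1)) ω - Q (p N) ω))) μ μ := by
      refine ⟨?_, ?_, ?_⟩
      · exact ((meas_of_le (mK N) (h.le _)).prodMk ((((meas_of_le (hK N) (h.le _))).mul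
          (h.mD (hp0' N) hle)).prodMk (h.mDQ (hp0' N) hle))).aemeasurable
      · exact ((meas_of_le (m1 N) (h.le _)).prodMk ((measurable_const.mul
          (h.mD (hp0' N) hle)).prodMk (h.mDQ (hp0' N) hle))).aemeasurable
      · rw [e1, e2, ih.map_eq]
    have hφ : Measurable (fun q : (E × (ℕ → ℝ × ℝ)) × (ℝ × ℝ) => (q.1.1, Function.update q.1.2 N q.2)) := by
      refine Measurable.prodMk (by fun_prop) ?_
      refine measurable_pi_iff.2 fun j => ?_
      by_cases hj : j = N
      · subst hj; simp only [Function.update_self]; fun_prop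
      · simp only [Function.update_of_ne hj]; fun_prop
    have := hb.comp hφ
    simp only [incs_succ]
    exact this

lemma V_fsum_tim (h : PB μ G V Q) {t : ℝ} (ht : 0 ≤ t) :
    TendstoInMeasure μ (fun n ω => V (1 / 2 ^ n * (⌊t * 2 ^ n⌋₊ : ℝ)) ω) atTop (V t) ∧
    TendstoInMeasure μ (fun n ω => Q (1 / 2 ^ n * (⌊t * 2 ^ n⌋₊ : ℝ)) ω) atTop (Q t) := by
  constructor
  · refine tendstoInMeasure_of_tendsto_ae (fun n => (h.mV (by positivity)).aestronglyMeasurable)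
      (ae_of_all _ fun ω => ?_)
    exact ((h.contV ω).tendsto t).comp (floor_tendsto ht)
  · refine tendstoInMeasure_of_tendsto_ae (fun n => (h.mQ (by positivity)).aestronglyMeasurable)
      (ae_of_all _ fun ω => ?_)
    exact ((h.contQ ω).tendsto t).comp (floor_tendsto ht)

lemma sum_incr (f : ℕ → ℝ) (N : ℕ) : ∑ i ∈ Finset.range N, (f (i + 1) - f i) = f N - f 0 :=
  Finset.sum_range_sub f N

/-- the law of `(∫ K dV, Q)` is that of `(V, Q)`. -/
lemma PB.law_transfer (h : PB μ G V Q) {K : ℝ → Ω → ℝ} (hK : ∀ s : ℝ, 0 ≤ s → Measurable[G s] (K s))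
    (hK1 : ∀ s ω, K s ω = 1 ∨ K s ω = -1) {U : ℝ → Ω → ℝ} (hU : ∀ t : ℝ, 0 ≤ t → Measurable (U t))
    (hlim : ∀ t : ℝ, 0 ≤ t → TendstoInMeasure μ (fsum K V t) atTop (U t)) :
    IdentDistrib (fun ω (t : NNReal) => (U t ω, Q t ω)) (fun ω (t : NNReal) => (V t ω, Q t ω)) μ μ := by
  refine (identDistrib_iff_forall_finset_identDistrib (X := fun (t : NNReal) ω => (U t ω, Q t ω))
    (Y := fun (t : NNReal) ω => (V t ω, Q t ω)) ?_ ?_).2 fun J => ?_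
  · exact (measurable_pi_iff.2 fun (t : NNReal) => (hU _ (NNReal.coe_nonneg t)).prodMk (h.mQ (NNReal.coe_nonneg t))).aemeasurable
  · exact (measurable_pi_iff.2 fun t => (h.mV t.2).prodMk (h.mQ t.2)).aemeasurable
  refine identDistrib_of_tim
    (f := fun n ω (t : J) => (fsum K V t.1 n ω, Q (1 / 2 ^ n * (⌊(t.1:ℝ) * 2 ^ n⌋₊ : ℝ)) ω))
    (f' := fun n ω (t : J) => (V (1 / 2 ^ n * (⌊(t.1:ℝ) * 2 ^ n⌋₊ : ℝ)) ω,
      Q (1 / 2 ^ n * (⌊(t.1:ℝ) * 2 ^ n⌋₊ : ℝ)) ω))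
    (tim_pi fun t => tim_prod (hlim _ (NNReal.coe_nonneg _)) (V_fsum_tim h (NNReal.coe_nonneg _)).2)
    (tim_pi fun t => tim_prod (V_fsum_tim h (NNReal.coe_nonneg _)).1 (V_fsum_tim h (NNReal.coe_nonneg _)).2)
    (Eventually.of_forall fun n => ?_)
  have hmono : Monotone (fun k : ℕ => (1:ℝ) / 2 ^ n * k) := fun i j hij => by
    have : (i:ℝ) ≤ j := by exact_mod_cast hij
    exact mul_le_mul_of_nonneg_left this (by positivity)
  have key := h.incs_law (p := fun k : ℕ => (1:ℝ) / 2 ^ n * k) hmono (by simp)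
    (K := fun k : ℕ => K (1 / 2 ^ n * k)) (fun j => hK _ (by positivity)) (fun j => hK1 _)
    (A := fun _ => ()) measurable_const (J.sup fun t => ⌊(t:ℝ) * 2 ^ n⌋₊)
  have hφ : Measurable (fun (q : Unit × (ℕ → ℝ × ℝ)) (t : J) =>
      ((∑ i ∈ Finset.range ⌊(t.1:ℝ) * 2 ^ n⌋₊, (q.2 i).1, ∑ i ∈ Finset.range ⌊(t.1:ℝ) * 2 ^ n⌋₊, (q.2 i).2)
        : ℝ × ℝ)) := by
    refine measurable_pi_iff.2 fun t => ?_
    refine Measurable.prodMk ?_ ?_ <;> refine Finset.measurable_fun_sum _ fun i _ => ?_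
    · exact measurable_fst.comp ((measurable_pi_apply i).comp measurable_snd)
    · exact measurable_snd.comp ((measurable_pi_apply i).comp measurable_snd)
  have k2 := key.comp hφ
  have hlt : ∀ t : J, ∀ i ∈ Finset.range ⌊(t.1:ℝ) * 2 ^ n⌋₊, i < J.sup fun t => ⌊(t:ℝ) * 2 ^ n⌋₊ := by
    intro t i hi
    exact (Finset.mem_range.1 hi).trans_le (Finset.le_sup (f := fun t : NNReal => ⌊(t:ℝ) * 2 ^ n⌋₊) t.2)
  convert k2 using 1
  · ext ω t
    · simp only [Function.comp_apply, fsum, gsum]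
      refine Finset.sum_congr rfl fun i hi => ?_
      simp [incs, hlt t i hi]
    · simp only [Function.comp_apply]
      rw [Finset.sum_congr rfl (g := fun i : ℕ => Q (1 / 2 ^ n * ((i + 1 : ℕ) : ℝ)) ω - Q (1 / 2 ^ n * (i : ℝ)) ω)
        (fun i hi => by simp [incs, hlt t i hi]),
        sum_incr (fun i : ℕ => Q (1 / 2 ^ n * (i : ℝ)) ω)]
      simp [h.Q0]
  · ext ω t
    · simp only [Function.comp_apply]
      rw [Finset.sum_congr rfl (g := fun i : ℕ => V (1 / 2 ^ n * ((i + 1 : ℕ) : ℝ)) ω - V (1 / 2 ^ n * (i : ℝ)) ω)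
        (fun i hi => by simp [incs, hlt t i hi]),
        sum_incr (fun i : ℕ => V (1 / 2 ^ n * (i : ℝ)) ω)]
      simp [h.V0]
    · simp only [Function.comp_apply]
      rw [Finset.sum_congr rfl (g := fun i : ℕ => Q (1 / 2 ^ n * ((i + 1 : ℕ) : ℝ)) ω - Q (1 / 2 ^ n * (i : ℝ)) ω)
        (fun i hi => by simp [incs, hlt t i hi]),
        sum_incr (fun i : ℕ => Q (1 / 2 ^ n * (i : ℝ)) ω)]
      simp [h.Q0]

/-- increments of `∫ K dV` after a dyadic time are independent of the past, and Gaussian. -/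
lemma PB.law_indep (h : PB μ G V Q) {K : ℝ → Ω → ℝ} (hK : ∀ s : ℝ, 0 ≤ s → Measurable[G s] (K s))
    (hK1 : ∀ s ω, K s ω = 1 ∨ K s ω = -1) {t : ℝ} {q j : ℕ} (hst : 1 / 2 ^ q * (j:ℝ) ≤ t)
    {Us Ut : Ω → ℝ}
    (hs : TendstoInMeasure μ (fsum K V (1 / 2 ^ q * (j:ℝ))) atTop Us)
    (ht : TendstoInMeasure μ (fsum K V t) atTop Ut)
    {A : Ω → ℝ} (hA : Measurable[G (1 / 2 ^ q * (j:ℝ))] A) :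
    IdentDistrib (fun ω => (A ω, Ut ω - Us ω))
      (fun ω => (A ω, V t ω - V (1 / 2 ^ q * (j:ℝ)) ω)) μ μ := by
  have ht0 : 0 ≤ t := le_trans (by positivity) hst
  refine identDistrib_of_tim (f := fun n ω => (A ω, fsum K V t n ω - fsum K V (1 / 2 ^ q * (j:ℝ)) n ω))
    (f' := fun n ω => (A ω, V (1 / 2 ^ n * (⌊t * 2 ^ n⌋₊ : ℝ)) ω - V (1 / 2 ^ q * (j:ℝ)) ω))
    (tim_prod (tim_const _) (tim_sub ht hs))
    (tim_prod (tim_const _) (tim_sub (V_fsum_tim h ht0).1 (tim_const _))) ?_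
  filter_upwards [eventually_ge_atTop q] with n hn
  set k0 := j * 2 ^ (n - q) with hk0
  have e0 : (1:ℝ) / 2 ^ q * j = 1 / 2 ^ n * k0 := by
    have : (2:ℝ) ^ n = 2 ^ q * 2 ^ (n - q) := by rw [← pow_add]; congr 1; omega
    rw [hk0, this]; push_cast; field_simp
  have e1 : ⌊(1:ℝ) / 2 ^ q * j * 2 ^ n⌋₊ = k0 := by
    rw [e0]
    have : (1:ℝ) / 2 ^ n * k0 * 2 ^ n = k0 := by field_simp
    rw [this, Nat.floor_natCast]
  have hkM : k0 ≤ ⌊t * 2 ^ n⌋₊ := by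
    rw [← e1]; exact Nat.floor_mono (mul_le_mul_of_nonneg_right hst (by positivity))
  have hmono : Monotone (fun k : ℕ => (1:ℝ) / 2 ^ n * ((k0 + k : ℕ) : ℝ)) := fun i j hij => by
    have : ((k0 + i : ℕ):ℝ) ≤ ((k0 + j : ℕ) : ℝ) := by exact_mod_cast Nat.add_le_add_left hij k0
    exact mul_le_mul_of_nonneg_left this (by positivity)
  have key := h.incs_law (p := fun k : ℕ => (1:ℝ) / 2 ^ n * ((k0 + k : ℕ) : ℝ)) hmono (by positivity)
    (K := fun k : ℕ => K (1 / 2 ^ n * ((k0 + k : ℕ) : ℝ))) (fun j => hK _ (by positivity)) (fun j => hK1 _)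
    (A := A) (by rw [e0] at hA; simpa using hA) (⌊t * 2 ^ n⌋₊ - k0)
  have hφ : Measurable (fun (q : ℝ × (ℕ → ℝ × ℝ)) =>
      (q.1, ∑ i ∈ Finset.range (⌊t * 2 ^ n⌋₊ - k0), (q.2 i).1)) := by
    refine Measurable.prodMk measurable_fst ?_
    refine Finset.measurable_fun_sum _ fun i _ => ?_
    exact measurable_fst.comp ((measurable_pi_apply i).comp measurable_snd)
  have k2 := key.comp hφ
  convert k2 using 1
  · ext ω
    · rfl
    · simp only [Function.comp_apply, fsum, gsum]
      rw [e1, ← Finset.sum_Ico_eq_sub _ hkM, Finset.sum_Ico_eq_sum_range]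
      refine Finset.sum_congr rfl fun i hi => ?_
      have : i < ⌊t * 2 ^ n⌋₊ - k0 := Finset.mem_range.1 hi
      simp [incs, this, add_assoc]
  · ext ω
    · rfl
    · simp only [Function.comp_apply]
      rw [Finset.sum_congr rfl (g := fun i : ℕ => V (1 / 2 ^ n * ((k0 + (i + 1) : ℕ) : ℝ)) ω -
          V (1 / 2 ^ n * ((k0 + i : ℕ) : ℝ)) ω)
        (fun i hi => by simp [incs, Finset.mem_range.1 hi]),
        sum_incr (fun i : ℕ => V (1 / 2 ^ n * ((k0 + i : ℕ) : ℝ)) ω), Nat.add_sub_cancel' hkM, e0]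
      simp

end Lawsec

section Eulersec

lemma measurable_psgn : Measurable psgn :=
  Measurable.ite measurableSet_Ioi measurable_const measurable_const

lemma psgn_cases (y : ℝ) : psgn y = 1 ∨ psgn y = -1 := by
  unfold psgn; split_ifs <;> simp

lemma abs_psgn (y : ℝ) : |psgn y| = 1 := by
  rcases psgn_cases y with h | h <;> simp [h]

lemma psgn_mul_self (y : ℝ) : psgn y * psgn y = 1 := by
  rcases psgn_cases y with h | h <;> simp [h]

lemma psgn_continuousAt {y : ℝ} (hy : y ≠ 0) : ContinuousAt psgn y := by
  rcases lt_or_gt_of_ne hy with h | h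
  · have : psgn =ᶠ[nhds y] fun _ => -1 := by
      filter_upwards [Iio_mem_nhds h] with z hz
      have : ¬ (0 < z) := not_lt.2 (le_of_lt hz)
      simp [psgn, this]
    exact continuousAt_const.congr this.symm
  · have : psgn =ᶠ[nhds y] fun _ => 1 := by
      filter_upwards [Ioi_mem_nhds h] with z hz
      have : (0 < z) := hz
      simp [psgn, this]
    exact continuousAt_const.congr this.symm

/-- drift of the difference process -/
def bfun (l y : ℝ) : ℝ := -l * psgn y

lemma measurable_bfun (l : ℝ) : Measurable (bfun l) := measurable_psgn.const_mul _

lemma abs_bfun {l : ℝ} (hl : 0 ≤ l) (y : ℝ) : |bfun l y| = l := by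
  unfold bfun; rw [abs_mul, abs_psgn, abs_neg, abs_of_nonneg hl, mul_one]

lemma bfun_anti {l : ℝ} (hl : 0 ≤ l) (x y : ℝ) : (bfun l x - bfun l y) * (x - y) ≤ 0 := by
  unfold bfun psgn
  split_ifs with h1 h2 h2
  · simp
  · have := not_lt.1 h2; nlinarith
  · have := not_lt.1 h1; nlinarith
  · simp

lemma intble_b {l : ℝ} (hl : 0 ≤ l) {p : ℝ → ℝ} (hp : Measurable p) (a b : ℝ) :
    IntervalIntegrable (fun s => bfun l (p s)) volume a b := by
  refine (intervalIntegrable_const (c := l)).mono_fun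
    (((measurable_bfun l).comp hp).aestronglyMeasurable) (ae_of_all _ fun s => ?_)
  simp only [Real.norm_eq_abs]
  rw [abs_bfun hl, abs_of_nonneg hl]

lemma abs_int_b {l : ℝ} (hl : 0 ≤ l) (p : ℝ → ℝ) (a b : ℝ) :
    |∫ s in a..b, bfun l (p s)| ≤ l * |b - a| := by
  have := intervalIntegral.norm_integral_le_of_norm_le_const (a := a) (b := b) (C := l)
    (f := fun s => bfun l (p s)) (fun s _ => by rw [Real.norm_eq_abs, abs_bfun hl])
  simpa using this

lemma sq_int_le {d : ℝ → ℝ} {c T : ℝ} (hT : 0 ≤ T) (hd : IntervalIntegrable d volume 0 T)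
    (h : ∀ s ∈ Icc 0 T, d s * (∫ r in (0:ℝ)..s, d r) ≤ c) :
    (∫ r in (0:ℝ)..T, d r) ^ 2 ≤ 2 * c * T := by
  set D : ℝ → ℝ := fun s => ∫ r in (0:ℝ)..s, d r with hD
  have hac : AbsolutelyContinuousOnInterval D 0 T :=
    hd.absolutelyContinuousOnInterval_intervalIntegral (c := 0) (by simp)
  have h1 := hac.integral_deriv_mul_eq_sub hac
  have h0 : D 0 = 0 := by simp [hD]
  rw [h0] at h1
  have hcont : ContinuousOn D (uIcc 0 T) := hac.continuousOn
  have hdi := hac.intervalIntegrable_deriv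
  have h2 : ∫ x in (0:ℝ)..T, deriv D x * D x + D x * deriv D x ≤ ∫ x in (0:ℝ)..T, 2 * c := by
    refine intervalIntegral.integral_mono_ae_restrict hT ?_ intervalIntegrable_const ?_
    · exact (hdi.mul_continuousOn hcont).add (hdi.continuousOn_mul hcont)
    · rw [Filter.EventuallyLE, ae_restrict_iff' measurableSet_Icc]
      filter_upwards [hd.ae_hasDerivAt_integral] with x hx hxI
      have hx' := (hx (by rwa [uIcc_of_le hT]) 0 (by simp)).deriv
      have h3 := h x hxI
      have : deriv D x = d x := hx'
      rw [this]
      have h4 : d x * D x ≤ c := h3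
      nlinarith
  rw [intervalIntegral.integral_const, h1] at h2
  simp only [sub_zero, smul_eq_mul, mul_zero] at h2
  have : (∫ r in (0:ℝ)..T, d r) = D T := rfl
  rw [this]; nlinarith

/-- comparison of two approximate solutions -/
lemma comparison {l ε T : ℝ} (hl : 0 ≤ l) {p q P Q w : ℝ → ℝ} (hp : Measurable p) (hq : Measurable q)
    (hP : ∀ t ∈ Icc 0 T, P t = w t + ∫ s in (0:ℝ)..t, bfun l (p s))
    (hQ : ∀ t ∈ Icc 0 T, Q t = w t + ∫ s in (0:ℝ)..t, bfun l (q s))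
    (hPp : ∀ t ∈ Icc 0 T, |P t - p t| ≤ ε) (hQq : ∀ t ∈ Icc 0 T, |Q t - q t| ≤ ε)
    {t : ℝ} (ht : t ∈ Icc 0 T) : (P t - Q t) ^ 2 ≤ 8 * l * ε * t := by
  have key : ∀ s ∈ Icc 0 T, P s - Q s = ∫ r in (0:ℝ)..s, (bfun l (p r) - bfun l (q r)) := by
    intro s hs
    rw [intervalIntegral.integral_sub (intble_b hl hp _ _) (intble_b hl hq _ _), hP s hs, hQ s hs]
    ring
  rw [key t ht]
  have := sq_int_le (d := fun r => bfun l (p r) - bfun l (q r)) (c := 4 * l * ε) ht.1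
    ((intble_b hl hp _ _).sub (intble_b hl hq _ _)) (fun s hs => by
      have hs' : s ∈ Icc 0 T := ⟨hs.1, hs.2.trans ht.2⟩
      rw [← key s hs']
      have h1 := bfun_anti hl (p s) (q s)
      have h2 : |bfun l (p s) - bfun l (q s)| ≤ 2 * l := by
        have := abs_sub (bfun l (p s)) (bfun l (q s))
        rw [abs_bfun hl, abs_bfun hl] at this; linarith
      have h3 : |(P s - p s) - (Q s - q s)| ≤ 2 * ε := by
        have := abs_sub (P s - p s) (Q s - q s)
        linarith [hPp s hs', hQq s hs']
      have h4 : (bfun l (p s) - bfun l (q s)) * ((P s - p s) - (Q s - q s)) ≤ (2 * l) * (2 * ε) := by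
        refine (le_abs_self _).trans ?_
        rw [abs_mul]
        exact mul_le_mul h2 h3 (abs_nonneg _) (by positivity)
      nlinarith)
  nlinarith

/-- Euler scheme -/
def eul (l x : ℝ) (w : ℝ → ℝ) (N : ℕ) : ℕ → ℝ
  | 0 => x
  | k + 1 => eul l x w N k + (w (1 / 2 ^ N * ((k + 1 : ℕ) : ℝ)) - w (1 / 2 ^ N * (k : ℝ)))
      + 1 / 2 ^ N * bfun l (eul l x w N k)

def eulp (l x : ℝ) (w : ℝ → ℝ) (N : ℕ) (t : ℝ) : ℝ := eul l x w N ⌊t * 2 ^ N⌋₊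

def eulP (l x : ℝ) (w : ℝ → ℝ) (N : ℕ) (t : ℝ) : ℝ :=
  (x + w t) + ∫ s in (0:ℝ)..t, bfun l (eulp l x w N s)

variable {l x : ℝ} {w : ℝ → ℝ}

lemma measurable_eulp (N : ℕ) : Measurable (eulp l x w N) := by
  unfold eulp
  exact (measurable_from_top (f := eul l x w N)).comp
    (Nat.measurable_floor.comp (measurable_id.mul_const _))

lemma eul_grid (hl : 0 ≤ l) (hw0 : w 0 = 0) (N k : ℕ) :
    eul l x w N k = eulP l x w N (1 / 2 ^ N * (k : ℝ)) := by
  induction k with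
  | zero => simp [eul, eulP, hw0]
  | succ k ih =>
    have e1 : ∫ s in (1 / 2 ^ N * (k : ℝ))..(1 / 2 ^ N * ((k + 1 : ℕ) : ℝ)), bfun l (eulp l x w N s)
        = 1 / 2 ^ N * bfun l (eul l x w N k) := by
      have hle : (1 / 2 ^ N * (k : ℝ)) ≤ (1 / 2 ^ N * ((k + 1 : ℕ) : ℝ)) := by
        push_cast
        have : (0:ℝ) < 1 / 2 ^ N := by positivity
        nlinarith
      have : ∫ s in (1 / 2 ^ N * (k : ℝ))..(1 / 2 ^ N * ((k + 1 : ℕ) : ℝ)), bfun l (eulp l x w N s)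
          = ∫ s in (1 / 2 ^ N * (k : ℝ))..(1 / 2 ^ N * ((k + 1 : ℕ) : ℝ)), bfun l (eul l x w N k) := by
        rw [intervalIntegral.integral_of_le hle, intervalIntegral.integral_of_le hle,
          ← integral_Ico_eq_integral_Ioc, ← integral_Ico_eq_integral_Ioc]
        refine setIntegral_congr_fun measurableSet_Ico fun s hs => ?_
        have hpos : (0:ℝ) < 2 ^ N := by positivity
        have : ⌊s * 2 ^ N⌋₊ = k := by
          rw [Nat.floor_eq_iff (by
            have : 0 ≤ s := le_trans (by positivity) hs.1
            positivity)]
          have h1 := hs.1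
          have h2 := hs.2
          push_cast at h2
          constructor
          · rw [one_div, inv_mul_le_iff₀ hpos] at h1; linarith
          · rw [one_div, lt_inv_mul_iff₀ hpos] at h2; linarith
        simp only [eulp, this]
      rw [this, intervalIntegral.integral_const, smul_eq_mul]
      push_cast; ring
    have e2 := intervalIntegral.integral_add_adjacent_intervals
      (intble_b hl (measurable_eulp (l := l) (x := x) (w := w) N) 0 (1 / 2 ^ N * (k : ℝ)))
      (intble_b hl (measurable_eulp (l := l) (x := x) (w := w) N) (1 / 2 ^ N * (k : ℝ))
        (1 / 2 ^ N * ((k + 1 : ℕ) : ℝ)))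
    rw [eul]
    unfold eulP at ih ⊢
    rw [← e2, e1]
    linarith

lemma eul_close (hl : 0 ≤ l) (hw0 : w 0 = 0) (N : ℕ) {t : ℝ} (ht : 0 ≤ t) :
    |eulP l x w N t - eulp l x w N t| ≤ |w t - w (1 / 2 ^ N * (⌊t * 2 ^ N⌋₊ : ℝ))| + l * (1 / 2 ^ N) := by
  have e1 : eulp l x w N t = eulP l x w N (1 / 2 ^ N * (⌊t * 2 ^ N⌋₊ : ℝ)) := eul_grid hl hw0 _ _
  rw [e1]
  unfold eulP
  have e2 := intervalIntegral.integral_add_adjacent_intervals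
      (intble_b hl (measurable_eulp (l := l) (x := x) (w := w) N) 0 (1 / 2 ^ N * (⌊t * 2 ^ N⌋₊ : ℝ)))
      (intble_b hl (measurable_eulp (l := l) (x := x) (w := w) N) (1 / 2 ^ N * (⌊t * 2 ^ N⌋₊ : ℝ)) t)
  rw [← e2]
  have h1 := abs_int_b hl (eulp l x w N) (1 / 2 ^ N * (⌊t * 2 ^ N⌋₊ : ℝ)) t
  have h2 : |t - 1 / 2 ^ N * (⌊t * 2 ^ N⌋₊ : ℝ)| ≤ 1 / 2 ^ N := by
    rw [abs_of_nonneg (by linarith [floor_le' ht N])]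
    linarith [lt_floor' t N]
  have h3 := mul_le_mul_of_nonneg_left h2 hl
  calc _ = |(w t - w (1 / 2 ^ N * (⌊t * 2 ^ N⌋₊ : ℝ))) +
        ∫ s in (1 / 2 ^ N * (⌊t * 2 ^ N⌋₊ : ℝ))..t, bfun l (eulp l x w N s)| := by ring_nf
    _ ≤ _ := (abs_add_le _ _).trans (by linarith)

lemma eul_unif (hl : 0 ≤ l) (hw : Continuous w) (hw0 : w 0 = 0) (T : ℝ) {ε : ℝ} (hε : 0 < ε) :
    ∃ N0, ∀ N ≥ N0, ∀ t ∈ Icc 0 T, |eulP l x w N t - eulp l x w N t| ≤ ε := by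
  have huc : UniformContinuousOn w (Icc 0 T) :=
    isCompact_Icc.uniformContinuousOn_of_continuous hw.continuousOn
  rw [Metric.uniformContinuousOn_iff] at huc
  obtain ⟨δ, hδ, hδ'⟩ := huc (ε / 2) (by positivity)
  have h1 : ∀ᶠ N : ℕ in atTop, (1:ℝ) / 2 ^ N < δ := tendsto_dyad.eventually_lt_const hδ
  have h2 : ∀ᶠ N : ℕ in atTop, l * ((1:ℝ) / 2 ^ N) < ε / 2 := by
    have : Tendsto (fun N : ℕ => l * ((1:ℝ) / 2 ^ N)) atTop (nhds 0) := by
      simpa using tendsto_dyad.const_mul l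
    exact this.eventually_lt_const (by positivity)
  obtain ⟨N0, hN0⟩ := eventually_atTop.1 (h1.and h2)
  refine ⟨N0, fun N hN t ht => (eul_close hl hw0 N ht.1).trans ?_⟩
  obtain ⟨h3, h4⟩ := hN0 N hN
  have h5 := hδ' t ht (1 / 2 ^ N * (⌊t * 2 ^ N⌋₊ : ℝ))
    ⟨by positivity, (floor_le' ht.1 N).trans ht.2⟩ (by
      rw [Real.dist_eq, abs_of_nonneg (by linarith [floor_le' ht.1 N])]
      linarith [lt_floor' t N])
  rw [Real.dist_eq] at h5
  linarith

/-- exact solution of the difference equation -/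
def ESol (l x : ℝ) (w Z : ℝ → ℝ) : Prop :=
  ∀ t, 0 ≤ t → Z t = (x + w t) + ∫ s in (0:ℝ)..t, bfun l (Z s)

lemma abs_lt_of_sq_le {a b : ℝ} (hb : 0 < b) (h : a ^ 2 ≤ b ^ 2 / 2) : |a| < b := by
  rw [← sq_lt_sq₀ (abs_nonneg _) hb.le, sq_abs]
  nlinarith [sq_pos_of_pos hb]

lemma choose_eps (hl : 0 ≤ l) {T : ℝ} (hT : 0 ≤ T) {η : ℝ} (hη : 0 < η) :
    ∃ ε, 0 < ε ∧ ε ≤ η ∧ ∀ t ∈ Icc 0 T, 8 * l * ε * t ≤ η ^ 2 / 2 := by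
  have hpos : 0 < 1 + 16 * l * T := by positivity
  refine ⟨min η (η ^ 2 / (1 + 16 * l * T)), lt_min hη (by positivity), min_le_left _ _, fun t ht => ?_⟩
  have h1 : min η (η ^ 2 / (1 + 16 * l * T)) ≤ η ^ 2 / (1 + 16 * l * T) := min_le_right _ _
  have h2 : 8 * l * min η (η ^ 2 / (1 + 16 * l * T)) * t ≤ 8 * l * (η ^ 2 / (1 + 16 * l * T)) * T := by
    have h0 : 0 ≤ η ^ 2 / (1 + 16 * l * T) := by positivity
    have := ht.1
    exact mul_le_mul (mul_le_mul_of_nonneg_left h1 (by positivity)) ht.2 this (by positivity)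
  refine h2.trans ?_
  rw [show 8 * l * (η ^ 2 / (1 + 16 * l * T)) * T = η ^ 2 * (8 * l * T) / (1 + 16 * l * T) by ring,
    div_le_iff₀ hpos]
  nlinarith [sq_pos_of_pos hη]

lemma ESol.eul_tendsto {Z : ℝ → ℝ} (hZ : ESol l x w Z) (hZm : Measurable Z) (hl : 0 ≤ l)
    (hw : Continuous w) (hw0 : w 0 = 0) {t : ℝ} (ht : 0 ≤ t) :
    Tendsto (fun N => eulp l x w N t) atTop (nhds (Z t)) := by
  rw [Metric.tendsto_atTop]
  intro η hη
  obtain ⟨ε, hε, hεη, hε'⟩ := choose_eps hl ht (half_pos hη)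
  obtain ⟨N0, hN0⟩ := eul_unif (x := x) hl hw hw0 t hε
  refine ⟨N0, fun N hN => ?_⟩
  have h1 := comparison hl (w := fun t => x + w t) (measurable_eulp (l := l) (x := x) (w := w) N) hZm
    (P := eulP l x w N) (Q := Z) (T := t) (ε := ε) (fun _ _ => rfl) (fun s hs => hZ s hs.1)
    (hN0 N hN) (fun s _ => by simp [hε.le]) ⟨ht, le_rfl⟩
  have h2 := abs_lt_of_sq_le (half_pos hη) (h1.trans (hε' t ⟨ht, le_rfl⟩))
  have h3 := hN0 N hN t ⟨ht, le_rfl⟩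
  rw [Real.dist_eq]
  rw [abs_sub_comm] at h3
  calc |eulp l x w N t - Z t| ≤ |eulp l x w N t - eulP l x w N t| + |eulP l x w N t - Z t| :=
        abs_sub_le _ _ _
    _ < η := by linarith

lemma ESol.unique {Z Z' : ℝ → ℝ} (hZ : ESol l x w Z) (hZm : Measurable Z) (hZ' : ESol l x w Z')
    (hZm' : Measurable Z') (hl : 0 ≤ l) (hw : Continuous w) (hw0 : w 0 = 0) {t : ℝ} (ht : 0 ≤ t) :
    Z t = Z' t :=
  tendsto_nhds_unique (hZ.eul_tendsto hZm hl hw hw0 ht) (hZ'.eul_tendsto hZm' hl hw hw0 ht)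

lemma eul_lim (hl : 0 ≤ l) (hw : Continuous w) (hw0 : w 0 = 0) {t : ℝ} (ht : 0 ≤ t) :
    ∃ y, Tendsto (fun N => eulp l x w N t) atTop (nhds y) ∧
      Tendsto (fun N => eulP l x w N t) atTop (nhds y) := by
  have hc : CauchySeq (fun N => eulP l x w N t) := by
    rw [Metric.cauchySeq_iff]
    intro η hη
    obtain ⟨ε, hε, hεη, hε'⟩ := choose_eps hl ht hη
    obtain ⟨N0, hN0⟩ := eul_unif (x := x) hl hw hw0 t hε
    refine ⟨N0, fun M hM N hN => ?_⟩
    have h1 := comparison hl (w := fun t => x + w t) (measurable_eulp (l := l) (x := x) (w := w) M)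
      (measurable_eulp (l := l) (x := x) (w := w) N)
      (P := eulP l x w M) (Q := eulP l x w N) (T := t) (ε := ε) (fun _ _ => rfl) (fun _ _ => rfl)
      (hN0 M hM) (hN0 N hN) ⟨ht, le_rfl⟩
    exact abs_lt_of_sq_le hη (h1.trans (hε' t ⟨ht, le_rfl⟩))
  obtain ⟨y, hy⟩ := cauchySeq_tendsto_of_complete hc
  refine ⟨y, ?_, hy⟩
  have : Tendsto (fun N => eulP l x w N t - eulp l x w N t) atTop (nhds 0) := by
    rw [Metric.tendsto_atTop]
    intro η hη
    obtain ⟨N0, hN0⟩ := eul_unif (x := x) hl hw hw0 t (half_pos hη)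
    refine ⟨N0, fun N hN => ?_⟩
    rw [Real.dist_eq, sub_zero]
    linarith [hN0 N hN t ⟨ht, le_rfl⟩]
  simpa using hy.sub this

def eulY (l x : ℝ) (w : ℝ → ℝ) (t : ℝ) : ℝ := limUnder atTop (fun N => eulp l x w N t)

lemma eulY_tendsto (hl : 0 ≤ l) (hw : Continuous w) (hw0 : w 0 = 0) {t : ℝ} (ht : 0 ≤ t) :
    Tendsto (fun N => eulp l x w N t) atTop (nhds (eulY l x w t)) ∧
      Tendsto (fun N => eulP l x w N t) atTop (nhds (eulY l x w t)) := by
  obtain ⟨y, h1, h2⟩ := eul_lim (x := x) hl hw hw0 ht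
  have : eulY l x w t = y := h1.limUnder_eq
  rw [this]; exact ⟨h1, h2⟩

lemma eulY_lip (hl : 0 ≤ l) (hw : Continuous w) (hw0 : w 0 = 0) {s t : ℝ} (hs : 0 ≤ s) (ht : 0 ≤ t) :
    |(eulY l x w t - w t) - (eulY l x w s - w s)| ≤ l * |t - s| := by
  have h1 := (((eulY_tendsto (x := x) hl hw hw0 ht).2.sub_const (w t)).sub
    ((eulY_tendsto (x := x) hl hw hw0 hs).2.sub_const (w s))).abs
  refine le_of_tendsto h1 (Eventually.of_forall fun N => ?_)
  have e2 := intervalIntegral.integral_add_adjacent_intervals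
      (intble_b hl (measurable_eulp (l := l) (x := x) (w := w) N) 0 s)
      (intble_b hl (measurable_eulp (l := l) (x := x) (w := w) N) s t)
  have h2 := abs_int_b hl (eulp l x w N) s t
  unfold eulP
  rw [← e2]
  refine le_of_eq_of_le (congrArg abs ?_) h2
  ring

lemma eulY_zero (hl : 0 ≤ l) (hw : Continuous w) (hw0 : w 0 = 0) : eulY l x w 0 = x := by
  refine tendsto_nhds_unique (eulY_tendsto hl hw hw0 le_rfl).1 ?_
  simp [eulp, eul]

lemma eulY_cont (hl : 0 ≤ l) (hw : Continuous w) (hw0 : w 0 = 0) :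
    Continuous (fun t => eulY l x w (max t 0)) := by
  have : Continuous (fun t => eulY l x w (max t 0) - w (max t 0)) := by
    refine (LipschitzWith.of_dist_le_mul (K := l.toNNReal) fun s t => ?_).continuous
    rw [Real.dist_eq, Real.dist_eq, Real.coe_toNNReal _ hl]
    refine (eulY_lip hl hw hw0 (le_max_right _ _) (le_max_right _ _)).trans ?_
    exact mul_le_mul_of_nonneg_left (abs_max_sub_max_le_abs _ _ _) hl
  have h2 := this.add (hw.comp (continuous_id.max (continuous_const (y := (0:ℝ)))))
  refine h2.congr fun t => ?_
  simp

lemma eulY_sol (hl : 0 ≤ l) (hw : Continuous w) (hw0 : w 0 = 0)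
    (hz : ∀ᵐ s, 0 < s → eulY l x w s ≠ 0) : ESol l x w (eulY l x w) := by
  intro t ht
  refine tendsto_nhds_unique (eulY_tendsto hl hw hw0 ht).2 ?_
  unfold eulP
  refine tendsto_const_nhds.add ?_
  refine intervalIntegral.tendsto_integral_filter_of_dominated_convergence (fun _ => l) ?_ ?_ ?_ ?_
  · exact Eventually.of_forall fun N =>
      ((measurable_bfun l).comp (measurable_eulp N)).aestronglyMeasurable
  · exact Eventually.of_forall fun N => ae_of_all _ fun s _ => by rw [Real.norm_eq_abs, abs_bfun hl]
  · exact intervalIntegrable_const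
  · filter_upwards [hz] with s hs hs'
    rw [uIoc_of_le ht] at hs'
    have := (psgn_continuousAt (hs hs'.1)).tendsto.comp (eulY_tendsto hl hw hw0 hs'.1.le).1
    exact this.const_mul _

end Eulersec

section Atomsec
set_option linter.unusedSectionVars false
variable {Ω : Type*} [m : MeasurableSpace Ω] {μ : Measure Ω} {G : ℝ → MeasurableSpace Ω}
  {V Q : ℝ → Ω → ℝ} [IsProbabilityMeasure μ]

lemma gauss_small {v : ℝ} (hv : 0 < v) {c : ℝ} (hc : 0 ≤ c) (a : ℝ) :
    gaussianReal 0 v.toNNReal {x | |a + x| ≤ c} ≤ ENNReal.ofReal (2 * c / √v) := by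
  have hv0 : v.toNNReal ≠ 0 := by simpa using hv
  rw [gaussianReal_apply _ hv0]
  have h1 : ∀ x, gaussianPDF 0 v.toNNReal x ≤ ENNReal.ofReal (1 / √v) := by
    intro x
    rw [gaussianPDF, gaussianPDFReal]
    refine ENNReal.ofReal_le_ofReal ?_
    rw [Real.coe_toNNReal _ hv.le]
    have h2 : Real.exp (-(x - 0) ^ 2 / (2 * v)) ≤ 1 := by
      rw [Real.exp_le_one_iff]
      exact div_nonpos_of_nonpos_of_nonneg (by nlinarith [sq_nonneg (x - 0)]) (by positivity)
    have h3 : √v ≤ √(2 * Real.pi * v) := Real.sqrt_le_sqrt (by nlinarith [Real.pi_gt_three])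
    have h4 : (√(2 * Real.pi * v))⁻¹ ≤ 1 / √v := by
      rw [one_div]; exact inv_anti₀ (Real.sqrt_pos.2 hv) h3
    calc _ ≤ (√(2 * Real.pi * v))⁻¹ * 1 := mul_le_mul_of_nonneg_left h2 (by positivity)
      _ ≤ _ := by simpa using h4
  have h2 : {x | |a + x| ≤ c} = Icc (-a - c) (-a + c) := by
    ext x; simp only [mem_ofPred_eq, mem_Icc, abs_le]
    constructor <;> rintro ⟨h, h'⟩ <;> constructor <;> linarith
  calc _ ≤ ∫⁻ x in {x | |a + x| ≤ c}, ENNReal.ofReal (1 / √v) := lintegral_mono fun x => h1 x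
    _ = ENNReal.ofReal (1 / √v) * ENNReal.ofReal (2 * c) := by
        rw [setLIntegral_const, h2, Real.volume_Icc]; congr 2; ring
    _ = _ := by
        rw [← ENNReal.ofReal_mul (by positivity)]; congr 1; ring

lemma anti_conc {A N : Ω → ℝ} (hA : Measurable A) (hN : Measurable N) (hi : IndepFun A N μ) {v : ℝ}
    (hv : 0 < v) (hl : μ.map N = gaussianReal 0 v.toNNReal) {c : ℝ} (hc : 0 ≤ c) :
    μ {ω | |A ω + N ω| ≤ c} ≤ ENNReal.ofReal (2 * c / √v) := by
  have h1 := (indepFun_iff_map_prod_eq_prod_map_map hA.aemeasurable hN.aemeasurable).1 hi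
  have hS : MeasurableSet {p : ℝ × ℝ | |p.1 + p.2| ≤ c} :=
    measurableSet_le (by fun_prop) measurable_const
  have h2 : μ {ω | |A ω + N ω| ≤ c} = (μ.map (fun ω => (A ω, N ω))) {p : ℝ × ℝ | |p.1 + p.2| ≤ c} := by
    rw [Measure.map_apply (hA.prodMk hN) hS]; rfl
  have : IsProbabilityMeasure (μ.map A) := Measure.isProbabilityMeasure_map hA.aemeasurable
  rw [h2, h1, hl, Measure.prod_apply hS]
  calc _ ≤ ∫⁻ x, ENNReal.ofReal (2 * c / √v) ∂(μ.map A) :=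
        lintegral_mono fun x => gauss_small hv hc x
    _ = _ := by simp

lemma PB.gsum_law (h : PB μ G V Q) {K : ℝ → Ω → ℝ} (hK : ∀ s : ℝ, 0 ≤ s → Measurable[G s] (K s))
    (hK1 : ∀ s ω, K s ω = 1 ∨ K s ω = -1) {δ : ℝ} (hδ : 0 ≤ δ) {k0 M : ℕ} (hkM : k0 ≤ M)
    {A : Ω → ℝ} (hA : Measurable[G (δ * k0)] A) :
    IdentDistrib (fun ω => (A ω, gsum K V δ M ω - gsum K V δ k0 ω))
      (fun ω => (A ω, V (δ * M) ω - V (δ * k0) ω)) μ μ := by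
  have hmono : Monotone (fun k : ℕ => δ * ((k0 + k : ℕ) : ℝ)) := fun i j hij => by
    have : ((k0 + i : ℕ):ℝ) ≤ ((k0 + j : ℕ) : ℝ) := by exact_mod_cast Nat.add_le_add_left hij k0
    exact mul_le_mul_of_nonneg_left this (by positivity)
  have key := h.incs_law (p := fun k : ℕ => δ * ((k0 + k : ℕ) : ℝ)) hmono (by positivity)
    (K := fun k : ℕ => K (δ * ((k0 + k : ℕ) : ℝ))) (fun j => hK _ (by positivity)) (fun j => hK1 _)
    (A := A) (by simpa using hA) (M - k0)
  have hφ : Measurable (fun (q : ℝ × (ℕ → ℝ × ℝ)) =>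
      (q.1, ∑ i ∈ Finset.range (M - k0), (q.2 i).1)) := by
    refine Measurable.prodMk measurable_fst ?_
    refine Finset.measurable_fun_sum _ fun i _ => ?_
    exact measurable_fst.comp ((measurable_pi_apply i).comp measurable_snd)
  have k2 := key.comp hφ
  convert k2 using 1
  · ext ω
    · rfl
    · simp only [Function.comp_apply, gsum]
      rw [← Finset.sum_Ico_eq_sub _ hkM, Finset.sum_Ico_eq_sum_range]
      refine Finset.sum_congr rfl fun i hi => ?_
      have : i < M - k0 := Finset.mem_range.1 hi
      simp [incs, this, add_assoc]
  · ext ω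
    · rfl
    · simp only [Function.comp_apply]
      rw [Finset.sum_congr rfl (g := fun i : ℕ => V (δ * ((k0 + (i + 1) : ℕ) : ℝ)) ω -
          V (δ * ((k0 + i : ℕ) : ℝ)) ω)
        (fun i hi => by simp [incs, Finset.mem_range.1 hi]),
        sum_incr (fun i : ℕ => V (δ * ((k0 + i : ℕ) : ℝ)) ω), Nat.add_sub_cancel' hkM]
      simp

lemma PB.gsum_anti (h : PB μ G V Q) {K : ℝ → Ω → ℝ} (hK : ∀ s : ℝ, 0 ≤ s → Measurable[G s] (K s))
    (hK1 : ∀ s ω, K s ω = 1 ∨ K s ω = -1) {δ : ℝ} (hδ : 0 < δ) {k0 M : ℕ} (hkM : k0 < M)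
    {B : Ω → ℝ} (hB : Measurable[G (δ * k0)] B) {c : ℝ} (hc : 0 ≤ c) :
    μ {ω | |gsum K V δ M ω + B ω| ≤ c} ≤ ENNReal.ofReal (2 * c / √(δ * M - δ * k0)) := by
  have hA : Measurable[G (δ * k0)] (fun ω => gsum K V δ k0 ω + B ω) :=
    (gsum_meas hK h hδ.le le_rfl).add hB
  have hlt : δ * k0 < δ * M := mul_lt_mul_of_pos_left (by exact_mod_cast hkM) hδ
  have hk : 0 ≤ δ * k0 := by positivity
  have h1 := h.gsum_law hK hK1 hδ.le hkM.le hA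
  have h2 := anti_conc (meas_of_le hA (h.le _)) (h.mD hk hlt.le) (h.indepX hk hlt.le hA)
    (sub_pos.2 hlt) (h.lawV hk hlt.le) hc
  have hS : MeasurableSet {p : ℝ × ℝ | |p.1 + p.2| ≤ c} :=
    measurableSet_le (by fun_prop) measurable_const
  have h3 := h1.measure_mem_eq hS
  calc _ = μ ((fun ω => (gsum K V δ k0 ω + B ω, gsum K V δ M ω - gsum K V δ k0 ω)) ⁻¹'
        {p : ℝ × ℝ | |p.1 + p.2| ≤ c}) := by
        congr 1; ext ω; simp only [mem_ofPred_eq, mem_preimage]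
        rw [show gsum K V δ k0 ω + B ω + (gsum K V δ M ω - gsum K V δ k0 ω) = gsum K V δ M ω + B ω by ring]
    _ ≤ _ := by rw [h3]; exact h2

/-- no atom at the origin -/
lemma PB.no_atom (h : PB μ G V Q) {K : ℝ → Ω → ℝ} (hK : ∀ s : ℝ, 0 ≤ s → Measurable[G s] (K s))
    (hK1 : ∀ s ω, K s ω = 1 ∨ K s ω = -1) {t : ℝ} (ht : 0 < t) {U : Ω → ℝ}
    (hU : TendstoInMeasure μ (rsum K V t) atTop U) {B : ℝ → Ω → ℝ} {l : ℝ} (hl : 0 ≤ l)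
    (hB : ∀ s, 0 ≤ s → s ≤ t → Measurable[G s] (B s))
    (hB' : ∀ s, 0 ≤ s → s ≤ t → ∀ᵐ ω ∂μ, |B t ω - B s ω| ≤ l * (t - s)) :
    μ {ω | U ω + B t ω = 0} = 0 := by
  have main : ∀ p : ℕ, μ {ω | U ω + B t ω = 0} ≤
      ENNReal.ofReal (2 * ((l + 1) * (t * (1 / 2 ^ p))) / √(t * (1 / 2 ^ p))) := by
    intro p
    set v := t * (1 / 2 ^ p) with hv
    have hv0 : 0 < v := by positivity
    have hvt : v ≤ t := by
      have : (1:ℝ) / 2 ^ p ≤ 1 := by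
        rw [div_le_one (by positivity)]; exact one_le_pow₀ (by norm_num)
      nlinarith
    have hlim : Tendsto (fun n => ENNReal.ofReal (2 * ((l + 1) * v) / √v) +
        μ {ω | ENNReal.ofReal v ≤ edist (rsum K V t n ω) (U ω)}) atTop
        (nhds (ENNReal.ofReal (2 * ((l + 1) * v) / √v) + 0)) :=
      tendsto_const_nhds.add (hU _ (by simpa using hv0))
    rw [add_zero] at hlim
    refine ge_of_tendsto hlim ?_
    filter_upwards [eventually_ge_atTop p] with n hn
    have hpow : 2 ^ (n - p) ≤ 2 ^ n := Nat.pow_le_pow_right (by norm_num) (by omega)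
    set k0 := 2 ^ n - 2 ^ (n - p) with hk0
    have hk0M : k0 < 2 ^ n := by
      have : 0 < 2 ^ (n - p) := by positivity
      omega
    have ek : t / 2 ^ n * (k0 : ℝ) = t - v := by
      rw [hk0, Nat.cast_sub hpow]
      have : (2:ℝ) ^ n = 2 ^ p * 2 ^ (n - p) := by rw [← pow_add]; congr 1; omega
      push_cast
      rw [hv, this]; field_simp
    have hBm := hB (t - v) (by linarith) (by linarith)
    have h1 := h.gsum_anti hK hK1 (δ := t / 2 ^ n) (by positivity) hk0M (B := B (t - v))
      (by rw [ek]; exact hBm) (c := (l + 1) * v) (by positivity)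
    have e2 : t / 2 ^ n * ((2 ^ n : ℕ) : ℝ) - t / 2 ^ n * k0 = v := by
      rw [ek]; push_cast; field_simp; ring
    rw [e2, ← rsum_eq_gsum] at h1
    refine le_trans ?_ (add_le_add_left h1 _)
    refine le_trans ?_ (measure_union_le _ _)
    refine measure_mono_ae ?_
    filter_upwards [hB' (t - v) (by linarith) (by linarith)] with ω hω hz
    have hz' : U ω + B t ω = 0 := hz
    by_cases hc : ENNReal.ofReal v ≤ edist (rsum K V t n ω) (U ω)
    · exact Or.inr hc
    · left
      show |rsum K V t n ω + B (t - v) ω| ≤ (l + 1) * v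
      rw [edist_dist, not_le, ENNReal.ofReal_lt_ofReal_iff hv0, Real.dist_eq] at hc
      have h3 : rsum K V t n ω + B (t - v) ω = (rsum K V t n ω - U ω) - (B t ω - B (t - v) ω) := by
        linarith
      rw [h3]
      refine (abs_sub _ _).trans ?_
      have : l * (t - (t - v)) = l * v := by ring
      linarith
  have hlim : Tendsto (fun p : ℕ => ENNReal.ofReal (2 * ((l + 1) * (t * (1 / 2 ^ p))) / √(t * (1 / 2 ^ p))))
      atTop (nhds 0) := by
    have h1 : ∀ p : ℕ, 2 * ((l + 1) * (t * (1 / 2 ^ p))) / √(t * (1 / 2 ^ p)) =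
        2 * (l + 1) * √(t * (1 / 2 ^ p)) := fun p => by
      have hv0 : 0 < t * (1 / 2 ^ p) := by positivity
      rw [div_eq_iff (Real.sqrt_pos.2 hv0).ne', mul_assoc (2 * (l + 1)), Real.mul_self_sqrt hv0.le]; ring
    simp_rw [h1]
    have h2 : Tendsto (fun p : ℕ => 2 * (l + 1) * √(t * (1 / 2 ^ p))) atTop (nhds 0) := by
      have := ((Real.continuous_sqrt.tendsto _).comp (tendsto_dyad.const_mul t)).const_mul (2 * (l + 1))
      simpa using this
    simpa using ENNReal.tendsto_ofReal h2
  exact le_antisymm (ge_of_tendsto' hlim main) (by simp)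

/-- joint measurability + Fubini: the zero set is null almost surely. -/
lemma zero_set_null {Y : ℝ → Ω → ℝ} (hc : ∀ ω, Continuous fun t => Y (max t 0) ω)
    (hm : ∀ t : ℝ, 0 ≤ t → Measurable (Y t))
    (h0 : ∀ t, 0 < t → μ {ω | Y t ω = 0} = 0) :
    ∀ᵐ ω ∂μ, ∀ᵐ s : ℝ, 0 < s → Y s ω ≠ 0 := by
  have hjm : Measurable (Function.uncurry (fun (t : ℝ) (ω : Ω) => Y (max t 0) ω)) :=
    measurable_uncurry_of_continuous_of_measurable (u := fun (t : ℝ) (ω : Ω) => Y (max t 0) ω) hc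
      (fun t => hm _ (le_max_right _ _))
  have hS : MeasurableSet {p : ℝ × Ω | 0 < p.1 → Y (max p.1 0) p.2 ≠ 0} := by
    have h1 : MeasurableSet {p : ℝ × Ω | Y (max p.1 0) p.2 = 0} := hjm (measurableSet_singleton 0)
    have h2 : MeasurableSet {p : ℝ × Ω | 0 < p.1} := measurableSet_lt measurable_const measurable_fst
    have : {p : ℝ × Ω | 0 < p.1 → Y (max p.1 0) p.2 ≠ 0} =
        {p : ℝ × Ω | 0 < p.1}ᶜ ∪ {p : ℝ × Ω | Y (max p.1 0) p.2 = 0}ᶜ := by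
      ext p; simp only [mem_ofPred_eq, mem_union, mem_compl_iff]; tauto
    rw [this]; exact h2.compl.union h1.compl
  have h1 : ∀ᵐ s : ℝ, ∀ᵐ ω ∂μ, 0 < s → Y (max s 0) ω ≠ 0 := by
    refine ae_of_all _ fun s => ?_
    by_cases hs : 0 < s
    · rw [max_eq_left hs.le]
      have := h0 s hs
      rw [ae_iff]
      refine measure_mono_null ?_ this
      intro ω hω
      simp only [mem_ofPred_eq] at hω ⊢
      push Not at hω
      exact hω.2
    · exact ae_of_all _ fun ω h => absurd h hs
  rw [Measure.ae_ae_comm hS] at h1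
  filter_upwards [h1] with ω hω
  filter_upwards [hω] with s hs h
  have := hs h
  rwa [max_eq_left h.le] at this

lemma meas_int_b {Ω : Type*} [MeasurableSpace Ω] {Y : ℝ → Ω → ℝ} {l t : ℝ} (ht : 0 ≤ t)
    (hc : ∀ ω, Continuous fun t => Y t ω)
    (hm : ∀ s, 0 ≤ s → s ≤ t → Measurable (Y s)) :
    Measurable (fun ω => ∫ s in (0:ℝ)..t, bfun l (Y s ω)) := by
  have hjm : Measurable (Function.uncurry (fun (s : ℝ) (ω : Ω) => Y (min (max s 0) t) ω)) :=
    measurable_uncurry_of_continuous_of_measurable (u := fun (s : ℝ) (ω : Ω) => Y (min (max s 0) t) ω)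
      (fun ω => (hc ω).comp ((continuous_id.max continuous_const).min continuous_const))
      (fun s => hm _ (le_min (le_max_right _ _) ht) (min_le_right _ _))
  have h2 : Measurable (Function.uncurry (fun (s : ℝ) (ω : Ω) => bfun l (Y (min (max s 0) t) ω))) :=
    (measurable_bfun l).comp hjm
  have h3 : (fun ω => ∫ s in (0:ℝ)..t, bfun l (Y s ω)) =
      fun ω => ∫ s, bfun l (Y (min (max s 0) t) ω) ∂(volume.restrict (Ioc 0 t)) := by
    ext ω
    rw [intervalIntegral.integral_of_le ht]
    refine setIntegral_congr_fun measurableSet_Ioc fun s hs => ?_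
    simp only [max_eq_left hs.1.le, min_eq_left hs.2]
  rw [h3]
  exact (h2.stronglyMeasurable.integral_prod_left).measurable

end Atomsec

section Uniqsec
set_option linter.unusedSectionVars false
variable {Ω : Type*} [m : MeasurableSpace Ω] {μ : Measure Ω}

lemma eq_of_rat {f g : ℝ → ℝ} (hf : Continuous f) (hg : Continuous g)
    (h : ∀ q : ℚ, 0 ≤ q → f q = g q) {t : ℝ} (ht : 0 ≤ t) : f t = g t := by
  have h1 : (fun t => f |t|) = fun t => g |t| := by
    refine Continuous.ext_on (Rat.denseRange_cast (𝕜 := ℝ)) (hf.comp continuous_abs)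
      (hg.comp continuous_abs) ?_
    rintro _ ⟨q, rfl⟩
    have := h |q| (abs_nonneg q)
    simpa using this
  have := congrFun h1 t
  simpa [abs_of_nonneg ht] using this

lemma ae_forall_of_cont {f g : ℝ → Ω → ℝ} (hf : ∀ᵐ ω ∂μ, Continuous fun t => f t ω)
    (hg : ∀ᵐ ω ∂μ, Continuous fun t => g t ω) (h : ∀ t : ℝ, 0 ≤ t → ∀ᵐ ω ∂μ, f t ω = g t ω) :
    ∀ᵐ ω ∂μ, ∀ t : ℝ, 0 ≤ t → f t ω = g t ω := by
  have h1 : ∀ᵐ ω ∂μ, ∀ q : ℚ, 0 ≤ q → f q ω = g q ω := by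
    rw [ae_all_iff]
    intro q
    by_cases hq : 0 ≤ q
    · filter_upwards [h q (by exact_mod_cast hq)] with ω hω _
      exact hω
    · exact ae_of_all _ fun ω h => absurd h hq
  filter_upwards [hf, hg, h1] with ω h1 h2 h3 t ht
  exact eq_of_rat h1 h2 h3 ht

lemma rsum_sub (H H' X : ℝ → Ω → ℝ) (t : ℝ) (n : ℕ) (ω : Ω) :
    rsum H X t n ω - rsum H' X t n ω = rsum (fun s ω => H s ω - H' s ω) X t n ω := by
  unfold rsum
  rw [← Finset.sum_sub_distrib]
  exact Finset.sum_congr rfl fun i _ => by ring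

lemma rsum_const (c : ℝ) (X : ℝ → Ω → ℝ) (t : ℝ) (n : ℕ) (ω : Ω) :
    rsum (fun _ _ => c) X t n ω = c * (X t ω - X 0 ω) := by
  unfold rsum
  rw [← Finset.mul_sum]
  have := Finset.sum_range_sub (fun i : ℕ => X (t * i / 2 ^ n) ω) (2 ^ n)
  push_cast at this
  rw [this]
  have e : t * 2 ^ n / 2 ^ n = t := by field_simp
  rw [e]; simp

lemma rsum_congr {H H' X X' : ℝ → Ω → ℝ} {t : ℝ} (ht : 0 ≤ t) (n : ℕ) {ω : Ω}
    (h : ∀ s, 0 ≤ s → H s ω = H' s ω) (h' : ∀ s, 0 ≤ s → X s ω = X' s ω) :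
    rsum H X t n ω = rsum H' X' t n ω := by
  unfold rsum
  refine Finset.sum_congr rfl fun i _ => ?_
  rw [h _ (by positivity), h' _ (by positivity), h' _ (by positivity)]

lemma ind_bfun (g h x y : ℝ) : (if x ≤ y then g else -h) - (if x ≤ y then -h else g) = bfun (g + h) (x - y) := by
  unfold bfun psgn
  by_cases hxy : x ≤ y
  · have : ¬ (0 < x - y) := by linarith
    simp [hxy, this]
  · have : 0 < x - y := by linarith
    simp only [hxy, this, if_true, if_false]; ring

lemma intble_ite {x y : ℝ → ℝ} (hx : Continuous x) (hy : Continuous y) (g h a b : ℝ) :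
    IntervalIntegrable (fun s => if x s ≤ y s then g else h) volume a b := by
  refine (intervalIntegrable_const (c := |g| + |h|)).mono_fun ?_ (ae_of_all _ fun s => ?_)
  · exact (Measurable.ite (measurableSet_le hx.measurable hy.measurable) measurable_const
      measurable_const).aestronglyMeasurable
  · have h0 : 0 ≤ |g| + |h| := by positivity
    simp only [Real.norm_eq_abs]
    rw [abs_of_nonneg h0]
    split_ifs
    · linarith [abs_nonneg h]
    · linarith [abs_nonneg g]

lemma diff_eq {g h x₁ x₂ : ℝ} {X₁ X₂ I₁ I₂ : ℝ → ℝ} (c1 : Continuous X₁) (c2 : Continuous X₂)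
    (e : ∀ t : ℝ, 0 ≤ t →
      X₁ t = x₁ + (∫ s in (0:ℝ)..t, (if X₁ s ≤ X₂ s then g else -h)) + I₁ t ∧
      X₂ t = x₂ + (∫ s in (0:ℝ)..t, (if X₁ s ≤ X₂ s then -h else g)) + I₂ t) {t : ℝ} (ht : 0 ≤ t) :
    X₁ t - X₂ t = (x₁ - x₂ + (I₁ t - I₂ t)) + ∫ s in (0:ℝ)..t, bfun (g + h) (X₁ s - X₂ s) := by
  obtain ⟨e1, e2⟩ := e t ht
  have := intervalIntegral.integral_sub (intble_ite c1 c2 g (-h) 0 t) (intble_ite c1 c2 (-h) g 0 t)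
  simp only [ind_bfun] at this
  rw [this]; linarith

lemma cont_prim {l : ℝ} (hl : 0 ≤ l) {p : ℝ → ℝ} (hp : Measurable p) :
    Continuous fun t => ∫ s in (0:ℝ)..t, bfun l (p s) :=
  intervalIntegral.continuous_primitive (fun a b => intble_b hl hp a b) 0

lemma sol212_Y {F : ℝ → MeasurableSpace Ω} {g h ρ σ x₁ x₂ : ℝ} (hgh : 0 ≤ g + h)
    {W₁ W₂ X₁ X₂ : ℝ → Ω → ℝ} (hW : IsPlanarBM μ F W₁ W₂)
    (hX : Solves212 μ F g h ρ σ x₁ x₂ W₁ W₂ X₁ X₂) :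
    ∀ᵐ ω ∂μ, ESol (g + h) (x₁ - x₂) (fun t => ρ * W₁ t ω + σ * W₂ t ω) (fun t => X₁ t ω - X₂ t ω) := by
  obtain ⟨-, hc, I₁, I₂, hI1, hI2, he⟩ := hX
  have hI : ∀ t : ℝ, 0 ≤ t → ∀ᵐ ω ∂μ, I₁ t ω - I₂ t ω = ρ * W₁ t ω + σ * W₂ t ω := by
    intro t ht
    have h1 := tim_sub (hI1.2 t ht) (hI2.2 t ht)
    have h2 := tendstoInMeasure_ae_unique h1 (tim_const (l := atTop) (ι := ℕ)
      (fun ω => ρ * (W₁ t ω - W₁ 0 ω) + σ * (W₂ t ω - W₂ 0 ω)) |>.congr_left ?_)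
    · filter_upwards [h2, hW.1.init, hW.2.1.init] with ω h h1 h2
      rw [h, h1, h2]; ring
    · intro n
      refine ae_of_all _ fun ω => ?_
      dsimp only
      rw [← rsum_const, ← rsum_const, add_sub_add_comm, rsum_sub, rsum_sub]
      congr 2
      · ext s ω; split_ifs <;> ring
      · ext s ω; split_ifs <;> ring
  have hW1 := hW.1.cont
  have hW2 := hW.2.1.cont
  have key := ae_forall_of_cont (μ := μ)
    (f := fun t ω => X₁ t ω - X₂ t ω - ∫ s in (0:ℝ)..t, bfun (g + h) (X₁ s ω - X₂ s ω))
    (g := fun t ω => (x₁ - x₂) + (ρ * W₁ t ω + σ * W₂ t ω)) ?_ ?_ ?_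
  · filter_upwards [key] with ω hω t ht
    have := hω t ht
    dsimp only at this ⊢
    linarith
  · filter_upwards [hc] with ω hω
    exact (hω.1.sub hω.2).sub (cont_prim hgh (hω.1.sub hω.2).measurable)
  · filter_upwards [hW1, hW2] with ω h1 h2
    exact continuous_const.add ((h1.const_mul ρ).add (h2.const_mul σ))
  · intro t ht
    filter_upwards [hI t ht, hc, he] with ω h1 h2 h3
    have := diff_eq h2.1 h2.2 h3 ht
    linarith

theorem uniq212 {F : ℝ → MeasurableSpace Ω} {g h ρ σ x₁ x₂ : ℝ} (hgh : 0 ≤ g + h)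
    {W₁ W₂ X₁ X₂ X₁' X₂' : ℝ → Ω → ℝ} (hW : IsPlanarBM μ F W₁ W₂)
    (hX : Solves212 μ F g h ρ σ x₁ x₂ W₁ W₂ X₁ X₂)
    (hX' : Solves212 μ F g h ρ σ x₁ x₂ W₁ W₂ X₁' X₂') :
    ∀ᵐ ω ∂μ, ∀ t : ℝ, 0 ≤ t → X₁ t ω = X₁' t ω ∧ X₂ t ω = X₂' t ω := by
  have hY := sol212_Y hgh hW hX
  have hY' := sol212_Y hgh hW hX'
  obtain ⟨-, hc, I₁, I₂, hI1, hI2, he⟩ := hX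
  obtain ⟨-, hc', I₁', I₂', hI1', hI2', he'⟩ := hX'
  have heq : ∀ᵐ ω ∂μ, ∀ t : ℝ, 0 ≤ t → X₁ t ω - X₂ t ω = X₁' t ω - X₂' t ω := by
    filter_upwards [hY, hY', hc, hc', hW.1.cont, hW.2.1.cont, hW.1.init, hW.2.1.init]
      with ω h1 h2 h3 h4 h5 h6 h7 h8 t ht
    exact h1.unique (h3.1.sub h3.2).measurable h2 (h4.1.sub h4.2).measurable hgh
      ((h5.const_mul ρ).add (h6.const_mul σ)) (by simp [h7, h8]) ht
  have hcond : ∀ᵐ ω ∂μ, ∀ t : ℝ, 0 ≤ t → (X₁ t ω ≤ X₂ t ω ↔ X₁' t ω ≤ X₂' t ω) := by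
    filter_upwards [heq] with ω hω t ht
    have := hω t ht
    constructor <;> intro _ <;> linarith
  have hI : ∀ t : ℝ, 0 ≤ t → ∀ᵐ ω ∂μ, I₁ t ω = I₁' t ω := by
    intro t ht
    refine tendstoInMeasure_ae_unique (hI1.2 t ht) ((hI1'.2 t ht).congr_left fun n => ?_)
    filter_upwards [hcond] with ω hω
    congr 1
    · exact rsum_congr ht n (fun s hs => by simp only [hω s hs]) (fun _ _ => rfl)
    · exact rsum_congr ht n (fun s hs => by simp only [hω s hs]) (fun _ _ => rfl)
  have h1 := ae_forall_of_cont (μ := μ) (f := X₁) (g := X₁') (hc.mono fun ω h => h.1)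
    (hc'.mono fun ω h => h.1) (fun t ht => by
      filter_upwards [hI t ht, he, he', hcond] with ω h1 h2 h3 h4
      rw [(h2 t ht).1, (h3 t ht).1, h1]
      congr 2
      refine intervalIntegral.integral_congr fun s hs => ?_
      rw [uIcc_of_le ht] at hs
      simp only [h4 s hs.1])
  filter_upwards [h1, heq] with ω h1 h2 t ht
  have := h2 t ht
  have := h1 t ht
  exact ⟨this, by linarith⟩

end Uniqsec

section Contsec
set_option linter.unusedSectionVars false
variable {Ω : Type*} [m : MeasurableSpace Ω] {μ : Measure Ω} {G : ℝ → MeasurableSpace Ω} {V Q : ℝ → Ω → ℝ} [IsProbabilityMeasure μ]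

/-- Uniform continuity on bounded sets of nonnegative rationals. -/
def UCQ (f : ℝ → ℝ) : Prop := ∀ T k : ℕ, ∃ j : ℕ, ∀ q r : ℚ,
  (0 ≤ q ∧ 0 ≤ r ∧ q ≤ T ∧ r ≤ T ∧ |(q:ℝ) - r| ≤ 1 / ((j:ℝ) + 1)) → |f q - f r| ≤ 1 / ((k:ℝ) + 1)

def dflo (n : ℕ) (t : ℝ) : ℝ := 1 / 2 ^ n * (⌊t * 2 ^ n⌋₊ : ℝ)

lemma dflo_nonneg (n : ℕ) (t : ℝ) : 0 ≤ dflo n t := by unfold dflo; positivity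

lemma dflo_le {t : ℝ} (ht : 0 ≤ t) (n : ℕ) : dflo n t ≤ t := floor_le' ht n

lemma dflo_tendsto {t : ℝ} (ht : 0 ≤ t) : Tendsto (fun n => dflo n t) atTop (nhds t) := floor_tendsto ht

lemma dflo_rat (n : ℕ) (t : ℝ) : ∃ q : ℚ, (q : ℝ) = dflo n t :=
  ⟨1 / 2 ^ n * (⌊t * 2 ^ n⌋₊ : ℚ), by unfold dflo; push_cast; rfl⟩

lemma ucq_of_cont {f : ℝ → ℝ} (hf : Continuous f) : UCQ f := by
  intro T k
  have huc : UniformContinuousOn f (Icc 0 (T:ℝ)) :=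
    isCompact_Icc.uniformContinuousOn_of_continuous hf.continuousOn
  rw [Metric.uniformContinuousOn_iff] at huc
  obtain ⟨δ, hδ, h⟩ := huc (1 / ((k:ℝ) + 1)) (by positivity)
  obtain ⟨j, hj⟩ := exists_nat_one_div_lt hδ
  refine ⟨j, fun q r ⟨hq, hr, hq', hr', hqr⟩ => ?_⟩
  have h1 := hqr
  exact (h q ⟨by exact_mod_cast hq, by exact_mod_cast hq'⟩ r ⟨by exact_mod_cast hr, by exact_mod_cast hr'⟩
    (by rw [Real.dist_eq]; linarith)).le

lemma ucq_pair {f : ℝ → ℝ} (hf : UCQ f) (T : ℝ) {ε : ℝ} (hε : 0 < ε) : ∃ δ > 0, ∀ s t n p, 0 ≤ s → 0 ≤ t →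
    s ≤ T → t ≤ T → |dflo n s - dflo p t| ≤ δ → |f (dflo n s) - f (dflo p t)| ≤ ε := by
  obtain ⟨k, hk⟩ := exists_nat_one_div_lt hε
  obtain ⟨M, hM⟩ := exists_nat_ge T
  obtain ⟨j, hj⟩ := hf M k
  refine ⟨1 / (j + 1), by positivity, fun s t n p hs ht hsT htT h => ?_⟩
  obtain ⟨q, hq⟩ := dflo_rat n s
  obtain ⟨r, hr⟩ := dflo_rat p t
  have q0 := dflo_nonneg n s
  have r0 := dflo_nonneg p t
  have q1 := (dflo_le hs n).trans (hsT.trans hM)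
  have r1 := (dflo_le ht p).trans (htT.trans hM)
  rw [← hq] at h q0 q1 ⊢
  rw [← hr] at h r0 r1 ⊢
  exact (hj q r ⟨by exact_mod_cast q0, by exact_mod_cast r0, by exact_mod_cast q1, by exact_mod_cast r1,
    h⟩).trans hk.le

lemma ucq_lim {f : ℝ → ℝ} (hf : UCQ f) : ∃ L : ℝ → ℝ, Continuous L ∧ ∀ t, 0 ≤ t →
    Tendsto (fun n => f (dflo n t)) atTop (nhds (L t)) := by
  have h1 : ∀ t, 0 ≤ t → ∃ y, Tendsto (fun n => f (dflo n t)) atTop (nhds y) := by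
    intro t ht
    refine cauchySeq_tendsto_of_complete (Metric.cauchySeq_iff.2 fun ε hε => ?_)
    obtain ⟨δ, hδ, h⟩ := ucq_pair hf t (half_pos hε)
    obtain ⟨N, hN⟩ := Metric.cauchySeq_iff.1 (dflo_tendsto ht).cauchySeq δ hδ
    refine ⟨N, fun a ha b hb => ?_⟩
    have := hN a ha b hb
    rw [Real.dist_eq] at this ⊢
    linarith [h t t a b ht ht le_rfl le_rfl this.le]
  choose! L hL using h1
  refine ⟨fun t => L (max t 0), ?_, fun t ht => by
    have := hL t ht
    dsimp only
    rwa [max_eq_left ht]⟩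
  rw [Metric.continuous_iff]
  intro t ε hε
  obtain ⟨δ, hδ, h⟩ := ucq_pair hf (max t 0 + 1) (half_pos hε)
  refine ⟨min δ 1 , lt_min hδ one_pos, fun s hs => ?_⟩
  rw [Real.dist_eq] at hs ⊢
  have hst : |max s 0 - max t 0| < min δ 1 := (abs_max_sub_max_le_abs _ _ _).trans_lt hs
  have h2 : |L (max s 0) - L (max t 0)| ≤ ε / 2 := by
    refine le_of_tendsto (((hL _ (le_max_right s 0)).sub (hL _ (le_max_right t 0))).abs) ?_
    have h3 := ((dflo_tendsto (le_max_right s 0)).sub (dflo_tendsto (le_max_right t 0))).abs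
    filter_upwards [h3.eventually_lt_const (hst.trans_le (min_le_left _ _))] with n hn
    refine h _ _ n n (le_max_right _ _) (le_max_right _ _) ?_ (by linarith) hn.le
    have := (abs_lt.1 (hst.trans_le (min_le_right _ _))).2
    linarith
  linarith

lemma measurableSet_ucq : MeasurableSet {π : NNReal → ℝ × ℝ | UCQ fun t => (π t.toNNReal).1} := by
  unfold UCQ
  refine measurableSet_setOfPred.2 ?_
  refine Measurable.forall fun T => Measurable.forall fun k => Measurable.exists fun j =>
    Measurable.forall fun q => Measurable.forall fun r => Measurable.imp measurable_const ?_
  refine measurableSet_setOfPred.1 (measurableSet_le ?_ measurable_const)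
  exact ((measurable_fst.comp (measurable_pi_apply _)).sub
    (measurable_fst.comp (measurable_pi_apply _))).abs

lemma cont_version (h : PB μ G V Q) {U : ℝ → Ω → ℝ} 
    (hI : IdentDistrib (fun ω (t : NNReal) => (U t ω, Q t ω)) (fun ω (t : NNReal) => (V t ω, Q t ω)) μ μ) :
    (∀ᵐ ω ∂μ, ∃ L : ℝ → ℝ, Continuous L ∧ ∀ t, 0 ≤ t →
      Tendsto (fun n => U (dflo n t) ω) atTop (nhds (L t))) ∧
    ∀ t, 0 ≤ t → ∀ᵐ ω ∂μ, Tendsto (fun n => U (dflo n t) ω) atTop (nhds (U t ω)) := by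
  constructor
  · have h1 := hI.symm.ae_mem_snd measurableSet_ucq (ae_of_all _ fun ω => by
      rw [mem_ofPred_eq]
      refine ucq_of_cont ?_
      dsimp only
      exact (h.contV ω).comp (NNReal.continuous_coe.comp continuous_real_toNNReal))
    filter_upwards [h1] with ω hω
    obtain ⟨L, hL, h2⟩ := ucq_lim hω
    refine ⟨L, hL, fun t ht => (h2 t ht).congr fun n => ?_⟩
    rw [Real.coe_toNNReal _ (dflo_nonneg n t)]
  · intro t ht
    have h1 := hI.symm.ae_mem_snd (t := {π : NNReal → ℝ × ℝ | Tendsto (fun n =>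
      (π (dflo n t).toNNReal).1) atTop (nhds (π t.toNNReal).1)}) ?_ (ae_of_all _ fun ω => by
        rw [mem_ofPred_eq]
        refine ((h.contV ω).tendsto _).comp ?_
        have : Tendsto (fun n => ((dflo n t).toNNReal : ℝ)) atTop (nhds (t.toNNReal : ℝ)) := 
          ((NNReal.continuous_coe.comp continuous_real_toNNReal).tendsto t).comp (dflo_tendsto ht)
        exact this)
    · filter_upwards [h1] with ω hω
      have := hω
      skip
      rw [Real.coe_toNNReal _ ht] at this
      refine this.congr fun n => ?_
      rw [Real.coe_toNNReal _ (dflo_nonneg n t)]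
    · exact measurableSet_tendsto_fun (fun n => measurable_fst.comp (measurable_pi_apply _))
        (measurable_fst.comp (measurable_pi_apply _))

/-- A version adapted to the raw natural filtration. -/
lemma nat_version {V₁ V₂ U : ℝ → Ω → ℝ} (hU : ∀ t, 0 ≤ t → Measurable[Gf μ V₁ V₂ t] (U t))
    (hc : ∀ᵐ ω ∂μ, ∃ L : ℝ → ℝ, Continuous L ∧ ∀ t, 0 ≤ t →
      Tendsto (fun n => U (dflo n t) ω) atTop (nhds (L t)))
    (hc' : ∀ t, 0 ≤ t → ∀ᵐ ω ∂μ, Tendsto (fun n => U (dflo n t) ω) atTop (nhds (U t ω))) :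
    ∃ U' : ℝ → Ω → ℝ, (∀ t, 0 ≤ t → Measurable[natSA (fun s ω => (V₁ s ω, V₂ s ω)) t] (U' t)) ∧
      (∀ᵐ ω ∂μ, Continuous fun t => U' t ω) ∧ ∀ t, 0 ≤ t → ∀ᵐ ω ∂μ, U' t ω = U t ω := by
  have h1 : ∀ t, ∃ f : Ω → ℝ, 0 ≤ t → (StronglyMeasurable[natSA (fun s ω => (V₁ s ω, V₂ s ω)) t] f ∧
      U t =ᵐ[μ] f) := by
    intro t
    by_cases ht : 0 ≤ t
    · obtain ⟨f, hf, hf'⟩ := aesm_of_Gf (hU t ht)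
      exact ⟨f, fun _ => ⟨hf, hf'⟩⟩
    · exact ⟨0, fun h => absurd h ht⟩
  choose f hf using h1
  have hq : ∀ᵐ ω ∂μ, ∀ q : ℚ, 0 ≤ q → U q ω = f q ω := by
    rw [ae_all_iff]
    intro q
    by_cases hq : 0 ≤ q
    · filter_upwards [(hf q (by exact_mod_cast hq)).2] with ω hω _
      exact hω
    · exact ae_of_all _ fun ω h => absurd h hq
  have hq' : ∀ᵐ ω ∂μ, ∀ n t, U (dflo n t) ω = f (dflo n t) ω := by
    filter_upwards [hq] with ω hω n t
    obtain ⟨q, hq⟩ := dflo_rat n t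
    rw [← hq]
    refine hω q ?_
    have := dflo_nonneg n t
    rw [← hq] at this
    exact_mod_cast this
  refine ⟨fun t ω => limUnder atTop (fun n => f (dflo n (max t 0)) ω), fun t ht => ?_, ?_, fun t ht => ?_⟩
  · refine (@sm_limUnder Ω (natSA (fun s ω => (V₁ s ω, V₂ s ω)) t) _ fun n => ?_).measurable
    refine StronglyMeasurable.mono (hf _ (dflo_nonneg n _)).1 (natSA_mono _ ?_)
    rw [max_eq_left ht]; exact dflo_le ht n
  · filter_upwards [hc, hq'] with ω ⟨L, hL, h2⟩ h3
    have : (fun t => limUnder atTop (fun n => f (dflo n (max t 0)) ω)) = fun t => L (max t 0) := by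
      ext t
      refine Tendsto.limUnder_eq ((h2 _ (le_max_right t 0)).congr fun n => h3 n _)
    rw [this]
    exact hL.comp (continuous_id.max continuous_const)
  · filter_upwards [hc' t ht, hq'] with ω h2 h3
    rw [max_eq_left ht]
    exact Tendsto.limUnder_eq (h2.congr fun n => h3 n _)

end Contsec

section Exsec
set_option linter.unusedSectionVars false
variable {Ω : Type*} [m : MeasurableSpace Ω] {μ : Measure Ω} {G : ℝ → MeasurableSpace Ω} {V Q : ℝ → Ω → ℝ} [IsProbabilityMeasure μ]

lemma PB.eul_meas (h : PB μ G V Q) (l x : ℝ) (N k : ℕ) {t : ℝ} (hk : 1 / 2 ^ N * (k:ℝ) ≤ t) :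
    Measurable[G t] (fun ω => eul l x (fun s => V s ω) N k) := by
  induction k with
  | zero => exact measurable_const
  | succ k ih =>
    have h0 : 1 / 2 ^ N * (k:ℝ) ≤ t := by
      refine le_trans ?_ hk
      push_cast
      exact mul_le_mul_of_nonneg_left (by linarith) (by positivity)
    have h1 := ih h0
    simp only [eul]
    refine Measurable.add (Measurable.add h1 (Measurable.sub ?_ ?_)) (Measurable.const_mul ((measurable_bfun l).comp h1) _)
    · exact meas_of_le (h.adV _ (by positivity)) (h.mono hk)
    · exact meas_of_le (h.adV _ (by positivity)) (h.mono h0)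

lemma PB.eulY_meas (h : PB μ G V Q) (l x : ℝ) {t : ℝ} (ht : 0 ≤ t) :
    Measurable[G t] (fun ω => eulY l x (fun s => V s ω) t) := by
  unfold eulY
  refine (@sm_limUnder Ω (G t) _ fun N => ?_).measurable
  refine Measurable.stronglyMeasurable ?_
  exact h.eul_meas l x N _ (floor_le' ht N)

lemma adm_psgn {Y : ℝ → Ω → ℝ} (hm : ∀ t, 0 ≤ t → Measurable[G t] (Y t))
    (hc : ∀ ω, Continuous fun t => Y t ω) (h0 : ∀ t, 0 < t → μ {ω | Y t ω = 0} = 0) :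
    Adm μ G (fun t ω => psgn (Y t ω)) 1 where
  meas s hs := measurable_psgn.comp (hm s hs)
  bdd s ω := (abs_psgn _).le
  cont s hs := by
    have : ∀ᵐ ω ∂μ, Y s ω ≠ 0 := by
      rw [ae_iff]; simpa using h0 s hs
    filter_upwards [this] with ω hω
    exact (psgn_continuousAt hω).comp (f := fun r => Y r ω) (hc ω).continuousAt

lemma PB.exists_Y (h : PB μ G V Q) {l : ℝ} (hl : 0 ≤ l) (x : ℝ) :
    ∃ Y : ℝ → Ω → ℝ, (∀ ω, Continuous fun t => Y t ω) ∧ (∀ t, 0 ≤ t → Measurable[G t] (Y t)) ∧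
      (∀ᵐ ω ∂μ, ESol l x (fun t => V t ω) (fun t => Y t ω)) ∧ ∀ t, 0 < t → μ {ω | Y t ω = 0} = 0 := by
  set Y : ℝ → Ω → ℝ := fun t ω => eulY l x (fun s => V s ω) (max t 0) with hY
  have hc : ∀ ω, Continuous fun t => Y t ω := fun ω => eulY_cont hl (h.contV ω) (h.V0 ω)
  have hm : ∀ t, 0 ≤ t → Measurable[G t] (Y t) := fun t ht => by
    simp only [hY]
    rw [max_eq_left ht]
    exact h.eulY_meas l x ht
  have h0 : ∀ t, 0 < t → μ {ω | Y t ω = 0} = 0 := by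
    intro t ht
    have := h.no_atom (K := fun _ _ => 1) (fun s _ => measurable_const) (fun _ _ => Or.inl rfl) ht
      (U := V t) (B := fun s ω => Y s ω - V s ω) (l := l) ?_ hl
      (fun s hs _ => (hm s hs).sub (h.adV s hs)) (fun s hs hst => ae_of_all _ fun ω => ?_)
    · simpa using this
    · refine (tim_const (V t)).congr_left fun n => ae_of_all _ fun ω => ?_
      rw [rsum_const, h.V0]; ring
    · have := eulY_lip (x := x) hl (h.contV ω) (h.V0 ω) hs ht.le
      simp only [hY]
      rw [max_eq_left hs, max_eq_left ht.le]
      rwa [abs_of_nonneg (sub_nonneg.2 hst)] at this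
  refine ⟨Y, hc, hm, ?_, h0⟩
  have hz := zero_set_null (μ := μ) (Y := Y) (fun ω => (hc ω).comp (continuous_id.max continuous_const))
    (fun t ht => meas_of_le (hm t ht) (h.le t)) h0
  filter_upwards [hz] with ω hω
  have hz' : ∀ᵐ s, 0 < s → eulY l x (fun s => V s ω) s ≠ 0 := by
    filter_upwards [hω] with s hs h0
    have := hs h0
    simp only [hY] at this
    rwa [max_eq_left h0.le] at this
  have hs := eulY_sol hl (h.contV ω) (h.V0 ω) hz'
  intro t ht
  simp only [hY]
  rw [max_eq_left ht, hs t ht]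
  congr 1
  refine intervalIntegral.integral_congr fun s hs => ?_
  rw [uIcc_of_le ht] at hs
  simp only [max_eq_left hs.1]

lemma PB.exists_U (h : PB μ G V Q) {Y : ℝ → Ω → ℝ} (hm : ∀ t, 0 ≤ t → Measurable[G t] (Y t))
    (hc : ∀ ω, Continuous fun t => Y t ω) (h0 : ∀ t, 0 < t → μ {ω | Y t ω = 0} = 0) :
    ∃ U : ℝ → Ω → ℝ, (∀ t, 0 ≤ t → Measurable[G t] (U t)) ∧
      (∀ t, 0 ≤ t → TendstoInMeasure μ (rsum (fun t ω => psgn (Y t ω)) V t) atTop (U t)) ∧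
      IdentDistrib (fun ω (t : NNReal) => (U t ω, Q t ω)) (fun ω (t : NNReal) => (V t ω, Q t ω)) μ μ := by
  have hA := adm_psgn hm hc h0
  have h1 : ∀ t, ∃ u : Ω → ℝ, 0 ≤ t → (Measurable[G t] u ∧
      TendstoInMeasure μ (fsum (fun t ω => psgn (Y t ω)) V t) atTop u) := by
    intro t
    by_cases ht : 0 ≤ t
    · obtain ⟨f, hf⟩ := hA.exists_lim h ht
      exact ⟨f, fun _ => hf⟩
    · exact ⟨0, fun h => absurd h ht⟩
  choose U hU using h1
  exact ⟨U, fun t ht => (hU t ht).1, fun t ht => hA.tim_rsum h ht (hU t ht).2,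
    h.law_transfer hA.meas (fun s ω => psgn_cases _) (fun t ht => meas_of_le (hU t ht).1 (h.le t))
      (fun t ht => (hU t ht).2)⟩

lemma cont_triv {Y : ℝ → Ω → ℝ} (hc : ∀ ω, Continuous fun t => Y t ω) :
    (∀ᵐ ω ∂μ, ∃ L : ℝ → ℝ, Continuous L ∧ ∀ t, 0 ≤ t →
      Tendsto (fun n => Y (dflo n t) ω) atTop (nhds (L t))) ∧
    ∀ t, 0 ≤ t → ∀ᵐ ω ∂μ, Tendsto (fun n => Y (dflo n t) ω) atTop (nhds (Y t ω)) :=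
  ⟨ae_of_all _ fun ω => ⟨fun t => Y t ω, hc ω, fun t ht => ((hc ω).tendsto t).comp (dflo_tendsto ht)⟩,
    fun t ht => ae_of_all _ fun ω => ((hc ω).tendsto t).comp (dflo_tendsto ht)⟩

lemma ite_g (g h y s : ℝ) : (if (s + y) / 2 ≤ (s - y) / 2 then g else -h) =
    1 / 2 * ((g - h) + bfun (g + h) y) := by
  unfold bfun psgn
  by_cases hy : 0 < y
  · rw [if_neg (by linarith), if_pos hy]; ring
  · rw [if_pos (by linarith), if_neg hy]; ring

lemma ite_h (g h y s : ℝ) : (if (s + y) / 2 ≤ (s - y) / 2 then -h else g) =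
    1 / 2 * ((g - h) - bfun (g + h) y) := by
  unfold bfun psgn
  by_cases hy : 0 < y
  · rw [if_neg (by linarith), if_pos hy]; ring
  · rw [if_pos (by linarith), if_neg hy]; ring

lemma psgn_half (y s : ℝ) : psgn y = if (s + y) / 2 ≤ (s - y) / 2 then -1 else 1 := by
  unfold psgn
  by_cases hy : 0 < y
  · rw [if_pos hy, if_neg (by linarith)]
  · rw [if_neg hy, if_pos (by linarith)]

theorem exist212 {F : ℝ → MeasurableSpace Ω} {g h ρ σ : ℝ} (x₁ x₂ : ℝ) (hgh : 0 ≤ g + h)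
    (hnorm : ρ ^ 2 + σ ^ 2 = 1)
    {W₁ W₂ : ℝ → Ω → ℝ} (hW : IsPlanarBM μ F W₁ W₂) :
    ∃ X₁ X₂ : ℝ → Ω → ℝ, Solves212 μ F g h ρ σ x₁ x₂ W₁ W₂ X₁ X₂ ∧
          ∀ t : ℝ, 0 ≤ t →
            natFilt μ (fun s ω => (X₁ s ω, X₂ s ω)) t ≤
              natFilt μ (fun s ω => (W₁ s ω, W₂ s ω)) t := by
  obtain ⟨U₁, U₂, hUW, hPB⟩ := exists_pb hW
  have pW := hPB ρ σ hnorm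
  have pV := hPB ρ (-σ) (by rw [neg_sq]; exact hnorm)
  obtain ⟨Y, Yc, Ym, Ysol, Y0⟩ := pW.exists_Y hgh (x₁ - x₂)
  obtain ⟨U, Um, Ulim, Ulaw⟩ := pV.exists_U Ym Yc Y0
  have cU := cont_version pV Ulaw
  obtain ⟨U', Um', Uc', Ueq⟩ := nat_version Um cU.1 cU.2
  have cY := cont_triv (μ := μ) Yc
  obtain ⟨Y', Ym', Yc', Yeq⟩ := nat_version Ym cY.1 cY.2
  have YY : ∀ᵐ ω ∂μ, ∀ t, 0 ≤ t → Y' t ω = Y t ω :=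
    ae_forall_of_cont Yc' (ae_of_all _ Yc) Yeq
  -- the solution
  set S : ℝ → Ω → ℝ := fun t ω => x₁ + x₂ + (g - h) * t + U' t ω with hS
  set X₁ : ℝ → Ω → ℝ := fun t ω => (S t ω + Y' t ω) / 2 with hX₁
  set X₂ : ℝ → Ω → ℝ := fun t ω => (S t ω - Y' t ω) / 2 with hX₂
  have Sm : ∀ t, 0 ≤ t → Measurable[natSA (fun s ω => (W₁ s ω, W₂ s ω)) t] (S t) := fun t ht =>
    Measurable.add measurable_const (Um' t ht)
  have Xm₁ : ∀ t, 0 ≤ t → Measurable[natSA (fun s ω => (W₁ s ω, W₂ s ω)) t] (X₁ t) := fun t ht =>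
    Measurable.div_const (Measurable.add (Sm t ht) (Ym' t ht)) 2
  have Xm₂ : ∀ t, 0 ≤ t → Measurable[natSA (fun s ω => (W₁ s ω, W₂ s ω)) t] (X₂ t) := fun t ht =>
    Measurable.div_const (Measurable.sub (Sm t ht) (Ym' t ht)) 2
  have nF : ∀ t, natSA (fun s ω => (W₁ s ω, W₂ s ω)) t ≤ F t := fun t => natSA_pair_le
    (fun r hr hrt => meas_of_le (measurable_of_comap_le (hW.1.adapted r hr)) (hW.1.mono hrt))
    (fun r hr hrt => meas_of_le (measurable_of_comap_le (hW.2.1.adapted r hr)) (hW.1.mono hrt))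
  have Xc : ∀ᵐ ω ∂μ, Continuous (fun t => X₁ t ω) ∧ Continuous (fun t => X₂ t ω) := by
    filter_upwards [Uc', Yc'] with ω h1 h2
    have h3 : Continuous fun t => S t ω := by
      simp only [hS]
      exact (continuous_const.add (continuous_const.mul continuous_id)).add h1
    exact ⟨(h3.add h2).div_const _, (h3.sub h2).div_const _⟩
  have limW : ∀ t, 0 ≤ t → TendstoInMeasure μ (fun n ω => ρ * (W₁ t ω - W₁ 0 ω) + σ * (W₂ t ω - W₂ 0 ω))
      (atTop : Filter ℕ) (fun ω => ρ * W₁ t ω + σ * W₂ t ω) := fun t ht => by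
    refine (tim_const _).congr_left fun n => ?_
    filter_upwards [hW.1.init, hW.2.1.init] with ω h1 h2
    rw [h1, h2]; ring
  have limV : ∀ t, 0 ≤ t → TendstoInMeasure μ (rsum (fun t ω => psgn (Y' t ω))
      (fun t ω => ρ * W₁ t ω + -σ * W₂ t ω) t) (atTop : Filter ℕ) (U' t) := fun t ht => by
    refine ((Ulim t ht).congr_left fun n => ?_).congr_right ?_
    · filter_upwards [YY, hUW] with ω h1 h2
      exact rsum_congr ht n (fun s hs => by rw [h1 s hs]) (fun s hs => by rw [(h2 s).1, (h2 s).2])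
    · filter_upwards [Ueq t ht] with ω hω
      exact hω.symm
  have U0 : ∀ᵐ ω ∂μ, U' 0 ω = 0 := by
    have h1 : ∀ n, rsum (fun t ω => psgn (Y' t ω)) (fun t ω => ρ * W₁ t ω + -σ * W₂ t ω) 0 n = fun _ => 0 := by
      intro n; ext ω
      simp [rsum]
    have h2 := limV 0 le_rfl
    simp only [funext h1] at h2
    exact tendstoInMeasure_ae_unique h2 (tim_const _)
  refine ⟨X₁, X₂, ⟨fun t ht => ?_, Xc, fun t ω => 1 / 2 * (U' t ω + (ρ * W₁ t ω + σ * W₂ t ω)),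
    fun t ω => 1 / 2 * (U' t ω - (ρ * W₁ t ω + σ * W₂ t ω)), ⟨?_, fun t ht => ?_⟩, ⟨?_, fun t ht => ?_⟩, ?_⟩,
    fun t ht => ?_⟩
  · rw [← measurable_iff_comap_le]
    exact Measurable.prodMk (meas_of_le (Xm₁ t ht) (nF t)) (meas_of_le (Xm₂ t ht) (nF t))
  · filter_upwards [U0, hW.1.init, hW.2.1.init] with ω h1 h2 h3
    rw [h1, h2, h3]; ring
  · refine (tim_const_mul (1 / 2) (tim_add (limV t ht) (limW t ht))).congr_left fun n => ae_of_all _ fun ω => ?_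
    dsimp only
    rw [← rsum_const, ← rsum_const]
    unfold rsum
    rw [← Finset.sum_add_distrib, ← Finset.sum_add_distrib, ← Finset.sum_add_distrib, Finset.mul_sum]
    refine Finset.sum_congr rfl fun i _ => ?_
    simp only [hX₁, hX₂]
    rw [psgn_half _ (S (t * i / 2 ^ n) ω)]
    split_ifs <;> ring
  · filter_upwards [U0, hW.1.init, hW.2.1.init] with ω h1 h2 h3
    rw [h1, h2, h3]; ring
  · refine (tim_const_mul (1 / 2) (tim_sub (limV t ht) (limW t ht))).congr_left fun n => ae_of_all _ fun ω => ?_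
    dsimp only
    rw [← rsum_const, ← rsum_const]
    unfold rsum
    rw [← Finset.sum_add_distrib, ← Finset.sum_add_distrib, ← Finset.sum_sub_distrib, Finset.mul_sum]
    refine Finset.sum_congr rfl fun i _ => ?_
    simp only [hX₁, hX₂]
    rw [psgn_half _ (S (t * i / 2 ^ n) ω)]
    split_ifs <;> ring
  · filter_upwards [Ysol, YY, hUW, Yc'] with ω h1 h2 h3 h4 t ht
    have e := h1 t ht
    simp only [(h3 _).1, (h3 _).2] at e
    have e2 : ∫ s in (0:ℝ)..t, bfun (g + h) (Y s ω) = ∫ s in (0:ℝ)..t, bfun (g + h) (Y' s ω) := by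
      refine intervalIntegral.integral_congr fun s hs => ?_
      rw [uIcc_of_le ht] at hs
      simp only [h2 s hs.1]
    rw [e2, ← h2 t ht] at e
    have hi := intble_b hgh h4.measurable 0 t
    simp only [hX₁, hX₂, ite_g, ite_h]
    rw [intervalIntegral.integral_const_mul, intervalIntegral.integral_const_mul,
      intervalIntegral.integral_add intervalIntegrable_const hi,
      intervalIntegral.integral_sub intervalIntegrable_const hi]
    simp only [intervalIntegral.integral_const, sub_zero, smul_eq_mul, hS]
    constructor <;> linarith
  · unfold natFilt augSA
    refine sup_le_sup_right ?_ _
    exact natSA_pair_le (fun r hr hrt => meas_of_le (Xm₁ r hr) (natSA_mono _ hrt))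
      (fun r hr hrt => meas_of_le (Xm₂ r hr) (natSA_mono _ hrt))

end Exsec

section Recsec
set_option linter.unusedSectionVars false
variable {Ω : Type*} [m : MeasurableSpace Ω] {μ : Measure Ω} {G : ℝ → MeasurableSpace Ω} {V Q : ℝ → Ω → ℝ} [IsProbabilityMeasure μ]

lemma fsum_grid (K V : ℝ → Ω → ℝ) (n N k : ℕ) :
    fsum K V (1 / 2 ^ n * (k:ℝ)) (n + N) = gsum K V (1 / 2 ^ (n + N)) (k * 2 ^ N) := by
  unfold fsum
  congr 1
  have : (1:ℝ) / 2 ^ n * (k:ℝ) * 2 ^ (n + N) = ((k * 2 ^ N : ℕ) : ℝ) := by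
    rw [pow_add]; push_cast; field_simp
  rw [this, Nat.floor_natCast]

lemma block_sum (a : ℕ → ℝ) (f : ℕ → ℝ) (K M : ℕ) (hK : 0 < K) :
    ∑ j ∈ Finset.range (M * K), a (j / K) * f j =
      ∑ k ∈ Finset.range M, a k * (∑ j ∈ Finset.range ((k + 1) * K), f j - ∑ j ∈ Finset.range (k * K), f j) := by
  induction M with
  | zero => simp
  | succ M ih =>
    rw [Finset.sum_range_succ, ← ih, Nat.succ_mul, Finset.sum_range_add, Finset.sum_range_add,
      add_sub_cancel_left, Finset.mul_sum]
    congr 1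
    refine Finset.sum_congr rfl fun x hx => ?_
    have hx := Finset.mem_range.1 hx
    have : (M * K + x) / K = M := by
      rw [Nat.mul_comm, Nat.mul_add_div hK, Nat.div_eq_of_lt hx, add_zero]
    rw [this]

lemma recov {H U : ℝ → Ω → ℝ} (hA : Adm μ G H 1) (h1 : ∀ s ω, H s ω * H s ω = 1) (h : PB μ G V Q)
    (hU : ∀ t, 0 ≤ t → TendstoInMeasure μ (fsum H V t) atTop (U t)) {t : ℝ} (ht : 0 ≤ t) :
    TendstoInMeasure μ (fsum H U t) atTop (V t) := by
  set e : ℕ × ℕ → Ω → ℝ := fun p ω => ∑ j ∈ Finset.range (⌊t * 2 ^ p.1⌋₊ * 2 ^ p.2),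
      (H (1 / 2 ^ p.1 * ((j / 2 ^ p.2 : ℕ) : ℝ)) ω * H (1 / 2 ^ (p.1 + p.2) * j) ω - 1) *
        (V (1 / 2 ^ (p.1 + p.2) * (j + 1)) ω - V (1 / 2 ^ (p.1 + p.2) * j) ω) with he
  have hδ : ∀ p : ℕ × ℕ, (0:ℝ) < 1 / 2 ^ (p.1 + p.2) := fun p => by positivity
  have hle : ∀ (p : ℕ × ℕ) (j : ℕ), (1:ℝ) / 2 ^ p.1 * ((j / 2 ^ p.2 : ℕ) : ℝ) ≤ 1 / 2 ^ (p.1 + p.2) * j := by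
    intro p j
    have := Nat.div_mul_le_self j (2 ^ p.2)
    have h3 : ((j / 2 ^ p.2 : ℕ) : ℝ) * 2 ^ p.2 ≤ j := by exact_mod_cast this
    rw [pow_add]
    have : (1:ℝ) / (2 ^ p.1 * 2 ^ p.2) * j - 1 / 2 ^ p.1 * ((j / 2 ^ p.2 : ℕ) : ℝ) =
      1 / (2 ^ p.1 * 2 ^ p.2) * (j - ((j / 2 ^ p.2 : ℕ) : ℝ) * 2 ^ p.2) := by field_simp
    rw [← sub_nonneg, this]
    exact mul_nonneg (by positivity) (by linarith)
  have evan : Van μ atTop (fun p ω => |e p ω|) := by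
    refine van_of_sq (fun p => ?_) (hA.prod h1 h ht)
    have := (stepFam_grid (G := G) (hδ p) (⌊t * 2 ^ p.1⌋₊ * 2 ^ p.2) (c := fun j ω =>
      H (1 / 2 ^ p.1 * ((j / 2 ^ p.2 : ℕ) : ℝ)) ω * H (1 / 2 ^ (p.1 + p.2) * j) ω - 1) (fun i =>
        (((meas_of_le (hA.meas _ (by positivity)) (h.mono (hle p i))).mul
      (hA.meas _ (by positivity))).sub measurable_const)) (C := 2) (fun j ω => by
        have a1 := hA.bdd (1 / 2 ^ p.1 * ((j / 2 ^ p.2 : ℕ) : ℝ)) ω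
        have a2 := hA.bdd (1 / 2 ^ (p.1 + p.2) * j) ω
        refine (abs_sub _ _).trans ?_
        rw [abs_mul, abs_one]
        nlinarith [mul_le_mul a1 a2 (abs_nonneg _) zero_le_one])).memLp h
    exact this.integrable_sq
  -- the approximation of the sums for fixed n
  have happ : ∀ n, TendstoInMeasure μ (fun N ω => e (n, N) ω + V (dflo n t) ω) atTop (fsum H U t n) := by
    intro n
    have h2 : ∀ k : ℕ, TendstoInMeasure μ (fun N => fsum H V (1 / 2 ^ n * (k:ℝ)) (n + N)) atTop
        (U (1 / 2 ^ n * (k:ℝ))) := fun k => (hU _ (by positivity)).comp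
          (tendsto_atTop_mono (fun N => Nat.le_add_left N n) tendsto_id)
    have h3 : TendstoInMeasure μ (fun N ω => ∑ k ∈ Finset.range ⌊t * 2 ^ n⌋₊, H (1 / 2 ^ n * (k:ℝ)) ω *
        (fsum H V (1 / 2 ^ n * ((k+1:ℕ):ℝ)) (n + N) ω - fsum H V (1 / 2 ^ n * (k:ℝ)) (n + N) ω)) atTop
        (fun ω => ∑ k ∈ Finset.range ⌊t * 2 ^ n⌋₊, H (1 / 2 ^ n * (k:ℝ)) ω *
        (U (1 / 2 ^ n * ((k+1:ℕ):ℝ)) ω - U (1 / 2 ^ n * (k:ℝ)) ω)) :=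
      tim_sum _ fun k _ => tim_mul_bdd (hA.bdd _) (tim_sub (h2 (k+1)) (h2 k))
    have e4 : (fun ω => ∑ k ∈ Finset.range ⌊t * 2 ^ n⌋₊, H (1 / 2 ^ n * (k:ℝ)) ω *
        (U (1 / 2 ^ n * ((k+1:ℕ):ℝ)) ω - U (1 / 2 ^ n * (k:ℝ)) ω)) = fsum H U t n := by
      ext ω; unfold fsum gsum; push_cast; rfl
    rw [e4] at h3
    refine h3.congr_left fun N => ae_of_all _ fun ω => ?_
    simp only [fsum_grid]
    unfold gsum
    rw [← block_sum (fun k => H (1 / 2 ^ n * (k:ℝ)) ω) (fun i => H (1 / 2 ^ (n + N) * (i:ℝ)) ω *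
      (V (1 / 2 ^ (n + N) * (i + 1)) ω - V (1 / 2 ^ (n + N) * i) ω)) (2 ^ N) _ (by positivity)]
    have e5 := sum_incr (fun i : ℕ => V (1 / 2 ^ (n + N) * (i:ℝ)) ω) (⌊t * 2 ^ n⌋₊ * 2 ^ N)
    have e6 : (1:ℝ) / 2 ^ (n + N) * ((⌊t * 2 ^ n⌋₊ * 2 ^ N : ℕ) : ℝ) = dflo n t := by
      unfold dflo; rw [pow_add]; push_cast; field_simp
    simp only [e6] at e5
    simp only [Nat.cast_zero, mul_zero, h.V0, sub_zero] at e5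
    rw [← e5, he]
    simp only
    rw [← Finset.sum_add_distrib]
    refine Finset.sum_congr rfl fun j _ => ?_
    push_cast
    ring
  refine tim_of_van (V_fsum_tim h ht).1 (van_of_approx fun ε hε δ hδ' => ?_)
  have ev := (evan (ε / 2) (half_pos hε)).eventually_le_const (ENNReal.half_pos hδ'.ne')
  rw [← prod_atTop_atTop_eq] at ev
  filter_upwards [ev.curry] with n hn
  have h5 := (tim_iff_van.1 (happ n) (ε / 2) (half_pos hε)).eventually_le_const (ENNReal.half_pos hδ'.ne')
  obtain ⟨N, hN1, hN2⟩ := (hn.and h5).exists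
  rw [← ENNReal.add_halves δ]
  refine le_trans (measure_mono (t := {ω | ε / 2 ≤ |e (n, N) ω|} ∪
    {ω | ε / 2 ≤ dist (e (n, N) ω + V (dflo n t) ω) (fsum H U t n ω)}) fun ω hω => ?_)
    ((measure_union_le _ _).trans (add_le_add hN1 hN2))
  by_contra hcon
  rw [mem_union, mem_ofPred_eq, mem_ofPred_eq] at hcon
  push Not at hcon
  rw [mem_ofPred_eq] at hω
  rw [Real.dist_eq] at hcon hω
  have e7 : fsum H U t n ω - V (1 / 2 ^ n * (⌊t * 2 ^ n⌋₊ : ℝ)) ω = e (n, N) ω -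
     (e (n, N) ω + V (dflo n t) ω - fsum H U t n ω) := by unfold dflo; ring
  rw [e7] at hω
  have := (abs_sub (e (n, N) ω) (e (n, N) ω + V (dflo n t) ω - fsum H U t n ω))
  linarith

end Recsec

section Flipsec
set_option linter.unusedSectionVars false

/-- dyadic times at which the sign differs from the initial sign -/
def bad (y : ℝ → ℝ) (n j : ℕ) : Prop := psgn (y (1 / 2 ^ n * (j:ℝ))) ≠ psgn (y 0)

def SS (y : ℝ → ℝ) : Set ℝ := {r | ∃ n j : ℕ, r = 1 / 2 ^ n * (j:ℝ) ∧ bad y n j}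

def ftau (y : ℝ → ℝ) : ℝ := sInf (SS y)

def DD (y : ℝ → ℝ) (t : ℝ) : Prop := ∃ r ∈ SS y, r ≤ t

open Classical in
def flipU (y u : ℝ → ℝ) (t : ℝ) : ℝ := if DD y t then 2 * u (ftau y) - u t else u t

open Classical in
def flipY (y : ℝ → ℝ) (t : ℝ) : ℝ := if DD y t then - y t else y t

variable {y u : ℝ → ℝ}

lemma mem_SS {r : ℝ} : r ∈ SS y ↔ ∃ n j : ℕ, r = 1 / 2 ^ n * (j:ℝ) ∧ bad y n j := Iff.rfl

lemma SS_nonneg {r : ℝ} (hr : r ∈ SS y) : 0 ≤ r := by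
  obtain ⟨n, j, rfl, -⟩ := mem_SS.1 hr
  positivity

lemma SS_bdd : BddBelow (SS y) := ⟨0, fun _ hr => SS_nonneg hr⟩

lemma SS_psgn {r : ℝ} (hr : r ∈ SS y) : psgn (y r) ≠ psgn (y 0) := by
  obtain ⟨n, j, rfl, h⟩ := mem_SS.1 hr
  exact h

lemma tau_nonneg : 0 ≤ ftau y := Real.sInf_nonneg fun _ hr => SS_nonneg hr

lemma DD_tau {t : ℝ} (h : DD y t) : ftau y ≤ t := by
  obtain ⟨r, hr, hrt⟩ := h
  exact (csInf_le SS_bdd hr).trans hrt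

lemma DD_mono {s t : ℝ} (hst : s ≤ t) (h : DD y s) : DD y t := by
  obtain ⟨r, hr, hrt⟩ := h
  exact ⟨r, hr, hrt.trans hst⟩

lemma DD_nonempty {t : ℝ} (h : DD y t) : (SS y).Nonempty := by
  obtain ⟨r, hr, hrt⟩ := h
  exact ⟨r, hr⟩

lemma DD_of_tau_lt {t : ℝ} (hn : (SS y).Nonempty) (h : ftau y < t) : DD y t := by
  obtain ⟨r, hr, hrt⟩ := exists_lt_of_csInf_lt hn h
  exact ⟨r, hr, hrt.le⟩

lemma le_tau {t : ℝ} (hn : (SS y).Nonempty) (h : ¬ DD y t) : t ≤ ftau y := by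
  by_contra hc
  exact h (DD_of_tau_lt hn (not_le.1 hc))

lemma not_DD_zero : ¬ DD y 0 := by
  rintro ⟨r, hr, h0⟩
  have : r = 0 := le_antisymm h0 (SS_nonneg hr)
  subst this
  exact SS_psgn hr rfl

lemma psgn_mul_nonneg (a b : ℝ) (h : psgn a = psgn b) : 0 ≤ psgn b * a := by
  rw [← h]
  unfold psgn
  split_ifs with h0
  · linarith
  · linarith

lemma psgn_mul_nonpos (a b : ℝ) (h : psgn a ≠ psgn b) : psgn b * a ≤ 0 := by
  unfold psgn at h ⊢
  by_cases ha : 0 < a <;> by_cases hb : 0 < b <;> simp only [ha, hb, if_true, if_false] at h ⊢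
  · exact absurd rfl h
  · linarith
  · linarith
  · exact absurd rfl h

lemma y_tau (hy : Continuous y) (hn : (SS y).Nonempty) : y (ftau y) = 0 := by
  set c := psgn (y 0) with hc
  have c0 : c ≠ 0 := by
    rcases psgn_cases (y 0) with h | h <;> rw [hc, h] <;> norm_num
  have h1 : c * y (ftau y) ≤ 0 := by
    obtain ⟨v, -, hv, hv'⟩ := exists_seq_tendsto_sInf hn SS_bdd
    refine le_of_tendsto ((((hy.tendsto _).comp hv).const_mul c)) (Eventually.of_forall fun n => ?_)
    exact psgn_mul_nonpos _ _ (SS_psgn (hv' n))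
  have h2 : ∀ s, 0 ≤ s → s < ftau y → 0 ≤ c * y s := by
    intro s hs hst
    refine ge_of_tendsto (((hy.tendsto s).comp (dflo_tendsto hs)).const_mul c)
      (Eventually.of_forall fun n => ?_)
    refine psgn_mul_nonneg _ _ ?_
    by_contra hcon
    have : dflo n s ∈ SS y := ⟨n, _, rfl, hcon⟩
    exact absurd (csInf_le SS_bdd this) (not_le.2 ((dflo_le hs n).trans_lt hst))
  have h3 : 0 ≤ c * y (ftau y) := by
    rcases tau_nonneg (y := y) |>.eq_or_lt with h0 | h0
    · rw [← h0]; exact psgn_mul_nonneg _ _ rfl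
    · have : Tendsto (fun s => c * y s) (nhdsWithin (ftau y) (Iio (ftau y))) (nhds (c * y (ftau y))) :=
        ((hy.tendsto _).mono_left nhdsWithin_le_nhds).const_mul c
      refine ge_of_tendsto this ?_
      filter_upwards [Ioo_mem_nhdsLT h0] with s hs
      exact h2 s hs.1.le hs.2
  exact (mul_eq_zero.1 (le_antisymm h1 h3)).resolve_left c0

lemma flipU_eq (hn : (SS y).Nonempty) (t : ℝ) : flipU y u t = 2 * u (min t (ftau y)) - u t := by
  unfold flipU
  split_ifs with h
  · rw [min_eq_right (DD_tau h)]
  · rw [min_eq_left (le_tau hn h)]; ring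

lemma flipU_eq' (hn : ¬ (SS y).Nonempty) (t : ℝ) : flipU y u t = u t := by
  unfold flipU
  rw [if_neg fun h => hn (DD_nonempty h)]

lemma flipU_cont (hu : Continuous u) : Continuous (flipU y u) := by
  by_cases hn : (SS y).Nonempty
  · rw [funext (flipU_eq hn)]
    exact ((hu.comp (continuous_id.min continuous_const)).const_mul 2).sub hu
  · rw [funext (flipU_eq' hn)]
    exact hu

lemma flipU_zero : flipU y u 0 = u 0 := by
  unfold flipU
  rw [if_neg not_DD_zero]

lemma flipY_meas (hy : Continuous y) : Measurable (flipY y) := by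
  unfold flipY
  refine Measurable.ite ?_ hy.measurable.neg hy.measurable
  have : OrdConnected {t | DD y t} := ⟨fun s hs t _ r hr => DD_mono hr.1 hs⟩
  exact this.measurableSet

lemma bfun_neg (l : ℝ) {a : ℝ} (ha : a ≠ 0) : bfun l (-a) = - bfun l a := by
  unfold bfun psgn
  rcases ha.lt_or_gt with h | h
  · rw [if_pos (by linarith), if_neg (by linarith)]; ring
  · rw [if_neg (by linarith), if_pos (by linarith)]; ring

lemma psgn_neg {a : ℝ} (ha : a ≠ 0) : psgn (-a) = - psgn a := by
  unfold psgn
  rcases ha.lt_or_gt with h | h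
  · rw [if_pos (by linarith), if_neg (by linarith)]; ring
  · rw [if_neg (by linarith), if_pos (by linarith)]

lemma flip_sol {l x : ℝ} (hl : 0 ≤ l) (hy : Continuous y) (hs : ESol l x u y)
    (hz : ∀ᵐ s, 0 < s → y s ≠ 0) : ESol l x (flipU y u) (flipY y) := by
  intro t ht
  have fm := flipY_meas hy
  by_cases hD : DD y t
  · have hn := DD_nonempty hD
    have h1 : ∫ s in (0:ℝ)..ftau y, bfun l (flipY y s) = ∫ s in (0:ℝ)..ftau y, bfun l (y s) := by
      refine intervalIntegral.integral_congr_ae ?_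
      have : ∀ᵐ s : ℝ, s ≠ ftau y := by simp [ae_iff]
      filter_upwards [this] with s hs1 hs2
      rw [uIoc_of_le tau_nonneg] at hs2
      unfold flipY
      rw [if_neg]
      intro h
      exact absurd (DD_tau h) (not_le.2 (lt_of_le_of_ne hs2.2 hs1))
    have h2 : ∫ s in ftau y..t, bfun l (flipY y s) = - ∫ s in ftau y..t, bfun l (y s) := by
      rw [← intervalIntegral.integral_neg]
      refine intervalIntegral.integral_congr_ae ?_
      filter_upwards [hz] with s hs1 hs2
      rw [uIoc_of_le (DD_tau hD)] at hs2
      unfold flipY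
      rw [if_pos (DD_of_tau_lt hn hs2.1), bfun_neg _ (hs1 (lt_of_le_of_lt tau_nonneg hs2.1))]
    rw [← intervalIntegral.integral_add_adjacent_intervals (intble_b hl fm 0 (ftau y)) (intble_b hl fm (ftau y) t),
      h1, h2]
    have h3 := intervalIntegral.integral_add_adjacent_intervals (intble_b hl hy.measurable 0 (ftau y))
      (intble_b hl hy.measurable (ftau y) t)
    have h4 := hs t ht
    have h5 := hs _ (tau_nonneg (y := y))
    rw [y_tau hy hn] at h5
    rw [← h3] at h4
    unfold flipU flipY
    rw [if_pos hD, if_pos hD, h4]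
    linarith
  · have h1 : ∫ s in (0:ℝ)..t, bfun l (flipY y s) = ∫ s in (0:ℝ)..t, bfun l (y s) := by
      refine intervalIntegral.integral_congr fun s hs => ?_
      rw [uIcc_of_le ht] at hs
      simp only [flipY]
      rw [if_neg fun h => hD (DD_mono hs.2 h)]
    rw [h1]
    unfold flipU flipY
    rw [if_neg hD, if_neg hD]
    exact hs t ht

/-- the recovery sums for the flipped pair are close to those of the original pair -/
lemma flip_sum (hy : Continuous y) (hu : Continuous u)
    (hd : ∀ n j : ℕ, 0 < j → y (1 / 2 ^ n * (j:ℝ)) ≠ 0) {t : ℝ} (ht : 0 ≤ t) :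
    Tendsto (fun n => (∑ i ∈ Finset.range ⌊t * 2 ^ n⌋₊, psgn (flipY y (1 / 2 ^ n * (i:ℝ))) *
      (flipU y u (1 / 2 ^ n * ((i:ℝ) + 1)) - flipU y u (1 / 2 ^ n * (i:ℝ)))) -
      ∑ i ∈ Finset.range ⌊t * 2 ^ n⌋₊, psgn (y (1 / 2 ^ n * (i:ℝ))) *
      (u (1 / 2 ^ n * ((i:ℝ) + 1)) - u (1 / 2 ^ n * (i:ℝ)))) atTop (nhds 0) := by
  classical
  rw [Metric.tendsto_atTop]
  intro ε hε
  have huc : UniformContinuousOn u (Icc 0 t) :=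
    isCompact_Icc.uniformContinuousOn_of_continuous hu.continuousOn
  rw [Metric.uniformContinuousOn_iff] at huc
  obtain ⟨δ, hδ, h⟩ := huc (ε / 4) (by positivity)
  obtain ⟨N0, hN0⟩ := eventually_atTop.1 (tendsto_dyad.eventually_lt_const hδ)
  refine ⟨N0, fun n hn => ?_⟩
  rw [Real.dist_eq, sub_zero, ← Finset.sum_sub_distrib]
  set d : ℕ → ℝ := fun i => if DD y (1 / 2 ^ n * (i:ℝ)) then (1:ℝ) else 0 with hdd
  have hb : ∀ i ∈ Finset.range ⌊t * 2 ^ n⌋₊, |psgn (flipY y (1 / 2 ^ n * (i:ℝ))) *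
      (flipU y u (1 / 2 ^ n * ((i:ℝ) + 1)) - flipU y u (1 / 2 ^ n * (i:ℝ))) - psgn (y (1 / 2 ^ n * (i:ℝ))) *
      (u (1 / 2 ^ n * ((i:ℝ) + 1)) - u (1 / 2 ^ n * (i:ℝ)))| ≤ ε / 2 * (d (i + 1) - d i) := by
    intro i hi
    have hi := Finset.mem_range.1 hi
    have hle : (1:ℝ) / 2 ^ n * (i:ℝ) ≤ 1 / 2 ^ n * ((i:ℝ) + 1) :=
      mul_le_mul_of_nonneg_left (by linarith) (by positivity)
    have hit : (1:ℝ) / 2 ^ n * ((i:ℝ) + 1) ≤ t := by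
      refine le_trans ?_ (floor_le' ht n)
      refine mul_le_mul_of_nonneg_left ?_ (by positivity)
      exact_mod_cast hi
    simp only [hdd]
    push_cast
    by_cases h1 : DD y (1 / 2 ^ n * (i:ℝ))
    · have h2 := DD_mono hle h1
      have hi0 : 0 < i := by
        rcases Nat.eq_zero_or_pos i with rfl | h0
        · simp only [Nat.cast_zero, mul_zero] at h1
          exact absurd h1 not_DD_zero
        · exact h0
      unfold flipU flipY
      rw [if_pos h1, if_pos h1, if_pos h2, if_pos h1, if_pos h2, psgn_neg (hd n i hi0)]
      refine le_of_eq_of_le (abs_eq_zero.2 (by ring)) (by simp)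
    · by_cases h2 : DD y (1 / 2 ^ n * ((i:ℝ) + 1))
      · unfold flipU flipY
        rw [if_neg h1, if_neg h1, if_pos h2, if_neg h1, if_pos h2, ← mul_sub, abs_mul, abs_psgn, one_mul]
        have h3 := le_tau (DD_nonempty h2) h1
        have h4 := DD_tau h2
        have h5 := h (ftau y) ⟨tau_nonneg, h4.trans hit⟩ (1 / 2 ^ n * ((i:ℝ) + 1)) ⟨by positivity, hit⟩ ?_
        · rw [Real.dist_eq] at h5
          have e : 2 * u (ftau y) - u (1 / 2 ^ n * ((i:ℝ) + 1)) - u (1 / 2 ^ n * (i:ℝ)) -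
            (u (1 / 2 ^ n * ((i:ℝ) + 1)) - u (1 / 2 ^ n * (i:ℝ))) = 2 * (u (ftau y) - u (1 / 2 ^ n * ((i:ℝ) + 1))) := by
            ring
          rw [e, abs_mul, abs_two]
          linarith
        · rw [Real.dist_eq, abs_sub_comm, abs_of_nonneg (sub_nonneg.2 h4)]
          have e : (1:ℝ) / 2 ^ n * ((i:ℝ) + 1) = 1 / 2 ^ n * i + 1 / 2 ^ n := by ring
          have := hN0 n hn
          linarith
      · unfold flipU flipY
        rw [if_neg h1, if_neg h1, if_neg h2, if_neg h1, if_neg h2]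
        simp
  refine (Finset.abs_sum_le_sum_abs _ _).trans_lt ((Finset.sum_le_sum hb).trans_lt ?_)
  rw [← Finset.mul_sum, sum_incr]
  have : d ⌊t * 2 ^ n⌋₊ - d 0 ≤ 1 := by
    have a1 : d ⌊t * 2 ^ n⌋₊ ≤ 1 := by simp only [hdd]; split_ifs <;> norm_num
    have a2 : 0 ≤ d 0 := by simp only [hdd]; split_ifs <;> norm_num
    linarith
  nlinarith

open Classical in
/-- indicator that the first bad grid time (level `k`) is `j` -/
def fst1 (y : ℝ → ℝ) (k j : ℕ) : ℝ := if bad y k j ∧ ∀ i < j, ¬ bad y k i then 1 else 0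

lemma fst1_sum_none {k M : ℕ} (h : ∀ j < M, ¬ bad y k j) (f : ℕ → ℝ) :
    ∑ j ∈ Finset.range M, fst1 y k j * f j = 0 := by
  refine Finset.sum_eq_zero fun j hj => ?_
  unfold fst1
  rw [if_neg fun h' => h j (Finset.mem_range.1 hj) h'.1, zero_mul]

lemma fst1_sum_some {k M j : ℕ} (hj : j < M) (hb : bad y k j) (hb' : ∀ i < j, ¬ bad y k i) (f : ℕ → ℝ) :
    ∑ j ∈ Finset.range M, fst1 y k j * f j = f j := by
  rw [Finset.sum_eq_single_of_mem j (Finset.mem_range.2 hj)]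
  · unfold fst1; rw [if_pos ⟨hb, hb'⟩, one_mul]
  · intro i hi hij
    unfold fst1
    rw [if_neg, zero_mul]
    rintro ⟨h1, h2⟩
    rcases lt_or_gt_of_ne hij with h | h
    · exact hb' i h h1
    · exact h2 j h hb

lemma exists_first {k M : ℕ} (h : ¬ ∀ j < M, ¬ bad y k j) :
    ∃ j < M, bad y k j ∧ ∀ i < j, ¬ bad y k i := by
  classical
  push Not at h
  have h' : ∃ j, j < M ∧ bad y k j := h
  refine ⟨Nat.find h', (Nat.find_spec h').1, (Nat.find_spec h').2, fun i hi hb => ?_⟩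
  exact Nat.find_min h' hi ⟨hi.trans (Nat.find_spec h').1, hb⟩

/-- the flip at the level-`k` discretised time -/
def flipUk (y u : ℝ → ℝ) (k : ℕ) (t : ℝ) : ℝ :=
  u t + ∑ j ∈ Finset.range (⌊t * 2 ^ k⌋₊ + 1), fst1 y k j * (2 * (u (1 / 2 ^ k * (j:ℝ)) - u t))

lemma grid_le_iff {t : ℝ} (ht : 0 ≤ t) (k j : ℕ) : j < ⌊t * 2 ^ k⌋₊ + 1 ↔ 1 / 2 ^ k * (j:ℝ) ≤ t := by
  rw [Nat.lt_succ_iff, Nat.le_floor_iff (by positivity), one_div, inv_mul_le_iff₀ (by positivity), mul_comm]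

lemma bad_refine {k k' j : ℕ} (hk : k ≤ k') (hb : bad y k j) :
    bad y k' (j * 2 ^ (k' - k)) ∧ (1:ℝ) / 2 ^ k' * ((j * 2 ^ (k' - k) : ℕ) : ℝ) = 1 / 2 ^ k * (j:ℝ) := by
  obtain ⟨d, rfl⟩ := Nat.exists_eq_add_of_le hk
  have e : (1:ℝ) / 2 ^ (k + d) * ((j * 2 ^ (k + d - k) : ℕ) : ℝ) = 1 / 2 ^ k * (j:ℝ) := by
    rw [Nat.add_sub_cancel_left, pow_add]; push_cast; field_simp
  refine ⟨?_, e⟩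
  unfold bad
  rw [e]; exact hb

lemma flipUk_tendsto (hu : Continuous u) {t : ℝ} (ht : 0 ≤ t) :
    Tendsto (fun k => flipUk y u k t) atTop (nhds (flipU y u t)) := by
  by_cases hD : DD y t
  · rw [Metric.tendsto_atTop]
    intro ε hε
    obtain ⟨δ, hδ, h⟩ := Metric.continuous_iff.1 hu (ftau y) (ε / 2) (by positivity)
    obtain ⟨r, hr, hrt, hrd⟩ : ∃ r ∈ SS y, r ≤ t ∧ r < ftau y + δ := by
      obtain ⟨r0, hr0, hr0t⟩ := id hD
      obtain ⟨r, hr, hrt⟩ := exists_lt_of_csInf_lt (DD_nonempty hD) (lt_add_of_pos_right (ftau y) hδ)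
      rcases le_total r0 r with h | h
      · exact ⟨r0, hr0, hr0t, h.trans_lt hrt⟩
      · exact ⟨r, hr, h.trans hr0t, hrt⟩
    obtain ⟨k0, i0, rfl, hb0⟩ := mem_SS.1 hr
    refine ⟨k0, fun k hk => ?_⟩
    obtain ⟨hb1, e1⟩ := bad_refine hk hb0
    rw [← e1] at hrt hrd
    have hM := (grid_le_iff ht k _).2 hrt
    obtain ⟨j, hjM, hj, hj'⟩ := exists_first (y := y) (k := k) (M := ⌊t * 2 ^ k⌋₊ + 1) fun hcon => hcon _ hM hb1
    unfold flipUk flipU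
    rw [fst1_sum_some hjM hj hj', if_pos hD]
    have hji : j ≤ i0 * 2 ^ (k - k0) := by
      by_contra hcon
      exact hj' _ (not_le.1 hcon) hb1
    have h1 : (1:ℝ) / 2 ^ k * (j:ℝ) ≤ 1 / 2 ^ k * ((i0 * 2 ^ (k - k0) : ℕ):ℝ) :=
      mul_le_mul_of_nonneg_left (by exact_mod_cast hji) (by positivity)
    have h2 : ftau y ≤ 1 / 2 ^ k * (j:ℝ) := csInf_le SS_bdd ⟨k, j, rfl, hj⟩
    have h3 := h (1 / 2 ^ k * (j:ℝ)) (by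
      rw [Real.dist_eq, abs_of_nonneg (sub_nonneg.2 h2)]; linarith)
    rw [Real.dist_eq] at h3 ⊢
    have e : u t + 2 * (u (1 / 2 ^ k * (j:ℝ)) - u t) - (2 * u (ftau y) - u t) =
      2 * (u (1 / 2 ^ k * (j:ℝ)) - u (ftau y)) := by ring
    rw [e, abs_mul, abs_two]
    linarith
  · have : ∀ k, flipUk y u k t = flipU y u t := by
      intro k
      unfold flipUk flipU
      rw [if_neg hD, fst1_sum_none, add_zero]
      intro j hj hb
      exact hD ⟨_, ⟨k, j, rfl, hb⟩, (grid_le_iff ht k j).1 hj⟩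
    simp only [this]
    exact tendsto_const_nhds

end Flipsec

section ProbFlip
set_option linter.unusedSectionVars false
variable {Ω : Type*} [m : MeasurableSpace Ω] {μ : Measure Ω} {G : ℝ → MeasurableSpace Ω}
  {V Q : ℝ → Ω → ℝ} [IsProbabilityMeasure μ]

open Classical in
/-- the sign process flipped after the first bad time on the grid of level `k` -/
def KK (Y : ℝ → Ω → ℝ) (k : ℕ) (s : ℝ) (ω : Ω) : ℝ :=
  if ∃ j : ℕ, 1 / 2 ^ k * (j:ℝ) ≤ s ∧ bad (fun t => Y t ω) k j then -psgn (Y s ω) else psgn (Y s ω)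

lemma KK_fsum (Y V : ℝ → Ω → ℝ) (k N : ℕ) {t : ℝ} (ht : 0 ≤ t) (ω : Ω) :
    fsum (KK Y k) V t (k + N) ω = fsum (fun t ω => psgn (Y t ω)) V t (k + N) ω +
      ∑ j ∈ Finset.range (⌊t * 2 ^ k⌋₊ + 1), fst1 (fun t => Y t ω) k j *
        (2 * (fsum (fun t ω => psgn (Y t ω)) V (1 / 2 ^ k * (j:ℝ)) (k + N) ω -
          fsum (fun t ω => psgn (Y t ω)) V t (k + N) ω)) := by
  have hM := floor_le' ht (k + N)
  have hp : (0:ℝ) < 1 / 2 ^ (k + N) := by positivity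
  have hgrid : ∀ i : ℕ, i < ⌊t * 2 ^ (k + N)⌋₊ → 1 / 2 ^ (k + N) * (i:ℝ) ≤ t := by
    intro i hi
    refine le_trans (mul_le_mul_of_nonneg_left ?_ hp.le) hM
    exact_mod_cast hi.le
  by_cases hb : ∀ j < ⌊t * 2 ^ k⌋₊ + 1, ¬ bad (fun t => Y t ω) k j
  · rw [fst1_sum_none hb, add_zero]
    unfold fsum gsum
    refine Finset.sum_congr rfl fun i hi => ?_
    congr 1
    unfold KK
    rw [if_neg]
    rintro ⟨j, hj, hj'⟩
    exact hb j ((grid_le_iff ht k j).2 (hj.trans (hgrid i (Finset.mem_range.1 hi)))) hj'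
  · obtain ⟨j, hj, hbj, hbj'⟩ := exists_first hb
    rw [fst1_sum_some hj hbj hbj', fsum_grid]
    have hjt := (grid_le_iff ht k j).1 hj
    have hle : j * 2 ^ N ≤ ⌊t * 2 ^ (k + N)⌋₊ := by
      rw [Nat.le_floor_iff (by positivity)]
      push_cast
      rw [pow_add, ← mul_assoc]
      refine mul_le_mul_of_nonneg_right ?_ (by positivity)
      rw [one_div, inv_mul_le_iff₀ (by positivity)] at hjt
      linarith
    obtain ⟨r, hr⟩ := Nat.exists_eq_add_of_le hle
    have e1 : ∀ i : ℕ, 1 / 2 ^ k * (j:ℝ) ≤ 1 / 2 ^ (k + N) * (i:ℝ) ↔ j * 2 ^ N ≤ i := by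
      intro i
      have : (1:ℝ) / 2 ^ k * (j:ℝ) = 1 / 2 ^ (k + N) * ((j * 2 ^ N : ℕ) : ℝ) := by
        rw [pow_add]; push_cast; field_simp
      rw [this, mul_le_mul_iff_right₀ hp]
      exact_mod_cast Iff.rfl
    unfold fsum gsum
    rw [hr, Finset.sum_range_add, Finset.sum_range_add]
    have s1 : ∑ x ∈ Finset.range (j * 2 ^ N), KK Y k (1 / 2 ^ (k + N) * (x:ℝ)) ω *
          (V (1 / 2 ^ (k + N) * ((x:ℝ) + 1)) ω - V (1 / 2 ^ (k + N) * (x:ℝ)) ω) =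
        ∑ x ∈ Finset.range (j * 2 ^ N), psgn (Y (1 / 2 ^ (k + N) * (x:ℝ)) ω) *
          (V (1 / 2 ^ (k + N) * ((x:ℝ) + 1)) ω - V (1 / 2 ^ (k + N) * (x:ℝ)) ω) := by
      refine Finset.sum_congr rfl fun i hi => ?_
      congr 1
      unfold KK
      rw [if_neg]
      rintro ⟨j', hj', hb'⟩
      have : j' < j := by
        by_contra hc
        have h2 : (1:ℝ) / 2 ^ k * (j:ℝ) ≤ 1 / 2 ^ k * (j':ℝ) :=
          mul_le_mul_of_nonneg_left (by exact_mod_cast not_lt.1 hc) (by positivity)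
        exact absurd ((e1 i).1 (h2.trans hj')) (not_le.2 (Finset.mem_range.1 hi))
      exact hbj' j' this hb'
    have s2 : ∑ x ∈ Finset.range r, KK Y k (1 / 2 ^ (k + N) * ((j * 2 ^ N + x : ℕ):ℝ)) ω *
          (V (1 / 2 ^ (k + N) * (((j * 2 ^ N + x : ℕ):ℝ) + 1)) ω - V (1 / 2 ^ (k + N) * ((j * 2 ^ N + x : ℕ):ℝ)) ω) =
        -∑ x ∈ Finset.range r, psgn (Y (1 / 2 ^ (k + N) * ((j * 2 ^ N + x : ℕ):ℝ)) ω) *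
          (V (1 / 2 ^ (k + N) * (((j * 2 ^ N + x : ℕ):ℝ) + 1)) ω - V (1 / 2 ^ (k + N) * ((j * 2 ^ N + x : ℕ):ℝ)) ω) := by
      rw [← Finset.sum_neg_distrib]
      refine Finset.sum_congr rfl fun i hi => ?_
      rw [← neg_mul]
      congr 1
      unfold KK
      rw [if_pos ⟨j, (e1 _).2 (Nat.le_add_right _ _), hbj⟩]
    rw [s1, s2]
    ring

lemma KK_cases (Y : ℝ → Ω → ℝ) (k : ℕ) (s : ℝ) (ω : Ω) : KK Y k s ω = 1 ∨ KK Y k s ω = -1 := by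
  unfold KK
  rcases psgn_cases (Y s ω) with h | h <;> rw [h] <;> split_ifs <;> simp

lemma bad_meas {M : MeasurableSpace Ω} {Y : ℝ → Ω → ℝ} {k j : ℕ} (h0 : Measurable[M] (Y 0))
    (hj : Measurable[M] (Y (1 / 2 ^ k * (j:ℝ)))) :
    MeasurableSet[M] {ω | bad (fun t => Y t ω) k j} := by
  have h1 : Measurable[M] (fun ω => psgn (Y (1 / 2 ^ k * (j:ℝ)) ω)) := measurable_psgn.comp hj
  have h2 : Measurable[M] (fun ω => psgn (Y 0 ω)) := measurable_psgn.comp h0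
  exact (measurableSet_eq_fun h1 h2).compl

lemma KK_meas (h : PB μ G V Q) {Y : ℝ → Ω → ℝ} (hm : ∀ t, 0 ≤ t → Measurable[G t] (Y t)) (k : ℕ)
    {s : ℝ} (hs : 0 ≤ s) : Measurable[G s] (KK Y k s) := by
  unfold KK
  have hp : Measurable[G s] (fun ω => psgn (Y s ω)) := measurable_psgn.comp (hm s hs)
  refine Measurable.ite ?_ hp.neg hp
  have : {ω | ∃ j : ℕ, 1 / 2 ^ k * (j:ℝ) ≤ s ∧ bad (fun t => Y t ω) k j} =
      ⋃ j : ℕ, ⋃ (_ : 1 / 2 ^ k * (j:ℝ) ≤ s), {ω | bad (fun t => Y t ω) k j} := by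
    ext ω; simp
  rw [this]
  refine MeasurableSet.iUnion fun j => MeasurableSet.iUnion fun hj => ?_
  exact bad_meas (meas_of_le (hm 0 le_rfl) (h.mono hs)) (meas_of_le (hm _ (by positivity)) (h.mono hj))

lemma fst1_meas {Y : ℝ → Ω → ℝ} (hm : ∀ t, 0 ≤ t → Measurable (Y t)) (k j : ℕ) :
    Measurable (fun ω => fst1 (fun t => Y t ω) k j) := by
  unfold fst1
  have hb : ∀ i : ℕ, MeasurableSet {ω | bad (fun t => Y t ω) k i} := fun i =>
    bad_meas (hm 0 le_rfl) (hm _ (by positivity))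
  refine Measurable.ite ?_ measurable_const measurable_const
  have : {ω | bad (fun t => Y t ω) k j ∧ ∀ i < j, ¬ bad (fun t => Y t ω) k i} =
      {ω | bad (fun t => Y t ω) k j} ∩ ⋂ i : ℕ, ⋂ (_ : i < j), {ω | bad (fun t => Y t ω) k i}ᶜ := by
    ext ω; simp
  rw [this]
  exact (hb j).inter (MeasurableSet.iInter fun i => MeasurableSet.iInter fun _ => (hb i).compl)

lemma abs_fst1 (y : ℝ → ℝ) (k j : ℕ) : |fst1 y k j| ≤ 1 := by
  unfold fst1; split_ifs <;> simp

lemma KK_tim {Y U : ℝ → Ω → ℝ} 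
    (hU : ∀ t, 0 ≤ t → TendstoInMeasure μ (fsum (fun t ω => psgn (Y t ω)) V t) atTop (U t)) (k : ℕ)
    {t : ℝ} (ht : 0 ≤ t) :
    TendstoInMeasure μ (fsum (KK Y k) V t) atTop (fun ω => flipUk (fun s => Y s ω) (fun s => U s ω) k t) := by
  have key : TendstoInMeasure μ (fun n ω => fsum (fun t ω => psgn (Y t ω)) V t n ω +
      ∑ j ∈ Finset.range (⌊t * 2 ^ k⌋₊ + 1), fst1 (fun t => Y t ω) k j *
        (2 * (fsum (fun t ω => psgn (Y t ω)) V (1 / 2 ^ k * (j:ℝ)) n ω -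
          fsum (fun t ω => psgn (Y t ω)) V t n ω))) atTop
      (fun ω => flipUk (fun s => Y s ω) (fun s => U s ω) k t) := by
    refine tim_add (hU t ht) (tim_sum _ fun j _ => tim_mul_bdd (C := 1) (fun ω => abs_fst1 _ k j) ?_)
    exact tim_const_mul 2 (tim_sub (hU _ (by positivity)) (hU t ht))
  intro ε hε
  refine (key ε hε).congr' ?_
  filter_upwards [eventually_ge_atTop k] with n hn
  obtain ⟨N, rfl⟩ := Nat.exists_eq_add_of_le hn
  simp only [KK_fsum Y V k N ht]

lemma flip_law (h : PB μ G V Q) {Y U : ℝ → Ω → ℝ} (hm : ∀ t, 0 ≤ t → Measurable[G t] (Y t))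
    (hUm : ∀ t, 0 ≤ t → Measurable (U t)) (hUc : ∀ ω, Continuous fun t => U t ω)
    (hU : ∀ t, 0 ≤ t → TendstoInMeasure μ (fsum (fun t ω => psgn (Y t ω)) V t) atTop (U t)) :
    (∀ t, 0 ≤ t → Measurable fun ω => flipU (fun s => Y s ω) (fun s => U s ω) t) ∧
    IdentDistrib (fun ω (t : NNReal) => (flipU (fun s => Y s ω) (fun s => U s ω) t, Q t ω))
      (fun ω (t : NNReal) => (V t ω, Q t ω)) μ μ := by
  have mk : ∀ k : ℕ, ∀ t : ℝ, 0 ≤ t → Measurable fun ω => flipUk (fun s => Y s ω) (fun s => U s ω) k t := by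
    intro k t ht
    unfold flipUk
    refine (hUm t ht).add (Finset.measurable_fun_sum _ fun j _ => ?_)
    exact (fst1_meas (fun t ht => meas_of_le (hm t ht) (h.le t)) k j).mul
      (((hUm _ (by positivity)).sub (hUm t ht)).const_mul 2)
  have mU : ∀ t : ℝ, 0 ≤ t → Measurable fun ω => flipU (fun s => Y s ω) (fun s => U s ω) t := by
    intro t ht
    exact measurable_of_tendsto_metrizable (mk · t ht)
      (tendsto_pi_nhds.2 fun ω => flipUk_tendsto (hUc ω) ht)
  refine ⟨mU, ?_⟩
  refine (identDistrib_iff_forall_finset_identDistrib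
    (X := fun (t : NNReal) ω => (flipU (fun s => Y s ω) (fun s => U s ω) t, Q t ω))
    (Y := fun (t : NNReal) ω => (V t ω, Q t ω)) ?_ ?_).2 fun J => ?_
  · exact (measurable_pi_iff.2 fun (t : NNReal) => (mU _ (NNReal.coe_nonneg t)).prodMk (h.mQ (NNReal.coe_nonneg t))).aemeasurable
  · exact (measurable_pi_iff.2 fun t => (h.mV t.2).prodMk (h.mQ t.2)).aemeasurable
  refine identDistrib_of_tim
    (f := fun k ω (t : J) => (flipUk (fun s => Y s ω) (fun s => U s ω) k t.1, Q t.1 ω))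
    (f' := fun k ω (t : J) => (V t.1 ω, Q t.1 ω))
    (tim_pi fun t => tim_prod ?_ (tim_const _)) (tim_const _) (Eventually.of_forall fun k => ?_)
  · exact tendstoInMeasure_of_tendsto_ae (fun n => (mk n _ (NNReal.coe_nonneg _)).aestronglyMeasurable)
      (ae_of_all _ fun ω => flipUk_tendsto (hUc ω) (NNReal.coe_nonneg _))
  · have := h.law_transfer (fun s hs => KK_meas h hm k hs) (KK_cases Y k) (mk k)
      (fun t ht => KK_tim hU k ht)
    have hφ : Measurable (fun (π : NNReal → ℝ × ℝ) (t : J) => π t.1) :=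
      measurable_pi_iff.2 fun t => measurable_pi_apply _
    exact this.comp hφ

end ProbFlip

section NoFun
set_option linter.unusedSectionVars false
variable {Ω : Type*} [m : MeasurableSpace Ω] {μ : Measure Ω} {G : ℝ → MeasurableSpace Ω}
  {V Q : ℝ → Ω → ℝ} [IsProbabilityMeasure μ]

/-- first coordinate of a path, as a function on the real line -/
def wp (π : NNReal → ℝ × ℝ) (s : ℝ) : ℝ := (π s.toNNReal).1

lemma measurable_wp (s : ℝ) : Measurable (fun π => wp π s) :=
  measurable_fst.comp (measurable_pi_apply _)

lemma measurable_eul_wp (l x : ℝ) (N k : ℕ) : Measurable (fun π => eul l x (wp π) N k) := by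
  induction k with
  | zero => exact measurable_const
  | succ k ih =>
    simp only [eul]
    exact (ih.add ((measurable_wp _).sub (measurable_wp _))).add
      (((measurable_bfun l).comp ih).const_mul _)

lemma measurable_eulY_wp (l x t : ℝ) : Measurable (fun π => eulY l x (wp π) t) := by
  unfold eulY
  exact (sm_limUnder fun N => (measurable_eul_wp l x N _).stronglyMeasurable).measurable

/-- recovery sums as functionals of the path -/
def sfun (l x : ℝ) (n : ℕ) (t : ℝ) (π : NNReal → ℝ × ℝ) : ℝ :=
  ∑ i ∈ Finset.range ⌊t * 2 ^ n⌋₊, psgn (eulY l x (wp π) (1 / 2 ^ n * (i:ℝ))) *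
    (wp π (1 / 2 ^ n * ((i:ℝ) + 1)) - wp π (1 / 2 ^ n * (i:ℝ)))

lemma measurable_sfun (l x : ℝ) (n : ℕ) (t : ℝ) : Measurable (sfun l x n t) := by
  unfold sfun
  refine Finset.measurable_fun_sum _ fun i _ => ?_
  exact (measurable_psgn.comp (measurable_eulY_wp l x _)).mul ((measurable_wp _).sub (measurable_wp _))

lemma wp_eq {u : ℝ → ℝ} {q : NNReal → ℝ} {s : ℝ} (hs : 0 ≤ s) :
    wp (fun t : NNReal => (u t, q t)) s = u s := by
  unfold wp; simp [hs]

lemma eulY_wp {u y : ℝ → ℝ} {q : NNReal → ℝ} {l x : ℝ} (hl : 0 ≤ l) (hu : Continuous u) (hu0 : u 0 = 0)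
    (hy : Measurable y) (hE : ESol l x u y) {t : ℝ} (ht : 0 ≤ t) :
    eulY l x (wp (fun t : NNReal => (u t, q t))) t = y t := by
  have h1 : ESol l x (wp (fun t : NNReal => (u t, q t))) y := by
    intro s hs
    rw [wp_eq hs]; exact hE s hs
  have h2 : Continuous (wp (fun t : NNReal => (u t, q t))) := by
    unfold wp
    exact hu.comp (NNReal.continuous_coe.comp continuous_real_toNNReal)
  have h3 : wp (fun t : NNReal => (u t, q t)) 0 = 0 := by rw [wp_eq le_rfl]; exact hu0
  exact (h1.eul_tendsto hy hl h2 h3 ht).limUnder_eq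

lemma sfun_wp {u y : ℝ → ℝ} {q : NNReal → ℝ} {l x : ℝ} (hl : 0 ≤ l) (hu : Continuous u) (hu0 : u 0 = 0)
    (hy : Measurable y) (hE : ESol l x u y) (n : ℕ) (t : ℝ) :
    sfun l x n t (fun t : NNReal => (u t, q t)) =
      ∑ i ∈ Finset.range ⌊t * 2 ^ n⌋₊, psgn (y (1 / 2 ^ n * (i:ℝ))) *
        (u (1 / 2 ^ n * ((i:ℝ) + 1)) - u (1 / 2 ^ n * (i:ℝ))) := by
  unfold sfun
  refine Finset.sum_congr rfl fun i _ => ?_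
  rw [eulY_wp hl hu hu0 hy hE (by positivity), wp_eq (by positivity), wp_eq (by positivity)]

theorem flip_pair (h : PB μ G V Q) {l y0 : ℝ} (hl : 0 ≤ l) {Y U : ℝ → Ω → ℝ}
    (hm : ∀ t, 0 ≤ t → Measurable[G t] (Y t)) (hc : ∀ ω, Continuous fun t => Y t ω)
    (hE : ∀ ω, ESol l y0 (fun t => U t ω) (fun t => Y t ω))
    (hUm : ∀ t, 0 ≤ t → Measurable (U t)) (hUc : ∀ ω, Continuous fun t => U t ω) (hU0 : ∀ ω, U 0 ω = 0)
    (hU : ∀ t, 0 ≤ t → TendstoInMeasure μ (fsum (fun t ω => psgn (Y t ω)) V t) atTop (U t))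
    (h0 : ∀ t, 0 < t → μ {ω | Y t ω = 0} = 0) :
    IdentDistrib (fun ω (t : NNReal) => (V t ω, Q t ω)) (fun ω (t : NNReal) => (U t ω, Q t ω)) μ μ ∧
    IdentDistrib (fun ω => (Y 1 ω, fun t : NNReal => (V t ω, Q t ω)))
      (fun ω => (flipY (fun t => Y t ω) 1, fun t : NNReal => (V t ω, Q t ω))) μ μ := by
  have hA : Adm μ G (fun t ω => psgn (Y t ω)) 1 := adm_psgn hm hc h0
  have hm' : ∀ t, 0 ≤ t → Measurable (Y t) := fun t ht => meas_of_le (hm t ht) (h.le t)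
  have law1 := h.law_transfer hA.meas (fun s ω => psgn_cases _) hUm hU
  obtain ⟨mU', law2⟩ := flip_law h hm hUm hUc hU
  have law3 := law1.trans law2.symm
  have hz := zero_set_null (Y := Y) (fun ω => (hc ω).comp (continuous_id.max continuous_const)) hm' h0
  have hd : ∀ᵐ ω ∂μ, ∀ n j : ℕ, 0 < j → Y (1 / 2 ^ n * (j:ℝ)) ω ≠ 0 := by
    rw [ae_all_iff]; intro n
    rw [ae_all_iff]; intro j
    by_cases hj : 0 < j
    · have : (0:ℝ) < 1 / 2 ^ n * (j:ℝ) := by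
        have : (0:ℝ) < j := by exact_mod_cast hj
        positivity
      have : ∀ᵐ ω ∂μ, Y (1 / 2 ^ n * (j:ℝ)) ω ≠ 0 := by
        rw [ae_iff]; simpa using h0 _ this
      filter_upwards [this] with ω hω _ using hω
    · exact ae_of_all _ fun ω hj' => absurd hj' hj
  -- paths
  have mp : Measurable (fun ω (t : NNReal) => (U t ω, Q t ω)) :=
    measurable_pi_iff.2 fun (t : NNReal) => (hUm _ (NNReal.coe_nonneg t)).prodMk (h.mQ (NNReal.coe_nonneg t))
  have mp' : Measurable (fun ω (t : NNReal) => (flipU (fun s => Y s ω) (fun s => U s ω) t, Q t ω)) :=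
    measurable_pi_iff.2 fun (t : NNReal) => (mU' _ (NNReal.coe_nonneg t)).prodMk (h.mQ (NNReal.coe_nonneg t))
  have mpV : Measurable (fun ω (t : NNReal) => (V t ω, Q t ω)) :=
    measurable_pi_iff.2 fun (t : NNReal) => (h.mV (NNReal.coe_nonneg t)).prodMk (h.mQ (NNReal.coe_nonneg t))
  have eY : ∀ ω, eulY l y0 (wp fun t : NNReal => (U t ω, Q t ω)) 1 = Y 1 ω := fun ω =>
    eulY_wp (u := fun s => U s ω) (y := fun s => Y s ω) hl (hUc ω) (hU0 ω) (hc ω).measurable (hE ω) zero_le_one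
  have eS : ∀ n t ω, sfun l y0 n t (fun t : NNReal => (U t ω, Q t ω)) =
      fsum (fun t ω => psgn (Y t ω)) U t n ω := fun n t ω =>
    sfun_wp (u := fun s => U s ω) (y := fun s => Y s ω) hl (hUc ω) (hU0 ω) (hc ω).measurable (hE ω) n t
  have eY' : ∀ᵐ ω ∂μ, eulY l y0 (wp fun t : NNReal => (flipU (fun s => Y s ω) (fun s => U s ω) t, Q t ω)) 1 =
      flipY (fun t => Y t ω) 1 := by
    filter_upwards [hz] with ω hω
    exact eulY_wp (u := flipU (fun s => Y s ω) (fun s => U s ω)) (y := flipY (fun s => Y s ω)) hl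
      (flipU_cont (hUc ω)) (flipU_zero.trans (hU0 ω)) (flipY_meas (hc ω)) (flip_sol hl (hc ω) (hE ω) hω) zero_le_one
  have eS' : ∀ᵐ ω ∂μ, ∀ n t, sfun l y0 n t
        (fun t : NNReal => (flipU (fun s => Y s ω) (fun s => U s ω) t, Q t ω)) =
      ∑ i ∈ Finset.range ⌊t * 2 ^ n⌋₊, psgn (flipY (fun s => Y s ω) (1 / 2 ^ n * (i:ℝ))) *
        (flipU (fun s => Y s ω) (fun s => U s ω) (1 / 2 ^ n * ((i:ℝ) + 1)) -
          flipU (fun s => Y s ω) (fun s => U s ω) (1 / 2 ^ n * (i:ℝ))) := by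
    filter_upwards [hz] with ω hω n t
    exact sfun_wp (u := flipU (fun s => Y s ω) (fun s => U s ω)) (y := flipY (fun s => Y s ω)) hl
      (flipU_cont (hUc ω)) (flipU_zero.trans (hU0 ω)) (flipY_meas (hc ω)) (flip_sol hl (hc ω) (hE ω) hω) n t
  have tS : ∀ t, 0 ≤ t → TendstoInMeasure μ (fun n ω => sfun l y0 n t (fun t : NNReal => (U t ω, Q t ω)))
      atTop (V t) := by
    intro t ht
    simp only [eS]
    exact recov hA (fun s ω => psgn_mul_self _) h hU ht
  have tS' : ∀ t, 0 ≤ t → TendstoInMeasure μ (fun n ω => sfun l y0 n t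
      (fun t : NNReal => (flipU (fun s => Y s ω) (fun s => U s ω) t, Q t ω))) atTop (V t) := by
    intro t ht
    have hdiff : TendstoInMeasure μ (fun n ω => sfun l y0 n t
      (fun t : NNReal => (flipU (fun s => Y s ω) (fun s => U s ω) t, Q t ω)) -
        sfun l y0 n t (fun t : NNReal => (U t ω, Q t ω))) atTop (fun _ => (0:ℝ)) := by
      refine tendstoInMeasure_of_tendsto_ae (fun n => ?_) ?_
      · exact (((measurable_sfun l y0 n t).comp mp').sub
          ((measurable_sfun l y0 n t).comp mp)).aestronglyMeasurable
      · filter_upwards [eS', hd] with ω h1 h2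
        simp only [h1, eS]
        exact flip_sum (hc ω) (hUc ω) h2 ht
    have := tim_add hdiff (tS t ht)
    simpa using this
  refine ⟨law1.symm, ?_⟩
  have aeY' : AEMeasurable (fun ω => flipY (fun t => Y t ω) 1) μ :=
    (((measurable_eulY_wp l y0 1).comp mp').aemeasurable).congr eY'
  have key : IdentDistrib (fun ω (t : NNReal) => (Y 1 ω, (V t ω, Q t ω)))
      (fun ω (t : NNReal) => (flipY (fun t => Y t ω) 1, (V t ω, Q t ω))) μ μ := by
    refine (identDistrib_iff_forall_finset_identDistrib
      (X := fun (t : NNReal) ω => (Y 1 ω, (V t ω, Q t ω)))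
      (Y := fun (t : NNReal) ω => (flipY (fun t => Y t ω) 1, (V t ω, Q t ω))) ?_ ?_).2 fun J => ?_
    · exact (measurable_pi_iff.2 fun (t : NNReal) => (hm' 1 zero_le_one).prodMk
        ((h.mV (NNReal.coe_nonneg t)).prodMk (h.mQ (NNReal.coe_nonneg t)))).aemeasurable
    · have hψ : Measurable (fun (q : ℝ × (NNReal → ℝ × ℝ)) (t : NNReal) => (q.1, q.2 t)) :=
        measurable_pi_iff.2 fun t => measurable_fst.prodMk ((measurable_pi_apply t).comp measurable_snd)
      exact hψ.comp_aemeasurable (aeY'.prodMk mpV.aemeasurable)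
    refine identDistrib_of_tim
      (f := fun n ω (t : J) => (eulY l y0 (wp fun t : NNReal => (U t ω, Q t ω)) 1,
        (sfun l y0 n t.1 (fun t : NNReal => (U t ω, Q t ω)), Q t.1 ω)))
      (f' := fun n ω (t : J) =>
        (eulY l y0 (wp fun t : NNReal => (flipU (fun s => Y s ω) (fun s => U s ω) t, Q t ω)) 1,
        (sfun l y0 n t.1 (fun t : NNReal => (flipU (fun s => Y s ω) (fun s => U s ω) t, Q t ω)), Q t.1 ω)))
      (tim_pi fun t => tim_prod ?_ (tim_prod (tS _ (NNReal.coe_nonneg _)) (tim_const _)))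
      (tim_pi fun t => tim_prod ?_ (tim_prod (tS' _ (NNReal.coe_nonneg _)) (tim_const _)))
      (Eventually.of_forall fun n => ?_)
    · simp only [eY]; exact tim_const _
    · exact (tim_const _).congr_right eY'
    · have hφ : Measurable (fun (π : NNReal → ℝ × ℝ) (t : J) =>
          (eulY l y0 (wp π) 1, (sfun l y0 n t.1 π, (π t.1).2))) :=
        measurable_pi_iff.2 fun t => (measurable_eulY_wp l y0 1).prodMk
          ((measurable_sfun l y0 n _).prodMk (measurable_snd.comp (measurable_pi_apply _)))
      exact law3.comp hφ
  have hψ : Measurable (fun π : NNReal → ℝ × (ℝ × ℝ) => ((π 0).1, fun t => (π t).2)) :=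
    (measurable_fst.comp (measurable_pi_apply _)).prodMk
      (measurable_pi_iff.2 fun t => measurable_snd.comp (measurable_pi_apply _))
  exact key.comp hψ

theorem no_fun (h : PB μ G V Q) {l y0 : ℝ} (hl : 0 ≤ l) {Y U : ℝ → Ω → ℝ}
    (hm : ∀ t, 0 ≤ t → Measurable[G t] (Y t)) (hc : ∀ ω, Continuous fun t => Y t ω)
    (hY0 : ∀ ω, Y 0 ω = y0)
    (hE : ∀ ω, ESol l y0 (fun t => U t ω) (fun t => Y t ω))
    (hUm : ∀ t, 0 ≤ t → Measurable (U t)) (hUc : ∀ ω, Continuous fun t => U t ω) (hU0 : ∀ ω, U 0 ω = 0)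
    (hU : ∀ t, 0 ≤ t → TendstoInMeasure μ (fsum (fun t ω => psgn (Y t ω)) V t) atTop (U t))
    (h0 : ∀ t, 0 < t → μ {ω | Y t ω = 0} = 0)
    {φ : (NNReal → ℝ × ℝ) → ℝ} (hφ : Measurable φ)
    (hYφ : ∀ᵐ ω ∂μ, Y 1 ω = φ (fun t => (V t ω, Q t ω))) : False := by
  obtain ⟨l1, l2⟩ := flip_pair h hl hm hc hE hUm hUc hU0 hU h0
  have hms : MeasurableSet {p : ℝ × (NNReal → ℝ × ℝ) | p.1 = φ p.2} :=
    measurableSet_eq_fun measurable_fst (hφ.comp measurable_snd)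
  have h1 := l2.ae_mem_snd (t := {p : ℝ × (NNReal → ℝ × ℝ) | p.1 = φ p.2}) hms hYφ
  have h10 : ∀ᵐ ω ∂μ, Y 1 ω ≠ 0 := by
    rw [ae_iff]; simpa using h0 1 one_pos
  have hs : ∀ᵐ ω ∂μ, psgn (Y 1 ω) = psgn y0 := by
    filter_upwards [h1, hYφ, h10] with ω a b c
    have e : flipY (fun t => Y t ω) 1 = Y 1 ω := a.trans b.symm
    have hD : ¬ DD (fun t => Y t ω) 1 := by
      intro hD
      unfold flipY at e
      rw [if_pos hD] at e
      exact c (by linarith)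
    by_contra hcon
    refine hD ⟨1, ⟨0, 1, by norm_num, ?_⟩, le_rfl⟩
    unfold bad
    simpa [hY0] using hcon
  have hbd : ∀ ω, |Y 1 ω - y0 - U 1 ω| ≤ l := by
    intro ω
    have := hE ω 1 zero_le_one
    have e : Y 1 ω - y0 - U 1 ω = ∫ s in (0:ℝ)..1, bfun l (Y s ω) := by linarith
    rw [e]
    simpa using abs_int_b hl (fun s => Y s ω) 0 1
  have lawU : IdentDistrib (U 1) (V 1) μ μ := by
    have hp : Measurable (fun π : NNReal → ℝ × ℝ => (π 1).1) :=
      measurable_fst.comp (measurable_pi_apply _)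
    simpa [Function.comp_def] using (l1.symm.comp hp)
  have lawV : μ.map (V 1) = gaussianReal 0 1 := by
    have := h.lawV le_rfl zero_le_one
    simpa [h.V0] using this
  have pos : ∀ A : Set ℝ, MeasurableSet A → (∀ᵐ ω ∂μ, U 1 ω ∉ A) → volume A = 0 := by
    intro A hA hn
    refine gaussianReal_absolutelyContinuous' 0 one_ne_zero ?_
    rw [← lawV, ← lawU.map_eq, Measure.map_apply (hUm 1 zero_le_one) hA]
    have h3 : {ω | ¬ U 1 ω ∉ A} = U 1 ⁻¹' A := by ext ω; simp
    rw [ae_iff, h3] at hn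
    exact hn
  rcases psgn_cases y0 with hy | hy
  · have := pos (Iio (-y0 - l)) measurableSet_Iio (by
      filter_upwards [hs] with ω hω
      rw [hy] at hω
      have hp : 0 < Y 1 ω := by
        by_contra hc
        unfold psgn at hω
        rw [if_neg hc] at hω
        norm_num at hω
      have := abs_le.1 (hbd ω)
      simp only [mem_Iio, not_lt]
      linarith [this.2])
    simp at this
  · have := pos (Ioi (-y0 + l)) measurableSet_Ioi (by
      filter_upwards [hs] with ω hω
      rw [hy] at hω
      have hp : ¬ 0 < Y 1 ω := by
        intro hc
        unfold psgn at hω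
        rw [if_pos hc] at hω
        norm_num at hω
      have := abs_le.1 (hbd ω)
      simp only [mem_Ioi, not_lt]
      linarith [this.1])
    simp at this

end NoFun

section No214
set_option linter.unusedSectionVars false
variable {Ω : Type*} [m : MeasurableSpace Ω] {μ : Measure Ω} [IsProbabilityMeasure μ]

lemma natSA_le_comap (V₁ V₂ : ℝ → Ω → ℝ) (T : ℝ) :
    natSA (fun s ω => (V₁ s ω, V₂ s ω)) T ≤
      MeasurableSpace.comap (fun ω (t : NNReal) => (V₁ t ω, V₂ t ω)) MeasurableSpace.pi := by
  unfold natSA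
  refine iSup₂_le fun s hs => ?_
  have e : (fun ω => (V₁ s ω, V₂ s ω)) =
      (fun π : NNReal → ℝ × ℝ => π ⟨s, hs.1⟩) ∘ (fun ω (t : NNReal) => (V₁ t ω, V₂ t ω)) := rfl
  dsimp only
  rw [e, ← MeasurableSpace.comap_comp]
  exact MeasurableSpace.comap_mono (measurable_pi_apply _).comap_le

lemma exists_fun {V₁ V₂ : ℝ → Ω → ℝ} {f : Ω → ℝ} {T : ℝ} (hf : Measurable[Gf μ V₁ V₂ T] f) :
    ∃ φ : (NNReal → ℝ × ℝ) → ℝ, Measurable φ ∧ ∀ᵐ ω ∂μ, f ω = φ (fun t => (V₁ t ω, V₂ t ω)) := by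
  obtain ⟨f', h1, h2⟩ := aesm_of_Gf hf
  have h3 : Measurable[MeasurableSpace.comap (fun ω (t : NNReal) => (V₁ t ω, V₂ t ω)) MeasurableSpace.pi] f' :=
    meas_of_le h1.measurable (natSA_le_comap V₁ V₂ T)
  obtain ⟨φ, hφ, e⟩ := h3.exists_eq_measurable_comp
  refine ⟨φ, hφ, ?_⟩
  filter_upwards [h2] with ω hω
  rw [hω, e]; rfl

theorem no214 {F : ℝ → MeasurableSpace Ω} {g h ρ σ x₁ x₂ : ℝ} (hgh : 0 ≤ g + h)
    (hnorm : ρ ^ 2 + σ ^ 2 = 1) {V₁ V₂ X₁ X₂ : ℝ → Ω → ℝ} (hV : IsPlanarBM μ F V₁ V₂)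
    (hX : Solves214 μ F g h ρ σ x₁ x₂ V₁ V₂ X₁ X₂)
    (hA : ∀ t : ℝ, 0 ≤ t → natFilt μ (fun s ω => (X₁ s ω, X₂ s ω)) t ≤
      natFilt μ (fun s ω => (V₁ s ω, V₂ s ω)) t) : False := by
  obtain ⟨U₁, U₂, hUV, hpb⟩ := exists_pb hV
  have pb := hpb ρ (-σ) (by rw [neg_sq]; exact hnorm)
  obtain ⟨had, hcX, I₁, I₂, hI1, hI2, he⟩ := hX
  set l := g + h with hl
  set y0 := x₁ - x₂ with hy0
  -- measurability of the difference
  have hXG : ∀ t, 0 ≤ t → Measurable[Gf μ V₁ V₂ t] (fun ω => X₁ t ω - X₂ t ω) := by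
    intro t ht
    have hle : MeasurableSpace.comap (fun ω => (X₁ t ω, X₂ t ω)) inferInstance ≤ Gf μ V₁ V₂ t := by
      refine le_trans (le_inf ?_ ((had t ht).trans (hV.1.le t))) (natFilt_inf_le_Gf V₁ V₂ t)
      refine le_trans ?_ (hA t ht)
      refine le_trans ?_ (le_sup_left : natSA (fun s ω => (X₁ s ω, X₂ s ω)) t ≤ _)
      exact le_iSup₂ (f := fun s (_ : s ∈ Icc (0:ℝ) t) =>
        MeasurableSpace.comap (fun ω => (X₁ s ω, X₂ s ω)) inferInstance) t ⟨ht, le_rfl⟩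
    have hp : Measurable[Gf μ V₁ V₂ t] (fun ω => (X₁ t ω, X₂ t ω)) := measurable_of_comap_le hle
    exact (measurable_fst.comp hp).sub (measurable_snd.comp hp)
  -- a null set outside of which everything is good
  have hgood : ∀ᵐ ω ∂μ, (Continuous fun t => X₁ t ω - X₂ t ω) ∧ X₁ 0 ω - X₂ 0 ω = y0 := by
    filter_upwards [hcX, he, hI1.1, hI2.1] with ω h1 h2 h3 h4
    refine ⟨h1.1.sub h1.2, ?_⟩
    have := h2 0 le_rfl
    rw [this.1, this.2, h3, h4]
    simp [hy0]
  obtain ⟨N, hNs, hNm, hN0⟩ := exists_measurable_superset_of_null (ae_iff.1 hgood)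
  have hN : ∀ ω, ω ∉ N → (Continuous fun t => X₁ t ω - X₂ t ω) ∧ X₁ 0 ω - X₂ 0 ω = y0 := by
    intro ω hω
    by_contra hc
    exact hω (hNs hc)
  have hNae : ∀ᵐ ω ∂μ, ω ∉ N := by
    rw [ae_iff]; simpa using hN0
  classical
  set Y : ℝ → Ω → ℝ := fun t ω => if ω ∈ N then y0 else X₁ t ω - X₂ t ω with hY
  have hYX : ∀ᵐ ω ∂μ, ∀ t, Y t ω = X₁ t ω - X₂ t ω := by
    filter_upwards [hNae] with ω hω t
    simp only [hY, if_neg hω]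
  have hYc : ∀ ω, Continuous fun t => Y t ω := by
    intro ω
    by_cases hω : ω ∈ N
    · simp only [hY, if_pos hω]; exact continuous_const
    · simp only [hY, if_neg hω]; exact (hN ω hω).1
  have hY0 : ∀ ω, Y 0 ω = y0 := by
    intro ω
    by_cases hω : ω ∈ N
    · simp only [hY, if_pos hω]
    · simp only [hY, if_neg hω]; exact (hN ω hω).2
  have hYm : ∀ t, 0 ≤ t → Measurable[Gf μ V₁ V₂ t] (Y t) := by
    intro t ht
    exact Measurable.ite (Gf_null V₁ V₂ t hNm hN0) measurable_const (hXG t ht)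
  set B : ℝ → Ω → ℝ := fun t ω => y0 + ∫ s in (0:ℝ)..t, bfun l (Y s ω) with hB
  have hBm : ∀ t, 0 ≤ t → Measurable[Gf μ V₁ V₂ t] (B t) := by
    intro t ht
    refine Measurable.const_add ?_ _
    exact @meas_int_b Ω (Gf μ V₁ V₂ t) Y l t ht hYc
      (fun s hs hst => meas_of_le (hYm s hs) (Gf_mono V₁ V₂ hst))
  have hBc : ∀ ω, Continuous fun t => B t ω := fun ω =>
    continuous_const.add (cont_prim hgh (hYc ω).measurable)
  set U : ℝ → Ω → ℝ := fun t ω => Y t ω - B t ω with hU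
  have hUm : ∀ t, 0 ≤ t → Measurable (U t) := fun t ht =>
    (meas_of_le (hYm t ht) (Gf_le V₁ V₂ t)).sub (meas_of_le (hBm t ht) (Gf_le V₁ V₂ t))
  have hlimr : ∀ t, 0 ≤ t → TendstoInMeasure μ (rsum (fun t ω => psgn (Y t ω))
      (fun t ω => ρ * U₁ t ω + -σ * U₂ t ω) t) atTop (U t) := by
    intro t ht
    refine ((tim_sub (hI1.2 t ht) (hI2.2 t ht)).congr_left (g := I₁ t - I₂ t) fun n => ?_).congr_right ?_
    · filter_upwards [hUV, hYX] with ω h1 h2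
      unfold rsum
      rw [← Finset.sum_add_distrib, ← Finset.sum_add_distrib, ← Finset.sum_sub_distrib]
      refine Finset.sum_congr rfl fun i _ => ?_
      dsimp only
      simp only [fun s => (h1 s).1, fun s => (h1 s).2, h2]
      unfold psgn
      by_cases hc : X₁ (t * i / 2 ^ n) ω ≤ X₂ (t * i / 2 ^ n) ω
      · rw [if_pos hc, if_pos hc, if_pos hc, if_pos hc, if_neg (by linarith)]; ring
      · rw [if_neg hc, if_neg hc, if_neg hc, if_neg hc, if_pos (by linarith)]; ring
    · filter_upwards [hYX, hcX, he] with ω h1 h2 h3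
      have := diff_eq h2.1 h2.2 h3 ht
      simp only [hU, hB, h1, Pi.sub_apply]
      linarith
  have h0 : ∀ t, 0 < t → μ {ω | Y t ω = 0} = 0 := by
    intro t ht
    have := pb.no_atom (K := fun t ω => psgn (Y t ω)) (fun s hs => measurable_psgn.comp (hYm s hs))
      (fun s ω => psgn_cases _) ht (hlimr t ht.le) hgh (B := B) (fun s hs _ => hBm s hs)
      (fun s hs hst => ae_of_all _ fun ω => by
        have e : B t ω - B s ω = ∫ r in s..t, bfun l (Y r ω) := by
          simp only [hB]
          rw [add_sub_add_left_eq_sub, intervalIntegral.integral_interval_sub_left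
            (intble_b hgh (hYc ω).measurable _ _) (intble_b hgh (hYc ω).measurable _ _)]
        rw [e]
        refine (abs_int_b hgh _ _ _).trans_eq ?_
        rw [abs_of_nonneg (by linarith)])
    simpa [hU] using this
  have hAdm : Adm μ (Gf μ V₁ V₂) (fun t ω => psgn (Y t ω)) 1 := adm_psgn hYm hYc h0
  obtain ⟨φ, hφ, hφe⟩ := exists_fun (hYm 1 zero_le_one)
  refine no_fun pb (l := l) (y0 := y0) hgh hYm hYc hY0 (U := U) ?_ hUm (fun ω => (hYc ω).sub (hBc ω)) ?_
    (fun t ht => hAdm.tim_fsum pb ht (hlimr t ht)) h0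
    (φ := fun π => φ (fun t => (ρ * (π t).1 + σ * (π t).2, -σ * (π t).1 + ρ * (π t).2))) ?_ ?_
  · intro ω t ht
    simp only [hU, hB]; ring
  · intro ω
    simp only [hU, hB, hY0]; simp
  · refine hφ.comp (measurable_pi_iff.2 fun t => ?_)
    have h1 : Measurable (fun π : NNReal → ℝ × ℝ => (π t).1) := measurable_fst.comp (measurable_pi_apply t)
    have h2 : Measurable (fun π : NNReal → ℝ × ℝ => (π t).2) := measurable_snd.comp (measurable_pi_apply t)
    exact ((h1.const_mul _).add (h2.const_mul _)).prodMk ((h1.const_mul _).add (h2.const_mul _))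
  · filter_upwards [hφe, hUV] with ω h1 h2
    rw [h1]
    congr 1
    ext t
    · dsimp only
      rw [(h2 t).1, (h2 t).2]
      linear_combination (-(V₁ t ω)) * hnorm
    · dsimp only
      rw [(h2 t).1, (h2 t).2]
      linear_combination (-(V₂ t ω)) * hnorm

end No214


/-- second part of Theorem 2 of the paper; non-degenerate case
`ρσ > 0`.  The system (2.12)-(2.13) admits a strong solution — one adapted to the
augmented filtration of the driving planar Brownian motion `(W₁,W₂)` — and is
therefore pathwise unique; whereas the system (2.14)-(2.15), driven by a planar
Brownian motion `(V₁,V₂)`, admits no strong solution. -/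
theorem nondegenerate_strong_212_and_no_strong_214
    (g h ρ σ : ℝ) (hg : 0 ≤ g) (hh : 0 ≤ h) (hρ : 0 ≤ ρ) (hσ : 0 ≤ σ)
    (hnorm : ρ ^ 2 + σ ^ 2 = 1) (hgh : 0 < g + h) (hnd : 0 < ρ * σ) (x₁ x₂ : ℝ) :
    (∀ (Ω : Type) [mΩ : MeasurableSpace Ω] (μ : Measure Ω) [IsProbabilityMeasure μ]
        (F : ℝ → MeasurableSpace Ω) (W₁ W₂ : ℝ → Ω → ℝ),
      IsPlanarBM μ F W₁ W₂ →
        ∃ X₁ X₂ : ℝ → Ω → ℝ, Solves212 μ F g h ρ σ x₁ x₂ W₁ W₂ X₁ X₂ ∧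
          ∀ t : ℝ, 0 ≤ t →
            natFilt μ (fun s ω => (X₁ s ω, X₂ s ω)) t ≤
              natFilt μ (fun s ω => (W₁ s ω, W₂ s ω)) t) ∧
    (∀ (Ω : Type) [mΩ : MeasurableSpace Ω] (μ : Measure Ω) [IsProbabilityMeasure μ]
        (F : ℝ → MeasurableSpace Ω) (W₁ W₂ X₁ X₂ X₁' X₂' : ℝ → Ω → ℝ),
      IsPlanarBM μ F W₁ W₂ →
        Solves212 μ F g h ρ σ x₁ x₂ W₁ W₂ X₁ X₂ →
        Solves212 μ F g h ρ σ x₁ x₂ W₁ W₂ X₁' X₂' →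
        ∀ᵐ ω ∂μ, ∀ t : ℝ, 0 ≤ t → X₁ t ω = X₁' t ω ∧ X₂ t ω = X₂' t ω) ∧
    (∀ (Ω : Type) [mΩ : MeasurableSpace Ω] (μ : Measure Ω) [IsProbabilityMeasure μ]
        (F : ℝ → MeasurableSpace Ω) (V₁ V₂ : ℝ → Ω → ℝ),
      IsPlanarBM μ F V₁ V₂ →
        ¬ ∃ X₁ X₂ : ℝ → Ω → ℝ, Solves214 μ F g h ρ σ x₁ x₂ V₁ V₂ X₁ X₂ ∧
            ∀ t : ℝ, 0 ≤ t →
              natFilt μ (fun s ω => (X₁ s ω, X₂ s ω)) t ≤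
                natFilt μ (fun s ω => (V₁ s ω, V₂ s ω)) t) := by
  refine ⟨fun Ω _ μ _ F W₁ W₂ hW => exist212 x₁ x₂ hgh.le hnorm hW,
    fun Ω _ μ _ F W₁ W₂ X₁ X₂ X₁' X₂' hW hX hX' => uniq212 hgh.le hW hX hX', ?_⟩
  rintro Ω _ μ _ F V₁ V₂ hV ⟨X₁, X₂, hX, hA⟩
  exact no214 hgh.le hnorm hV hX hA

end SDEPaper
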